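/- arXiv:1609.05824 — 7 statements merged into one kernel-verified Lean document; each statement's English description precedes it below -/
import Mathlib

section
/- If G is a finite simple graph with maximum average degree mad(G) < 18/7, then the list 3-dynamic chromatic number of G satisfies ch_3^d(G) ≤ 6. -/
open SimpleGraph

/-- `φ` is a proper coloring of `G` that is 3-dynamic: every vertex `v` sees at least
`min 3 (deg v)` distinct colors on its neighborhood. -/
def IsDyn3Coloring {V : Type*} (G : SimpleGraph V) (φ : V → ℕ) : Prop :=
  (∀ u v, G.Adj u v → φ u ≠ φ v) ∧
  ∀ v, min 3 (G.neighborSet v).ncard ≤ (φ '' G.neighborSet v).ncard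

/-- `G` is 3-dynamically colorable from the list assignment `L`. -/
def Dyn3ListColorable {V : Type*} (G : SimpleGraph V) (L : V → Finset ℕ) : Prop :=
  ∃ φ : V → ℕ, IsDyn3Coloring G φ ∧ ∀ v, φ v ∈ L v

/-- `ch_3^d(G) ≤ k` : `G` is 3-dynamically `L`-colorable for every list assignment `L`
with `|L v| ≥ k` for all `v`. -/
def Ch3dLE {V : Type*} (G : SimpleGraph V) (k : ℕ) : Prop :=
  ∀ L : V → Finset ℕ, (∀ v, k ≤ (L v).card) → Dyn3ListColorable G L

/-- `mad(G) < c` : every nonempty subgraph has average degree `< c`. -/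
def MadLT {V : Type*} (G : SimpleGraph V) (c : ℚ) : Prop :=
  ∀ H : G.Subgraph, H.verts.Nonempty →
    (2 * H.edgeSet.ncard : ℚ) / (H.verts.ncard : ℚ) < c

/-- `mad(G) ≤ c` : every nonempty subgraph has average degree `≤ c`. -/
def MadLE {V : Type*} (G : SimpleGraph V) (c : ℚ) : Prop :=
  ∀ H : G.Subgraph, H.verts.Nonempty →
    (2 * H.edgeSet.ncard : ℚ) / (H.verts.ncard : ℚ) ≤ c

/-- Every proper subgraph of `G` (deleting at least one vertex or edge) has
`ch_3^d ≤ k`. -/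
def ProperSubgraphsCh3dLE {V : Type*} (G : SimpleGraph V) (k : ℕ) : Prop :=
  ∀ H : G.Subgraph, H ≠ ⊤ → Ch3dLE H.coe k

/-- `x ∈ W_i(G)` : `x` has degree 3 and exactly `i` neighbors of degree 2. -/
def Wmem {V : Type*} (G : SimpleGraph V) (i : ℕ) (x : V) : Prop :=
  (G.neighborSet x).ncard = 3 ∧
    {y | G.Adj x y ∧ (G.neighborSet y).ncard = 2}.ncard = i

/-- `y` is a weak neighbor of `x` : they are distinct and have a common neighbor of
degree 2. -/
def WeakAdj {V : Type*} (G : SimpleGraph V) (x y : V) : Prop :=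
  x ≠ y ∧ ∃ w, G.Adj x w ∧ G.Adj y w ∧ (G.neighborSet w).ncard = 2

set_option linter.unusedSectionVars false
namespace Dyn3
open Finset
open scoped Classical

noncomputable def nb {V : Type*} [Fintype V] (G : SimpleGraph V) (v : V) : Finset V :=
  univ.filter (fun u => G.Adj v u)

theorem mem_nb {V : Type*} [Fintype V] {G : SimpleGraph V} {v u : V} :
    u ∈ nb G v ↔ G.Adj v u := by simp [nb]

/-- list colorability of `F[U]` from `A` -/
def LC {V : Type*} (F : SimpleGraph V) (U : Finset V) (A : V → Finset ℕ) : Prop :=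
  ∃ ψ : V → ℕ, (∀ v ∈ U, ψ v ∈ A v) ∧ ∀ a ∈ U, ∀ b ∈ U, F.Adj a b → ψ a ≠ ψ b

noncomputable def upd {V : Type*} (F : SimpleGraph V) (A : V → Finset ℕ) (u : V) (c : ℕ) :
    V → Finset ℕ := fun v => if F.Adj u v then (A v).erase c else A v

noncomputable def dg {V : Type*} (F : SimpleGraph V) (U : Finset V) (v : V) : ℕ :=
  (U.filter (fun u => F.Adj v u)).card

noncomputable def ex {V : Type*} (F : SimpleGraph V) (U : Finset V) (A : V → Finset ℕ)
    (v : V) : ℤ := ((A v).card : ℤ) - (dg F U v : ℤ)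

section abs
variable {V : Type*} {F : SimpleGraph V} {U : Finset V} {A : V → Finset ℕ}

theorem card_A (v : V) : ((A v).card : ℤ) = ex F U A v + dg F U v := by simp [ex]

theorem LC_step {u : V} {c : ℕ} (hu : u ∈ U) (hc : c ∈ A u)
    (h : LC F (U.erase u) (upd F A u c)) : LC F U A := by
  obtain ⟨ψ, h1, h2⟩ := h
  refine ⟨fun v => if v = u then c else ψ v, ?_, ?_⟩
  · intro v hv
    by_cases hvu : v = u
    · simp [hvu, hc]
    · have := h1 v (by simp [hvu, hv])
      simp only [hvu, if_false]
      unfold upd at this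
      split_ifs at this
      · exact (mem_erase.1 this).2
      · exact this
  · have key : ∀ b ∈ U, b ≠ u → F.Adj u b → ψ b ≠ c := by
      intro b hb hbu hadj
      have := h1 b (by simp [hbu, hb])
      simp only [upd, hadj, if_true] at this
      exact (mem_erase.1 this).1
    intro a ha b hb hab
    by_cases hau : a = u <;> by_cases hbu : b = u
    · subst hau; subst hbu; exact absurd hab (F.loopless.irrefl _)
    · subst hau; simp only [hbu, if_true, if_false]; exact (key b hb hbu hab).symm
    · subst hbu; simp only [hau, if_true, if_false]; exact key a ha hau hab.symm
    · simp only [hau, hbu, if_false]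
      exact h2 a (by simp [hau, ha]) b (by simp [hbu, hb]) hab

theorem dg_erase_adj {u v : V} (hu : u ∈ U) (h : F.Adj v u) :
    dg F (U.erase u) v + 1 = dg F U v := by
  unfold dg
  rw [filter_erase]
  exact card_erase_add_one (by simp [hu, h])

theorem dg_erase_not {u v : V} (h : ¬ F.Adj v u) :
    dg F (U.erase u) v = dg F U v := by
  unfold dg
  rw [filter_erase, erase_eq_of_notMem (by simp [h])]

theorem ex_step {u : V} (hu : u ∈ U) (c : ℕ) (v : V) :
    ex F U A v ≤ ex F (U.erase u) (upd F A u c) v := by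
  unfold ex
  by_cases h : F.Adj u v
  · have h1 := dg_erase_adj hu h.symm
    have h2 : (A v).card ≤ ((A v).erase c).card + 1 := by
      have := pred_card_le_card_erase (s := A v) (a := c); omega
    simp only [upd, h, if_true]; omega
  · have h1 := dg_erase_not (U := U) (fun h' => h (SimpleGraph.Adj.symm h') : ¬ F.Adj v u)
    simp only [upd, h, if_false]; omega

theorem ex_gain {u v : V} {c : ℕ} (hu : u ∈ U) (h : F.Adj u v) (hc : c ∉ A v) :
    ex F U A v + 1 ≤ ex F (U.erase u) (upd F A u c) v := by
  unfold ex
  have h1 := dg_erase_adj hu h.symm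
  simp only [upd, h, if_true, erase_eq_of_notMem hc]; omega

/-- coloring `p` and `q` with the same color gains at common neighbors -/
theorem ex_gain2 {p q v : V} {c : ℕ} (hp : p ∈ U) (hq : q ∈ U) (hpq : p ≠ q)
    (h : F.Adj p v) (h' : F.Adj q v) :
    ex F U A v + 1 ≤ ex F ((U.erase p).erase q) (upd F (upd F A p c) q c) v := by
  have h1 := ex_step (F := F) (A := A) hp c v
  have h2 := ex_gain (A := upd F A p c) (c := c) (mem_erase.2 ⟨hpq.symm, hq⟩) h'
    (by simp [upd, h])
  omega

theorem upd_not {p q : V} {c : ℕ} (h : ¬ F.Adj p q) : upd F A p c q = A q := by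
  simp [upd, h]

noncomputable def GOk (F : SimpleGraph V) (s : V → ℤ) : List V → Prop
  | [] => True
  | v :: t => 1 ≤ s v + ((t.toFinset.filter (fun u => F.Adj v u)).card : ℤ) ∧ GOk F s t

theorem greedy (s : V → ℤ) : ∀ (l : List V) (U : Finset V) (A : V → Finset ℕ),
    (∀ v, v ∈ U ↔ v ∈ l) → l.Nodup → (∀ v ∈ l, s v ≤ ex F U A v) → GOk F s l → LC F U A
  | [], U, A, hU, _, _, _ => ⟨fun _ => 0, by simp [hU], by simp [hU]⟩
  | v :: t, U, A, hU, hn, hs, hg => by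
    have hvU : v ∈ U := by simp [hU]
    have hd : dg F U v = (t.toFinset.filter (fun u => F.Adj v u)).card := by
      unfold dg
      congr 1
      ext u
      simp only [mem_filter, hU, List.mem_cons, List.mem_toFinset]
      constructor
      · rintro ⟨rfl | h, h'⟩
        · exact absurd h' (F.loopless.irrefl _)
        · exact ⟨h, h'⟩
      · tauto
    have hc : 0 < (A v).card := by
      have h1 := hs v (by simp)
      have h2 := hg.1
      rw [← hd] at h2
      have h3 := card_A (F := F) (U := U) (A := A) v
      omega
    obtain ⟨c, hc⟩ := card_pos.1 hc
    refine LC_step hvU hc (greedy s t _ _ ?_ (List.nodup_cons.1 hn).2 ?_ hg.2)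
    · intro w
      simp only [mem_erase, hU, List.mem_cons]
      constructor
      · tauto
      · intro h
        refine ⟨?_, Or.inr h⟩
        rintro rfl
        exact (List.nodup_cons.1 hn).1 h
    · intro w hw
      exact (hs w (by simp [hw])).trans (ex_step hvU c w)

theorem cnt1 {v a : V} {t : List V} (ha : a ∈ t) (h : F.Adj v a) :
    (1:ℤ) ≤ ((t.toFinset.filter (fun u => F.Adj v u)).card : ℤ) := by
  have : 0 < (t.toFinset.filter (fun u => F.Adj v u)).card :=
    card_pos.2 ⟨a, by simp [ha, h]⟩
  omega

theorem cnt2 {v a b : V} {t : List V} (ha : a ∈ t) (h : F.Adj v a)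
    (hb : b ∈ t) (h' : F.Adj v b) (hab : a ≠ b) :
    (2:ℤ) ≤ ((t.toFinset.filter (fun u => F.Adj v u)).card : ℤ) := by
  have : 1 < (t.toFinset.filter (fun u => F.Adj v u)).card :=
    one_lt_card.2 ⟨a, by simp [ha, h], b, by simp [hb, h'], hab⟩
  omega

theorem GOk_nil {s : V → ℤ} : GOk F s [] := trivial

theorem GOk0 {s : V → ℤ} {v : V} {t : List V} (h : 1 ≤ s v) (ht : GOk F s t) :
    GOk F s (v :: t) := ⟨by omega, ht⟩

theorem GOk1 {s : V → ℤ} {v : V} {t : List V} (a : V) (h : 0 ≤ s v) (h' : F.Adj v a)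
    (ha : a ∈ t) (ht : GOk F s t) : GOk F s (v :: t) :=
  ⟨by have := cnt1 ha h'; omega, ht⟩

theorem GOk2 {s : V → ℤ} {v : V} {t : List V} (a b : V) (h : -1 ≤ s v) (h' : F.Adj v a)
    (h'' : F.Adj v b) (hab : a ≠ b) (ha : a ∈ t) (hb : b ∈ t)
    (ht : GOk F s t) : GOk F s (v :: t) :=
  ⟨by have := cnt2 ha h' hb h'' hab; omega, ht⟩

theorem LC_greedy {l : List V} (hU : ∀ v, v ∈ U ↔ v ∈ l) (hn : l.Nodup)
    (hg : GOk F (ex F U A) l) : LC F U A :=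
  greedy (ex F U A) l U A hU hn (fun _ _ => le_rfl) hg

/-- hub lemma -/
theorem hub {h r : V} : ∀ (n : ℕ) (U : Finset V) (A : V → Finset ℕ), U.card = n →
    h ∈ U → r ∈ U → (∀ v ∈ U, v ≠ h → F.Adj v h) → (∀ v ∈ U, 0 ≤ ex F U A v) →
    1 ≤ ex F U A r → LC F U A := by
  intro n
  induction n with
  | zero => intro U A hU hh; simp [card_eq_zero.1 hU] at hh
  | succ n ih =>
    intro U A hU hh hr hadj h0 h1
    by_cases hex : ∃ v ∈ U, v ≠ h ∧ v ≠ r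
    · obtain ⟨v, hv, hvh, hvr⟩ := hex
      have hpos : 0 < (A v).card := by
        have h3 := card_A (F := F) (U := U) (A := A) v
        have h4 := h0 v hv
        have h5 : 0 < dg F U v := card_pos.2 ⟨h, by simp [hh, hadj v hv hvh]⟩
        omega
      obtain ⟨c, hc⟩ := card_pos.1 hpos
      refine LC_step hv hc (ih _ _ ?_ ?_ ?_ ?_ ?_ ?_)
      · rw [card_erase_of_mem hv]; omega
      · simp [hh, hvh.symm]
      · simp [hr, hvr.symm]
      · intro w hw; exact hadj w (mem_of_mem_erase hw)
      · intro w hw; exact (h0 w (mem_of_mem_erase hw)).trans (ex_step hv c w)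
      · exact h1.trans (ex_step hv c r)
    · push Not at hex
      by_cases hhr : h = r
      · subst hhr
        refine LC_greedy (l := [h]) ?_ (by simp) (GOk0 h1 GOk_nil)
        intro v; constructor
        · intro hv; by_contra hne; simp at hne; exact hne (hex v hv hne)
        · simp; rintro rfl; exact hh
      · refine LC_greedy (l := [h, r]) ?_ (by simp [hhr])
          (GOk1 r (h0 h hh) (hadj r hr (Ne.symm hhr)).symm (by simp) (GOk0 h1 GOk_nil))
        intro v; constructor
        · intro hv; by_contra hne; simp at hne; exact hne.2 (hex v hv hne.1)
        · simp; rintro (rfl | rfl) <;> assumption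

end abs

section setup
variable {V : Type*} [Fintype V]

def Col (G : SimpleGraph V) (L : V → Finset ℕ) : Prop :=
  ∃ φ : V → ℕ, (∀ u v, G.Adj u v → φ u ≠ φ v) ∧
    (∀ v, min 3 (nb G v).card ≤ ((nb G v).image φ).card) ∧ ∀ v, φ v ∈ L v

def del (G : SimpleGraph V) (X : Finset V) : SimpleGraph V where
  Adj a b := G.Adj a b ∧ a ∉ X ∧ b ∉ X
  symm := ⟨fun _ _ h => ⟨h.1.symm, h.2.2, h.2.1⟩⟩
  loopless := ⟨fun _ h => G.loopless.irrefl _ h.1⟩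

theorem nb_del {G : SimpleGraph V} {X : Finset V} {v : V} (hv : v ∉ X) :
    nb (del G X) v = nb G v \ X := by
  ext u; simp [mem_nb, del, hv]

theorem exists_T (N X : Finset V) (φ : V → ℕ)
    (h : min 3 (N \ X).card ≤ ((N \ X).image φ).card) :
    ∃ T, T ⊆ N ∧ T.card = min 3 N.card ∧ Set.InjOn φ (T \ X : Finset V) ∧
      (3 ≤ (N \ X).card → Disjoint T X) ∧ ((N \ X).card ≤ 3 → N \ X ⊆ T) := by
  by_cases h3 : 3 ≤ (N \ X).card
  · have h4 : 3 ≤ ((N \ X).image φ).card := by omega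
    obtain ⟨C, hC, hC3⟩ := exists_subset_card_eq h4
    have hex : ∀ c : ℕ, ∃ v : V, c ∈ C → v ∈ N \ X ∧ φ v = c := by
      intro c
      by_cases hc : c ∈ C
      · obtain ⟨v, hv, hvc⟩ := mem_image.1 (hC hc)
        exact ⟨v, fun _ => ⟨hv, hvc⟩⟩
      · obtain ⟨v, hv⟩ := card_pos.1 (by omega : 0 < (N \ X).card)
        exact ⟨v, fun h => absurd h hc⟩
    choose g hg using hex
    have hsub : C.image g ⊆ N \ X := by
      intro v hv
      obtain ⟨c, hc, rfl⟩ := mem_image.1 hv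
      exact (hg c hc).1
    have hd : Disjoint (C.image g) X := disjoint_of_subset_left hsub sdiff_disjoint
    have hcard : (C.image g).card = C.card := by
      rw [card_image_iff]
      intro a ha b hb hab
      rw [← (hg a ha).2, ← (hg b hb).2, hab]
    have hN := card_le_card (sdiff_subset : N \ X ⊆ N)
    refine ⟨C.image g, hsub.trans sdiff_subset, by omega, ?_, fun _ => hd, fun h5 => ?_⟩
    · intro a ha b hb hab
      simp only [coe_sdiff, Set.mem_sdiff, mem_coe, mem_image] at ha hb
      obtain ⟨⟨c, hc, rfl⟩, _⟩ := ha
      obtain ⟨⟨d, hd, rfl⟩, _⟩ := hb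
      rw [(hg c hc).2, (hg d hd).2] at hab
      rw [hab]
    · exact (eq_of_subset_of_card_le hsub (by omega)).symm.subset
  · have hcard : ((N \ X).image φ).card = (N \ X).card :=
      le_antisymm card_image_le (by omega)
    have hinj := card_image_iff.1 hcard
    obtain ⟨T, h1, h2, h5⟩ := exists_subsuperset_card_eq (s := N \ X) (t := N)
      (n := min 3 N.card) sdiff_subset
      (by have := card_le_card (sdiff_subset : N \ X ⊆ N); omega) (by omega)
    refine ⟨T, h2, h5, ?_, fun h => absurd h h3, fun _ => h1⟩
    exact hinj.mono (by intro a ha; simp at ha ⊢; exact ⟨h2 ha.1, ha.2⟩)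

structure Setup (G : SimpleGraph V) (X : Finset V) (T : V → Finset V) (F : SimpleGraph V)
    (A : V → Finset ℕ) : Prop where
  sub : ∀ y, T y ⊆ nb G y
  card : ∀ y, (T y).card = min 3 (nb G y).card
  disj : ∀ y, y ∉ X → 3 ≤ (nb G y \ X).card → Disjoint (T y) X
  cont : ∀ y, y ∉ X → (nb G y \ X).card ≤ 3 → nb G y \ X ⊆ T y
  adj : ∀ a b, F.Adj a b ↔ a ≠ b ∧ (G.Adj a b ∨ ∃ y, a ∈ T y ∧ b ∈ T y)
  exc : ∀ v ∈ X, 6 - ((nb F v).card : ℤ) ≤ ex F X A v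

theorem setup {G : SimpleGraph V} {L : V → Finset ℕ} {X : Finset V}
    (hL : ∀ v, 6 ≤ (L v).card)
    (hX : ∀ v ∈ X, (nb G v).card ≤ 3 ∧ (nb G v \ X).card ≤ 1)
    (hcol : Col (del G X) L) :
    ∃ T F A, Setup G X T F A ∧ (LC F X A → Col G L) := by
  obtain ⟨φ, p1, p2, p3⟩ := hcol
  have hT : ∀ y, ∃ T, T ⊆ nb G y ∧ T.card = min 3 (nb G y).card ∧
      Set.InjOn φ (T \ X : Finset V) ∧
      (y ∉ X → 3 ≤ (nb G y \ X).card → Disjoint T X) ∧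
      (y ∉ X → (nb G y \ X).card ≤ 3 → nb G y \ X ⊆ T) := by
    intro y
    by_cases hy : y ∈ X
    · refine ⟨nb G y, Subset.rfl, by have := (hX y hy).1; omega, ?_,
        fun h => absurd hy h, fun h => absurd hy h⟩
      intro a ha b hb _
      exact card_le_one.1 (hX y hy).2 a ha b hb
    · have h := p2 y
      rw [nb_del hy] at h
      obtain ⟨T, a, b, c, d, e⟩ := exists_T (nb G y) X φ h
      exact ⟨T, a, b, c, fun _ => d, fun _ => e⟩
  choose T t1 t2 t3 t4 t5 using hT
  let F : SimpleGraph V :=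
    { Adj := fun a b => a ≠ b ∧ (G.Adj a b ∨ ∃ y, a ∈ T y ∧ b ∈ T y)
      symm := ⟨fun a b h => ⟨h.1.symm, h.2.imp (fun h => h.symm)
        (fun ⟨y, h⟩ => ⟨y, h.2, h.1⟩)⟩⟩
      loopless := ⟨fun _ h => h.1 rfl⟩ }
  have hF : ∀ a b, F.Adj a b ↔ a ≠ b ∧ (G.Adj a b ∨ ∃ y, a ∈ T y ∧ b ∈ T y) :=
    fun _ _ => Iff.rfl
  refine ⟨T, F, fun v => L v \ ((nb F v \ X).image φ), ⟨t1, t2, t4, t5, hF, ?_⟩, ?_⟩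
  · intro v hv
    have h1 : dg F X v = (nb F v ∩ X).card := by
      unfold dg; congr 1; ext u; simp [mem_nb, and_comm]
    have h2 := card_sdiff_add_card_inter (nb F v) X
    have h3 : ((nb F v \ X).image φ).card ≤ (nb F v \ X).card := card_image_le
    have h4 := le_card_sdiff ((nb F v \ X).image φ) (L v)
    have h5 := hL v
    unfold ex
    rw [h1]
    beta_reduce
    omega
  · rintro ⟨ψ, q1, q2⟩
    set χ : V → ℕ := fun v => if v ∈ X then ψ v else φ v with hχ
    have key : ∀ a b, a ∈ X → b ∉ X → F.Adj a b → ψ a ≠ φ b := by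
      intro a b ha hb hab he
      have := (mem_sdiff.1 (q1 a ha)).2
      apply this
      rw [he]
      exact mem_image_of_mem _ (by simp [mem_nb, hab, hb])
    have prop : ∀ a b, F.Adj a b → χ a ≠ χ b := by
      intro a b hab
      by_cases ha : a ∈ X <;> by_cases hb : b ∈ X <;> simp only [hχ, ha, hb, if_true, if_false]
      · exact q2 a ha b hb hab
      · exact key a b ha hb hab
      · exact (key b a hb ha hab.symm).symm
      · obtain ⟨hne, h | ⟨y, hy1, hy2⟩⟩ := (hF a b).1 hab
        · exact p1 a b ⟨h, ha, hb⟩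
        · intro he
          exact hne (t3 y (by simp [hy1, ha]) (by simp [hy2, hb]) he)
    refine ⟨χ, fun u v h => prop u v ⟨h.ne, Or.inl h⟩, ?_, ?_⟩
    · intro v
      rw [← t2 v]
      have : ((T v).image χ).card = (T v).card := by
        rw [card_image_iff]
        intro a ha b hb he
        by_contra hne
        exact prop a b ⟨hne, Or.inr ⟨v, ha, hb⟩⟩ he
      rw [← this]
      exact card_le_card (image_subset_image (t1 v))
    · intro v
      by_cases hv : v ∈ X <;> simp only [hχ, hv, if_true, if_false]
      · exact (mem_sdiff.1 (q1 v hv)).1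
      · exact p3 v

structure Mn (G : SimpleGraph V) (L : V → Finset ℕ) : Prop where
  hL : ∀ v, 6 ≤ (L v).card
  ncol : ¬ Col G L
  min : ∀ X : Finset V, (∃ v ∈ X, (nb G v).Nonempty) → Col (del G X) L

theorem Mn.red {G : SimpleGraph V} {L : V → Finset ℕ} (hM : Mn G L) (X : Finset V)
    (hne : ∃ v ∈ X, (nb G v).Nonempty)
    (hX : ∀ v ∈ X, (nb G v).card ≤ 3 ∧ (nb G v \ X).card ≤ 1)
    (h : ∀ T F A, Setup G X T F A → LC F X A) : False := by
  obtain ⟨T, F, A, hS, hc⟩ := setup hM.hL hX (hM.min X hne)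
  exact hM.ncol (hc (h T F A hS))

namespace Setup
variable {G : SimpleGraph V} {X : Finset V} {T : V → Finset V} {F : SimpleGraph V}
  {A : V → Finset ℕ}

theorem T_eq (S : Setup G X T F A) {y : V} (h : (nb G y).card ≤ 3) : T y = nb G y :=
  eq_of_subset_of_card_le (S.sub y) (by rw [S.card]; omega)

theorem adj1 (S : Setup G X T F A) {a b : V} (h : G.Adj a b) : F.Adj a b :=
  (S.adj a b).2 ⟨h.ne, Or.inl h⟩

theorem adj2 (S : Setup G X T F A) {a b : V} (y : V) (h : (nb G y).card ≤ 3)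
    (ha : a ∈ nb G y) (hb : b ∈ nb G y) (hab : a ≠ b) : F.Adj a b :=
  (S.adj a b).2 ⟨hab, Or.inr ⟨y, by rw [S.T_eq h]; exact ⟨ha, hb⟩⟩⟩

theorem nbF_sub (S : Setup G X T F A) (v : V) :
    nb F v ⊆ (nb G v).biUnion (fun u => if v ∈ T u then insert u ((T u).erase v) else {u}) := by
  intro b hb
  obtain ⟨hne, h | ⟨y, h1, h2⟩⟩ := (S.adj v b).1 (mem_nb.1 hb)
  · refine mem_biUnion.2 ⟨b, mem_nb.2 h, ?_⟩
    split_ifs <;> simp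
  · refine mem_biUnion.2 ⟨y, mem_nb.2 (mem_nb.1 (S.sub y h1)).symm, ?_⟩
    simp [h1, h2, hne.symm]

theorem nbF_le (S : Setup G X T F A) (v : V) :
    (nb F v).card ≤ ∑ u ∈ nb G v, min 3 (nb G u).card := by
  refine (card_le_card (S.nbF_sub v)).trans (card_biUnion_le.trans (sum_le_sum ?_))
  intro u hu
  split_ifs with h
  · have h1 := card_insert_le u ((T u).erase v)
    have h2 := card_erase_add_one h
    have h3 := S.card u
    omega
  · have : 0 < (nb G u).card := card_pos.2 ⟨v, mem_nb.2 (mem_nb.1 hu).symm⟩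
    rw [card_singleton]; omega

/-- two-vertices -/
theorem ex2 (S : Setup G X T F A) {w : V} (hw : w ∈ X) (h : (nb G w).card ≤ 2) :
    0 ≤ ex F X A w := by
  have h1 := S.nbF_le w
  have h2 : ∑ u ∈ nb G w, min 3 (nb G u).card ≤ (nb G w).card • 3 :=
    sum_le_card_nsmul _ _ _ (fun _ _ => by omega)
  have h3 := S.exc w hw
  simp at h2
  omega

theorem ex3 (S : Setup G X T F A) {x a b c : V} (hx : x ∈ X) (h : nb G x = {a, b, c})
    (hab : a ≠ b) (hac : a ≠ c) (hbc : b ≠ c)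
    (ha : (nb G a).card = 2) (hb : (nb G b).card = 2) :
    -1 ≤ ex F X A x := by
  have h1 := S.nbF_le x
  have h3 := S.exc x hx
  rw [h, sum_insert (by simp [hab, hac]), sum_insert (by simp [hbc]), sum_singleton] at h1
  omega

theorem ex33 (S : Setup G X T F A) {x a b c : V} (hx : x ∈ X) (h : nb G x = {a, b, c})
    (hab : a ≠ b) (hac : a ≠ c) (hbc : b ≠ c)
    (ha : (nb G a).card = 2) (hb : (nb G b).card = 2) (hc : (nb G c).card = 2) :
    0 ≤ ex F X A x := by
  have h1 := S.nbF_le x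
  have h3 := S.exc x hx
  rw [h, sum_insert (by simp [hab, hac]), sum_insert (by simp [hbc]), sum_singleton] at h1
  omega

/-- a 2-vertex not in `T b` -/
theorem ex_notT (S : Setup G X T F A) {w a b : V} (hw : w ∈ X) (h : nb G w = {a, b})
    (hb : w ∉ T b) : 2 ≤ ex F X A w := by
  have h3 := S.exc w hw
  have ca := S.card a
  have h2 : nb F w ⊆ {a, b} ∪ (if w ∈ T a then (T a).erase w else ∅) := by
    intro v hv
    have := S.nbF_sub w hv
    rw [h] at this
    simp only [mem_biUnion, mem_insert, mem_singleton, exists_eq_or_imp, exists_eq_left] at this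
    grind
  have u1 := card_le_card h2
  have u2 := card_union_le {a, b} (if w ∈ T a then (T a).erase w else ∅)
  have u4 : ({a, b} : Finset V).card ≤ 2 := card_le_two
  split_ifs at u1 u2 with hwa
  · have e1 := card_erase_add_one hwa
    omega
  · simp at u1 u2; omega

/-- a 2-vertex whose two neighbors share another neighbor -/
theorem ex_share (S : Setup G X T F A) {w w' a b : V} (hw : w ∈ X) (h : nb G w = {a, b})
    (hww : w' ≠ w) (ha : w' ∈ T a) (hb : w' ∈ T b) : 1 ≤ ex F X A w := by
  have h3 := S.exc w hw
  have ca := S.card a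
  have cb := S.card b
  have h1 : nb F w ⊆ {a, b, w'} ∪ (((T a).erase w').erase w ∪ ((T b).erase w').erase w) := by
    intro v hv
    have := S.nbF_sub w hv
    rw [h] at this
    simp only [mem_biUnion, mem_insert, mem_singleton, exists_eq_or_imp, exists_eq_left] at this
    grind
  by_cases hwa : w ∈ T a
  · by_cases hwb : w ∈ T b
    · have e1 := card_erase_add_one ha
      have e2 := card_erase_add_one hb
      have e3 := card_erase_add_one (mem_erase.2 ⟨hww.symm, hwa⟩)
      have e4 := card_erase_add_one (mem_erase.2 ⟨hww.symm, hwb⟩)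
      have u1 := card_le_card h1
      have u2 := card_union_le {a, b, w'} (((T a).erase w').erase w ∪ ((T b).erase w').erase w)
      have u3 := card_union_le (((T a).erase w').erase w) (((T b).erase w').erase w)
      have u4 : ({a, b, w'} : Finset V).card ≤ 3 := card_le_three
      omega
    · have := S.ex_notT hw h hwb; omega
  · have := S.ex_notT hw (h.trans (pair_comm a b)) hwa; omega

end Setup
end setup

section configs
variable {V : Type*} [Fintype V]

theorem get2 {s : Finset V} {a : V} (h : s.card = 2) (ha : a ∈ s) :
    ∃ b, a ≠ b ∧ s = {a, b} := by
  obtain ⟨p, q, hpq, rfl⟩ := card_eq_two.1 h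
  simp only [mem_insert, mem_singleton] at ha
  rcases ha with rfl | rfl
  · exact ⟨q, hpq, rfl⟩
  · exact ⟨p, hpq.symm, pair_comm _ _⟩

theorem get3 {s : Finset V} {a b : V} (h : s.card = 3) (ha : a ∈ s) (hb : b ∈ s) (hab : a ≠ b) :
    ∃ c, a ≠ c ∧ b ≠ c ∧ s = {a, b, c} := by
  have h1 : ((s.erase a).erase b).card = 1 := by
    rw [card_erase_of_mem (mem_erase.2 ⟨hab.symm, hb⟩), card_erase_of_mem ha]; omega
  obtain ⟨c, hc⟩ := card_eq_one.1 h1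
  have hc' : c ∈ (s.erase a).erase b := by simp [hc]
  refine ⟨c, by grind, by grind, ?_⟩
  ext v
  have : v ∈ (s.erase a).erase b ↔ v = c := by simp [hc]
  grind

theorem sd1 {N X : Finset V} (x : V) (h : N ⊆ insert x X) : (N \ X).card ≤ 1 := by
  have : N \ X ⊆ {x} := by intro v hv; have := @h v; grind
  exact (card_le_card this).trans (by simp)

variable {G : SimpleGraph V} {L : V → Finset ℕ}

theorem confA1 (hM : Mn G L) (v : V) : (nb G v).card ≠ 1 := by
  intro h
  obtain ⟨u, hu⟩ := card_eq_one.1 h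
  refine hM.red {v} ⟨v, by simp, by simp [hu]⟩ ?_ ?_
  · intro a ha
    obtain rfl := mem_singleton.1 ha
    exact ⟨by omega, sd1 u (by simp [hu])⟩
  · intro T F A S
    have h1 := S.nbF_le v
    have h2 := S.exc v (by simp)
    rw [hu, sum_singleton] at h1
    exact LC_greedy (l := [v]) (by simp) (by simp) (GOk0 (by omega) GOk_nil)

theorem confA2 (hM : Mn G L) {u v : V} (huv : G.Adj u v) (hu : (nb G u).card = 2)
    (hv : (nb G v).card = 2) : False := by
  obtain ⟨x, hvx, hx⟩ := get2 hu (mem_nb.2 huv)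
  obtain ⟨y, huy, hy⟩ := get2 hv (mem_nb.2 huv.symm)
  refine hM.red {u, v} ⟨v, by simp, by simp [hy]⟩ ?_ ?_
  · intro a ha
    simp only [mem_insert, mem_singleton] at ha
    rcases ha with rfl | rfl
    · exact ⟨by omega, sd1 x (by grind)⟩
    · exact ⟨by omega, sd1 y (by grind)⟩
  · intro T F A S
    have h2 := S.ex2 (w := u) (by simp) (by omega)
    have h1 := S.nbF_le v
    have h3 := S.exc v (by simp)
    rw [hy, sum_pair huy] at h1
    refine LC_greedy (l := [u, v]) (by simp) (by simp [huv.ne])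
      (GOk1 v h2 (S.adj1 huv) (by simp) (GOk0 (by omega) GOk_nil))

theorem confD (hM : Mn G L) {x y w1 w2 : V} (hxy : x ≠ y) (hw : w1 ≠ w2)
    (h1 : nb G w1 = {x, y}) (h2 : nb G w2 = {x, y}) (hx : (nb G x).card = 3)
    (hy : (nb G y).card = 3) : False := by
  have c1 : (nb G w1).card = 2 := by rw [h1, card_pair hxy]
  have c2 : (nb G w2).card = 2 := by rw [h2, card_pair hxy]
  have x1 : G.Adj w1 x := mem_nb.1 (by simp [h1])
  have x2 : G.Adj w2 x := mem_nb.1 (by simp [h2])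
  have y1 : G.Adj w1 y := mem_nb.1 (by simp [h1])
  have y2 : G.Adj w2 y := mem_nb.1 (by simp [h2])
  obtain ⟨p, hp1, hp2, hp⟩ := get3 hx (mem_nb.2 x1.symm) (mem_nb.2 x2.symm) hw
  obtain ⟨q, hq1, hq2, hq⟩ := get3 hy (mem_nb.2 y1.symm) (mem_nb.2 y2.symm) hw
  refine hM.red {x, y, w1, w2} ⟨x, by simp, by simp [hp]⟩ ?_ ?_
  · intro a ha
    simp only [mem_insert, mem_singleton] at ha
    rcases ha with rfl | rfl | rfl | rfl
    · exact ⟨by omega, sd1 p (by grind)⟩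
    · exact ⟨by omega, sd1 q (by grind)⟩
    · exact ⟨by omega, sd1 x (by grind)⟩
    · exact ⟨by omega, sd1 x (by grind)⟩
  · intro T F A S
    have e1 : 1 ≤ ex F {x, y, w1, w2} A w1 := S.ex_share (w' := w2) (by simp) h1 hw.symm
      (by rw [S.T_eq (by omega), hp]; simp) (by rw [S.T_eq (by omega), hq]; simp)
    have e2 : 1 ≤ ex F {x, y, w1, w2} A w2 := S.ex_share (w' := w1) (by simp) h2 hw
      (by rw [S.T_eq (by omega), hp]; simp) (by rw [S.T_eq (by omega), hq]; simp)
    have e3 : -1 ≤ ex F {x, y, w1, w2} A x := S.ex3 (by simp) hp hw hp1 hp2 c1 c2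
    have e4 : -1 ≤ ex F {x, y, w1, w2} A y := S.ex3 (by simp) hq hw hq1 hq2 c1 c2
    refine LC_greedy (l := [x, y, w1, w2]) (by simp) ?_
      (GOk2 w1 w2 e3 (S.adj1 x1.symm) (S.adj1 x2.symm) hw (by simp) (by simp)
      (GOk2 w1 w2 e4 (S.adj1 y1.symm) (S.adj1 y2.symm) hw (by simp) (by simp)
      (GOk0 e1 (GOk0 e2 GOk_nil))))
    simp [hxy, hw, x1.ne.symm, x2.ne.symm, y1.ne.symm, y2.ne.symm]

theorem confB (hM : Mn G L) {x y w1 w2 z y2 : V} (hxy : x ≠ y) (hxy2 : x ≠ y2)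
    (h1 : nb G w1 = {x, y}) (h2 : nb G w2 = {x, y2}) (hx : nb G x = {w1, w2, z})
    (hw : w1 ≠ w2) (hz1 : w1 ≠ z) (hz2 : w2 ≠ z) (hy : 4 ≤ (nb G y).card) : False := by
  have c1 : (nb G w1).card = 2 := by rw [h1, card_pair hxy]
  have c2 : (nb G w2).card = 2 := by rw [h2, card_pair hxy2]
  have cx : (nb G x).card = 3 := by rw [hx]; exact card_eq_three.2 ⟨_, _, _, hw, hz1, hz2, rfl⟩
  have x1 : G.Adj w1 x := mem_nb.1 (by simp [h1])
  have x2 : G.Adj w2 x := mem_nb.1 (by simp [h2])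
  have y1 : G.Adj w1 y := mem_nb.1 (by simp [h1])
  have yw1 : y ≠ w1 := by rintro rfl; omega
  have yw2 : y ≠ w2 := by rintro rfl; omega
  refine hM.red {x, w1, w2} ⟨x, by simp, by simp [hx]⟩ ?_ ?_
  · intro a ha
    simp only [mem_insert, mem_singleton] at ha
    rcases ha with rfl | rfl | rfl
    · exact ⟨by omega, sd1 z (by grind)⟩
    · exact ⟨by omega, sd1 y (by grind)⟩
    · exact ⟨by omega, sd1 y2 (by grind)⟩
  · intro T F A S
    have ex := S.ex3 (by simp) hx hw hz1 hz2 c1 c2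
    have e1 := S.ex2 (w := w1) (by simp) c1.le
    have e2 := S.ex2 (w := w2) (by simp) c2.le
    have a12 : F.Adj w1 w2 := S.adj2 x cx.le (by simp [hx]) (by simp [hx]) hw
    have f1 : 1 ≤ Dyn3.ex F {x, w1, w2} A w1 → LC F {x, w1, w2} A := fun h =>
      LC_greedy (l := [x, w2, w1]) (by simp; grind)
        (by simp [hw.symm, x1.ne.symm, x2.ne.symm])
        (GOk2 w1 w2 ex (S.adj1 x1.symm) (S.adj1 x2.symm) hw (by simp) (by simp)
        (GOk1 w1 e2 a12.symm (by simp) (GOk0 h GOk_nil)))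
    have f2 : 1 ≤ Dyn3.ex F {x, w1, w2} A w2 → LC F {x, w1, w2} A := fun h =>
      LC_greedy (l := [x, w1, w2]) (by simp)
        (by simp [hw, x1.ne.symm, x2.ne.symm])
        (GOk2 w1 w2 ex (S.adj1 x1.symm) (S.adj1 x2.symm) hw (by simp) (by simp)
        (GOk1 w2 e1 a12 (by simp) (GOk0 h GOk_nil)))
    by_cases ht : w1 ∈ T y
    · by_cases hadj : G.Adj x y
      · apply f1
        have hyz : y = z := by
          have := mem_nb.2 hadj; rw [hx] at this; simp [yw1, yw2] at this; exact this
        have h3 := S.exc w1 (by simp)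
        have hT : T x = {w1, w2, y} := by rw [S.T_eq cx.le, hx, hyz]
        have hsub : nb F w1 ⊆ {x, y, w2} ∪ (T y).erase w1 := by
          intro v hv
          have := S.nbF_sub w1 hv
          rw [h1] at this
          simp only [mem_biUnion, mem_insert, mem_singleton, exists_eq_or_imp,
            exists_eq_left, hT] at this
          grind
        have u1 := card_le_card hsub
        have u2 := card_union_le {x, y, w2} ((T y).erase w1)
        have u4 : ({x, y, w2} : Finset V).card ≤ 3 := card_le_three
        have e1 := card_erase_add_one ht
        have := S.card y
        omega
      · apply f2
        have hyX : y ∉ ({x, w1, w2} : Finset V) := by simp [hxy.symm, yw1, yw2]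
        have hlt : (nb G y \ {x, w1, w2}).card < 3 := by
          by_contra hge
          exact (disjoint_left.1 (S.disj y hyX (by omega)) ht) (by simp)
        have hcont := S.cont y hyX (by omega)
        have hxn : x ∉ nb G y := fun h => hadj (mem_nb.1 h).symm
        have k0 : nb G y ⊆ (nb G y \ {x, w1, w2}) ∪ {w1, w2} := by grind
        have k1 := card_le_card k0
        have k2 := card_union_le (nb G y \ {x, w1, w2}) {w1, w2}
        have k3 : ({w1, w2} : Finset V).card = 2 := card_pair hw
        have hw2 : w2 ∈ nb G y := by
          by_contra hn
          have k0 : nb G y ⊆ (nb G y \ {x, w1, w2}) ∪ {w1} := by grind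
          have k1 := card_le_card k0
          have k2 := card_union_le (nb G y \ {x, w1, w2}) {w1}
          rw [card_singleton] at k2
          omega
        have hw2T : w2 ∉ T y := by
          intro hn
          have k4 : (nb G y \ {x, w1, w2}) ∪ {w1, w2} ⊆ T y := by grind
          have k5 := card_le_card k4
          have := S.card y
          have k6 := card_union_of_disjoint (s := nb G y \ {x, w1, w2}) (t := {w1, w2})
            (by rw [Finset.disjoint_left]; grind)
          omega
        have hyy : y = y2 := by
          have := mem_nb.2 (mem_nb.1 hw2).symm
          rw [h2] at this; simp [hxy.symm] at this; exact this
        have := S.ex_notT (w := w2) (by simp) h2 (hyy ▸ hw2T)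
        omega
    · apply f1
      have := S.ex_notT (w := w1) (by simp) h1 ht
      omega


theorem exists_color {V : Type*} {F : SimpleGraph V} {U : Finset V} {A : V → Finset ℕ} {v a b : V}
    (h : -1 ≤ ex F U A v) (ha : a ∈ U) (hb : b ∈ U) (hab : a ≠ b) (h1 : F.Adj v a)
    (h2 : F.Adj v b) : ∃ c, c ∈ A v := by
  have h3 := card_A (F := F) (U := U) (A := A) v
  have : 1 < dg F U v := one_lt_card.2 ⟨a, by simp [ha, h1], b, by simp [hb, h2], hab⟩
  exact card_pos.1 (by omega)

theorem absC {V : Type*} {F : SimpleGraph V} {X : Finset V} {A : V → Finset ℕ}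
    {x w1 w2 w3 y w4 : V} (hX : ∀ v, v ∈ X ↔ v ∈ [x, w1, w2, w3, y, w4])
    (hn : [x, w1, w2, w3, y, w4].Nodup)
    (xw1 : F.Adj x w1) (xw2 : F.Adj x w2) (w12 : F.Adj w1 w2)
    (w13 : F.Adj w1 w3) (xy : F.Adj x y) (yw1 : F.Adj y w1)
    (yw4 : F.Adj y w4) (w14 : F.Adj w1 w4)
    (ex0 : 0 ≤ ex F X A x) (e1 : 0 ≤ ex F X A w1) (e2 : 0 ≤ ex F X A w2)
    (e3 : 0 ≤ ex F X A w3) (e4 : 0 ≤ ex F X A w4) (ey : -1 ≤ ex F X A y)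
    (h : ¬ F.Adj y w2 ∨ 1 ≤ ex F X A w2) : LC F X A := by
  have hxX : x ∈ X := by simp [hX]
  have h1X : w1 ∈ X := by simp [hX]
  have h2X : w2 ∈ X := by simp [hX]
  have h3X : w3 ∈ X := by simp [hX]
  have h4X : w4 ∈ X := by simp [hX]
  have hyX : y ∈ X := by simp [hX]
  have h0 : ∀ v ∈ X, v ≠ y → 0 ≤ ex F X A v := by
    intro v hv hvy
    simp only [hX, List.mem_cons, List.not_mem_nil, or_false] at hv
    rcases hv with rfl | rfl | rfl | rfl | rfl | rfl <;> first | assumption | exact absurd rfl hvy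
  have hadj : ∀ v ∈ X, v ≠ w1 → F.Adj v w1 := by
    intro v hv hvy
    simp only [hX, List.mem_cons, List.not_mem_nil, or_false] at hv
    rcases hv with rfl | rfl | rfl | rfl | rfl | rfl <;>
      first | assumption | exact absurd rfl hvy | (apply SimpleGraph.Adj.symm; assumption)
  simp only [List.nodup_cons, List.mem_cons, List.not_mem_nil, or_false, not_or] at hn
  obtain ⟨⟨n1, n2, n3, n4, n5⟩, ⟨n6, n7, n8, n9⟩, ⟨n10, n11, n12⟩, ⟨n13, n14⟩, n15, -⟩ := hn
  by_contra hno
  obtain ⟨c, hc⟩ := exists_color ey h1X h4X n9 yw1 yw4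
  -- coloring y
  have hy : ∀ c ∈ A y, ∀ r ∈ X.erase y, 1 ≤ ex F (X.erase y) (upd F A y c) r → False := by
    intro c hc r hr h1
    refine hno (LC_step hyX hc (hub (h := w1) (r := r) _ _ _ rfl ?_ hr ?_ ?_ h1))
    · simp [h1X, n8]
    · intro v hv; exact hadj v (mem_of_mem_erase hv)
    · intro v hv
      exact (h0 v (mem_of_mem_erase hv) (ne_of_mem_erase hv)).trans (ex_step hyX c v)
  rcases h with h | h
  swap
  · exact hy c hc w2 (by simp [h2X, n11]) (h.trans (ex_step hyX c w2))
  have s1 : A y ⊆ A x := by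
    intro c hc
    by_contra hcx
    have := ex_gain hyX xy.symm hcx
    exact hy c hc x (by simp [hxX, n4]) (by omega)
  have s2 : A x ⊆ A w2 := by
    intro c hc
    by_contra hcx
    have hg := ex_gain hxX xw2 hcx
    have hyx : y ∈ X.erase x := by simp [hyX, Ne.symm n4]
    obtain ⟨d, hd⟩ := exists_color (F := F) (U := X.erase x) (A := upd F A x c) (v := y)
      (a := w1) (b := w4) (ey.trans (ex_step hxX c y)) (by simp [h1X, Ne.symm n1])
      (by simp [h4X, Ne.symm n5]) n9 yw1 yw4
    refine hno (LC_step hxX hc (LC_step hyx hd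
      (hub (h := w1) (r := w2) _ _ _ rfl ?_ ?_ ?_ ?_ ?_)))
    · simp [h1X, n8, Ne.symm n1]
    · simp [h2X, n11, Ne.symm n2]
    · intro v hv; exact hadj v (mem_of_mem_erase (mem_of_mem_erase hv))
    · intro v hv
      exact ((h0 v (mem_of_mem_erase (mem_of_mem_erase hv)) (ne_of_mem_erase hv)).trans
        (ex_step hxX c v)).trans (ex_step hyx d v)
    · have := ex_step (F := F) (A := upd F A x c) hyx d w2
      omega
  have hw2y : w2 ∈ X.erase y := by simp [h2X, n11]
  have hc2 : c ∈ upd F A y c w2 := by rw [upd_not h]; exact s2 (s1 hc)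
  refine hno (LC_step hyX hc (LC_step hw2y hc2
    (hub (h := w1) (r := x) _ _ _ rfl ?_ ?_ ?_ ?_ ?_)))
  · simp [h1X, n8, n6]
  · simp [hxX, n4, n2]
  · intro v hv; exact hadj v (mem_of_mem_erase (mem_of_mem_erase hv))
  · intro v hv
    have hv' := mem_of_mem_erase hv
    exact ((h0 v (mem_of_mem_erase hv') (ne_of_mem_erase hv')).trans
      (ex_step hyX c v)).trans (ex_step hw2y c v)
  · have := ex_gain2 (A := A) (c := c) hyX h2X (Ne.symm n11) xy.symm xw2.symm
    omega

set_option maxHeartbeats 2000000 in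
theorem confC (hM : Mn G L) {x y w1 w2 w3 w4 y2 y3 z : V}
    (hx : nb G x = {w1, w2, w3}) (w12 : w1 ≠ w2) (w13 : w1 ≠ w3) (w23 : w2 ≠ w3)
    (h1 : nb G w1 = {x, y}) (xy : x ≠ y) (h2 : nb G w2 = {x, y2}) (xy2 : x ≠ y2)
    (h3 : nb G w3 = {x, y3}) (xy3 : x ≠ y3)
    (hy : nb G y = {w1, w4, z}) (w14 : w1 ≠ w4) (w1z : w1 ≠ z) (w4z : w4 ≠ z)
    (h4 : (nb G w4).card = 2) : False := by
  have c1 : (nb G w1).card = 2 := by rw [h1, card_pair xy]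
  have c2 : (nb G w2).card = 2 := by rw [h2, card_pair xy2]
  have c3 : (nb G w3).card = 2 := by rw [h3, card_pair xy3]
  have cx : (nb G x).card = 3 := by rw [hx]; exact card_eq_three.2 ⟨_, _, _, w12, w13, w23, rfl⟩
  have cy : (nb G y).card = 3 := by rw [hy]; exact card_eq_three.2 ⟨_, _, _, w14, w1z, w4z, rfl⟩
  have a1 : G.Adj x w1 := mem_nb.1 (by simp [hx])
  have a2 : G.Adj x w2 := mem_nb.1 (by simp [hx])
  have a3 : G.Adj x w3 := mem_nb.1 (by simp [hx])
  have b1 : G.Adj y w1 := mem_nb.1 (by simp [hy])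
  have b4 : G.Adj y w4 := mem_nb.1 (by simp [hy])
  have yy2 : y ≠ y2 := by rintro rfl; exact confD hM xy w12 h1 h2 cx cy
  have yy3 : y ≠ y3 := by rintro rfl; exact confD hM xy w13 h1 h3 cx cy
  have ny2 : ¬ G.Adj y w2 := by
    intro h; have := mem_nb.2 h.symm; rw [h2] at this; simp [xy.symm, yy2] at this
  have ny3 : ¬ G.Adj y w3 := by
    intro h; have := mem_nb.2 h.symm; rw [h3] at this; simp [xy.symm, yy3] at this
  have w42 : w4 ≠ w2 := by rintro rfl; exact ny2 b4
  have w43 : w4 ≠ w3 := by rintro rfl; exact ny3 b4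
  have yw2 : y ≠ w2 := by rintro rfl; omega
  have yw3 : y ≠ w3 := by rintro rfl; omega
  have xw4 : x ≠ w4 := by rintro rfl; omega
  obtain ⟨u, -, hu⟩ := get2 h4 (mem_nb.2 b4.symm)
  refine hM.red {x, w1, w2, w3, y, w4} ⟨x, by simp, by simp [hx]⟩ ?_ ?_
  · intro a ha
    simp only [mem_insert, mem_singleton] at ha
    rcases ha with rfl | rfl | rfl | rfl | rfl | rfl
    · exact ⟨by omega, sd1 a (by grind)⟩
    · exact ⟨by omega, sd1 x (by grind)⟩
    · exact ⟨by omega, sd1 y2 (by grind)⟩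
    · exact ⟨by omega, sd1 y3 (by grind)⟩
    · exact ⟨by omega, sd1 z (by grind)⟩
    · exact ⟨by omega, sd1 u (by grind)⟩
  · intro T F A S
    have ex0 := S.ex33 (x := x) (by simp) hx w12 w13 w23 c1 c2 c3
    have e1 := S.ex2 (w := w1) (by simp) c1.le
    have e2 := S.ex2 (w := w2) (by simp) c2.le
    have e3 := S.ex2 (w := w3) (by simp) c3.le
    have e4 := S.ex2 (w := w4) (by simp) h4.le
    have ey := S.ex3 (x := y) (by simp) hy w14 w1z w4z c1 h4
    have f12 : F.Adj w1 w2 := S.adj2 x cx.le (by simp [hx]) (by simp [hx]) w12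
    have f13 : F.Adj w1 w3 := S.adj2 x cx.le (by simp [hx]) (by simp [hx]) w13
    have f14 : F.Adj w1 w4 := S.adj2 y cy.le (by simp [hy]) (by simp [hy]) w14
    have fxy : F.Adj x y := S.adj2 w1 (by omega) (by simp [h1]) (by simp [h1]) xy
    have key : ∀ w t, w = w2 ∧ t = y2 ∨ w = w3 ∧ t = y3 → F.Adj y w → t = z ∧ w ∈ T t := by
      intro w t hwt hF
      obtain ⟨-, h | ⟨s, hs1, hs2⟩⟩ := (S.adj y w).1 hF
      · rcases hwt with ⟨rfl, rfl⟩ | ⟨rfl, rfl⟩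
        · exact absurd h ny2
        · exact absurd h ny3
      · have g1 := mem_nb.1 (S.sub s hs1)
        have g2 := mem_nb.1 (S.sub s hs2)
        have cw : nb G w = {x, t} ∧ (nb G w).card = 2 := by
          rcases hwt with ⟨rfl, rfl⟩ | ⟨rfl, rfl⟩
          · exact ⟨h2, c2⟩
          · exact ⟨h3, c3⟩
        have hst : s = x ∨ s = t := by
          have := mem_nb.2 g2.symm; rw [cw.1] at this; simpa using this
        have hst : s = t := by
          rcases hst with rfl | h
          · exfalso
            have := mem_nb.2 g1; rw [hx] at this
            simp [b1.ne, yw2, yw3] at this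
          · exact h
        subst hst
        refine ⟨?_, hs2⟩
        have := mem_nb.2 g1.symm; rw [hy] at this
        simp only [mem_insert, mem_singleton] at this
        rcases this with rfl | rfl | h
        · exact absurd (confA2 hM g2 c1 cw.2) id
        · exact absurd (confA2 hM g2 h4 cw.2) id
        · exact h
    have nd : [x, w1, w2, w3, y, w4].Nodup := by
      simp [a1.ne, a2.ne, a3.ne, xy, xw4, w12, w13, b1.ne.symm, w14, w23, yw2.symm, w42.symm,
        yw3.symm, w43.symm, b4.ne]
    by_cases hF2 : F.Adj y w2
    · by_cases hF3 : F.Adj y w3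
      · obtain ⟨k1, k2⟩ := key w2 y2 (by simp) hF2
        obtain ⟨k3, k4⟩ := key w3 y3 (by simp) hF3
        have e2' := S.ex_share (w := w2) (w' := w3) (by simp) h2 w23.symm
          (by rw [S.T_eq cx.le, hx]; simp) (by rw [k1, ← k3]; exact k4)
        exact absC (x := x) (w1 := w1) (w2 := w2) (w3 := w3) (y := y) (w4 := w4) (by simp) nd
          (S.adj1 a1) (S.adj1 a2) f12 f13 fxy (S.adj1 b1) (S.adj1 b4) f14 ex0 e1 e2 e3 e4 ey
          (Or.inr e2')
      · refine absC (x := x) (w1 := w1) (w2 := w3) (w3 := w2) (y := y) (w4 := w4) ?_ ?_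
          (S.adj1 a1) (S.adj1 a3) f13 f12 fxy (S.adj1 b1) (S.adj1 b4) f14 ex0 e1 e3 e2 e4 ey
          (Or.inl hF3)
        · intro v; simp; tauto
        · simp [a1.ne, a2.ne, a3.ne, xy, xw4, w12, w13, b1.ne.symm, w14, w23.symm, yw2.symm,
            w42.symm, yw3.symm, w43.symm, b4.ne]
    · exact absC (x := x) (w1 := w1) (w2 := w2) (w3 := w3) (y := y) (w4 := w4) (by simp) nd
          (S.adj1 a1) (S.adj1 a2) f12 f13 fxy (S.adj1 b1) (S.adj1 b4) f14 ex0 e1 e2 e3 e4 ey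
          (Or.inl hF2)

section greedy2
variable {V : Type*} {F : SimpleGraph V} {X : Finset V} {A : V → Finset ℕ}

theorem list_ok {l : List V} (hc : l.length = X.card) (hX : ∀ v ∈ X, v ∈ l) :
    l.Nodup ∧ ∀ v, v ∈ X ↔ v ∈ l := by
  have h1 : X ⊆ l.toFinset := fun v hv => List.mem_toFinset.2 (hX v hv)
  have h2 := List.toFinset_card_le l
  have h3 := card_le_card h1
  have h4 : X = l.toFinset := eq_of_subset_of_card_le h1 (by omega)
  refine ⟨?_, fun v => by rw [h4, List.mem_toFinset]⟩
  have h5 : l.toFinset.card = l.length := by rw [← h4]; omega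
  exact Multiset.coe_nodup.1 (Multiset.toFinset_card_eq_card_iff_nodup.1 h5)

theorem G0 {l : List V} (hc : l.length = X.card) (hX : ∀ v ∈ X, v ∈ l)
    (hg : GOk F (ex F X A) l) : LC F X A :=
  LC_greedy (list_ok hc hX).2 (list_ok hc hX).1 hg

theorem G1 {u : V} {c : ℕ} (l : List V) (hc : (u :: l).length = X.card)
    (hX : ∀ v ∈ X, v ∈ u :: l) (hcu : c ∈ A u)
    (hg : ∀ s : V → ℤ, (∀ v, ex F X A v ≤ s v) →
      (∀ v, F.Adj u v → c ∉ A v → ex F X A v + 1 ≤ s v) → GOk F s l) : LC F X A := by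
  obtain ⟨hn, hm⟩ := list_ok hc hX
  have hu : u ∈ X := by simp [hm]
  simp only [List.nodup_cons] at hn
  refine LC_step hu hcu (LC_greedy (l := l) ?_ hn.2 (hg _ (ex_step hu c) ?_))
  · intro v
    rw [mem_erase, hm, List.mem_cons]
    constructor
    · tauto
    · intro h; exact ⟨fun h' => hn.1 (h' ▸ h), Or.inr h⟩
  · intro v h1 h2
    exact ex_gain hu h1 h2

theorem G2 {p q : V} {c : ℕ} (l : List V) (hc : (p :: q :: l).length = X.card)
    (hX : ∀ v ∈ X, v ∈ p :: q :: l) (hcp : c ∈ A p) (hcq : c ∈ A q) (hpq : ¬ F.Adj p q)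
    (hg : ∀ s : V → ℤ, (∀ v, ex F X A v ≤ s v) →
      (∀ v, F.Adj p v → F.Adj q v → ex F X A v + 1 ≤ s v) → GOk F s l) : LC F X A := by
  obtain ⟨hn, hm⟩ := list_ok hc hX
  have hp : p ∈ X := by simp [hm]
  simp only [List.nodup_cons, List.mem_cons, not_or] at hn
  obtain ⟨⟨n1, n2⟩, n3, n4⟩ := hn
  have hqX : q ∈ X := by simp [hm]
  have hq : q ∈ X.erase p := mem_erase.2 ⟨Ne.symm n1, hqX⟩
  refine LC_step hp hcp (LC_step hq (by rw [upd_not hpq]; exact hcq)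
    (LC_greedy (l := l) ?_ n4 (hg _ ?_ ?_)))
  · intro v
    rw [mem_erase, mem_erase, hm, List.mem_cons, List.mem_cons]
    constructor
    · tauto
    · intro h; exact ⟨fun h' => n3 (h' ▸ h), fun h' => n2 (h' ▸ h), Or.inr (Or.inr h)⟩
  · intro v; exact (ex_step hp c v).trans (ex_step hq c v)
  · intro v h1 h2
    exact ex_gain2 hp hqX n1 h1 h2

theorem cnt_contra {x y1 w1 w0 : V} (s1 : A x ⊆ A w1) (s2 : A y1 ⊆ A w1) (s3 : A y1 ⊆ A w0)
    (hd : ∀ c, c ∈ A x → c ∈ A w0 → False) (e1 : ex F X A w1 < 1) (ex0 : -1 ≤ ex F X A x)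
    (ey1 : -1 ≤ ex F X A y1) (h : dg F X w1 + 2 < dg F X x + dg F X y1) : False := by
  have k1 : Disjoint (A x) (A y1) := disjoint_left.2 fun c h1 h2 => hd c h1 (s3 h2)
  have k2 := card_le_card (union_subset s1 s2)
  rw [card_union_of_disjoint k1] at k2
  have := card_A (F := F) (U := X) (A := A) x
  have := card_A (F := F) (U := X) (A := A) y1
  have := card_A (F := F) (U := X) (A := A) w1
  omega

theorem P6 {x y1 y2 w0 w1 w2 : V} (hc : X.card = 6)
    (hX : ∀ v ∈ X, v ∈ [x, y1, y2, w0, w1, w2])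
    (a01 : F.Adj w0 w1) (a12 : F.Adj w1 w2) (a20 : F.Adj w2 w0) (xy1 : F.Adj x y1)
    (xy2 : F.Adj x y2) (xw1 : F.Adj x w1) (xw2 : F.Adj x w2)
    (y1w1 : F.Adj y1 w1) (y1w0 : F.Adj y1 w0) (y2w2 : F.Adj y2 w2) (y2w0 : F.Adj y2 w0)
    (ex0 : -1 ≤ ex F X A x) (ey1 : -1 ≤ ex F X A y1) (ey2 : -1 ≤ ex F X A y2)
    (e0 : 0 ≤ ex F X A w0) (e1 : 0 ≤ ex F X A w1) (e2 : 0 ≤ ex F X A w2)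
    (h : 1 ≤ ex F X A x ∨ (¬ F.Adj x w0 ∧ dg F X w1 + 2 < dg F X x + dg F X y1)) :
    LC F X A := by
  rcases h with h | ⟨h, hd⟩
  · refine G0 (l := [y1, y2, w0, w1, w2, x]) (by simp [hc])
      (fun v hv => (by simp : [x, y1, y2, w0, w1, w2] ⊆ _) (hX v hv)) ?_
    exact GOk2 w0 w1 ey1 y1w0 y1w1 a01.ne (by simp) (by simp)
      (GOk2 w0 w2 ey2 y2w0 y2w2 a20.ne.symm (by simp) (by simp)
      (GOk1 w1 e0 a01 (by simp) (GOk1 w2 e1 a12 (by simp) (GOk1 x e2 xw2.symm (by simp)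
      (GOk0 h GOk_nil)))))
  by_contra hno
  refine cnt_contra (F := F) (X := X) (A := A) (x := x) (y1 := y1) (w1 := w1) (w0 := w0)
    ?_ ?_ ?_ ?_ ?_ ex0 ey1 hd
  · intro c hcx
    by_contra hcw
    refine hno (G1 [y1, y2, w0, w2, w1] (by simp [hc])
      (fun v hv => (by simp : [x, y1, y2, w0, w1, w2] ⊆ _) (hX v hv)) hcx fun s hs hg => ?_)
    exact GOk2 w0 w1 (ey1.trans (hs _)) y1w0 y1w1 a01.ne (by simp) (by simp)
      (GOk2 w0 w2 (ey2.trans (hs _)) y2w0 y2w2 a20.ne.symm (by simp) (by simp)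
      (GOk1 w1 (e0.trans (hs _)) a01 (by simp) (GOk1 w1 (e2.trans (hs _)) a12.symm (by simp)
      (GOk0 (by have := hg _ xw1 hcw; omega) GOk_nil))))
  · intro c hcx
    by_contra hcw
    refine hno (G1 [x, y2, w0, w2, w1] (by simp [hc])
      (fun v hv => (by simp : [x, y1, y2, w0, w1, w2] ⊆ _) (hX v hv)) hcx fun s hs hg => ?_)
    exact GOk2 w1 w2 (ex0.trans (hs _)) xw1 xw2 a12.ne (by simp) (by simp)
      (GOk2 w0 w2 (ey2.trans (hs _)) y2w0 y2w2 a20.ne.symm (by simp) (by simp)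
      (GOk1 w1 (e0.trans (hs _)) a01 (by simp) (GOk1 w1 (e2.trans (hs _)) a12.symm (by simp)
      (GOk0 (by have := hg _ y1w1 hcw; omega) GOk_nil))))
  · intro c hcx
    by_contra hcw
    refine hno (G1 [x, y2, w1, w2, w0] (by simp [hc])
      (fun v hv => (by simp : [x, y1, y2, w0, w1, w2] ⊆ _) (hX v hv)) hcx fun s hs hg => ?_)
    exact GOk2 w1 w2 (ex0.trans (hs _)) xw1 xw2 a12.ne (by simp) (by simp)
      (GOk2 w0 w2 (ey2.trans (hs _)) y2w0 y2w2 a20.ne.symm (by simp) (by simp)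
      (GOk1 w0 (e1.trans (hs _)) a01.symm (by simp) (GOk1 w0 (e2.trans (hs _)) a20 (by simp)
      (GOk0 (by have := hg _ y1w0 hcw; omega) GOk_nil))))
  · intro c hcx hcw
    refine hno (G2 [y1, y2, w2, w1] (by simp [hc])
      (fun v hv => (by simp : [x, y1, y2, w0, w1, w2] ⊆ _) (hX v hv)) hcx hcw h fun s hs hg => ?_)
    exact GOk1 w1 (by have := hg _ xy1 y1w0.symm; omega) y1w1 (by simp)
      (GOk1 w2 (by have := hg _ xy2 y2w0.symm; omega) y2w2 (by simp)
      (GOk1 w1 (e2.trans (hs _)) a12.symm (by simp)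
      (GOk0 (by have := hg _ xw1 a01; omega) GOk_nil)))
  · by_contra hge
    refine hno (G0 (l := [x, y1, y2, w0, w2, w1]) (by simp [hc])
      (fun v hv => (by simp : [x, y1, y2, w0, w1, w2] ⊆ _) (hX v hv)) ?_)
    exact GOk2 w1 w2 ex0 xw1 xw2 a12.ne (by simp) (by simp)
      (GOk2 w0 w1 ey1 y1w0 y1w1 a01.ne (by simp) (by simp)
      (GOk2 w0 w2 ey2 y2w0 y2w2 a20.ne.symm (by simp) (by simp)
      (GOk1 w1 e0 a01 (by simp) (GOk1 w1 e2 a12.symm (by simp)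
      (GOk0 (by omega) GOk_nil)))))

theorem P7 {x y1 y2 w0 w1 w2 w3 : V} (hc : X.card = 7)
    (hX : ∀ v ∈ X, v ∈ [x, y1, y2, w0, w1, w2, w3])
    (a01 : F.Adj w0 w1) (a12 : F.Adj w1 w2) (a23 : F.Adj w2 w3) (xy1 : F.Adj x y1)
    (xy2 : F.Adj x y2) (xw1 : F.Adj x w1) (xw2 : F.Adj x w2)
    (y1w1 : F.Adj y1 w1) (y1w0 : F.Adj y1 w0) (y2w2 : F.Adj y2 w2) (y2w3 : F.Adj y2 w3)
    (ex0 : -1 ≤ ex F X A x) (ey1 : -1 ≤ ex F X A y1) (ey2 : -1 ≤ ex F X A y2)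
    (e0 : 0 ≤ ex F X A w0) (e1 : 0 ≤ ex F X A w1) (e2 : 0 ≤ ex F X A w2) (e3 : 0 ≤ ex F X A w3)
    (h : 1 ≤ ex F X A x ∨ (¬ F.Adj x w0 ∧ dg F X w1 + 2 < dg F X x + dg F X y1) ∨
      (F.Adj x w0 ∧ F.Adj x w3 ∧ ¬ F.Adj w0 w2)) :
    LC F X A := by
  rcases h with h | ⟨h, hd⟩ | ⟨xw0, xw3, h02⟩
  · refine G0 (l := [y1, y2, w0, w3, w1, w2, x]) (by simp [hc])
      (fun v hv => (by simp : [x, y1, y2, w0, w1, w2, w3] ⊆ _) (hX v hv)) ?_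
    exact GOk2 w0 w1 ey1 y1w0 y1w1 a01.ne (by simp) (by simp)
      (GOk2 w2 w3 ey2 y2w2 y2w3 a23.ne (by simp) (by simp)
      (GOk1 w1 e0 a01 (by simp) (GOk1 w2 e3 a23.symm (by simp)
      (GOk1 w2 e1 a12 (by simp) (GOk1 x e2 xw2.symm (by simp)
      (GOk0 h GOk_nil))))))
  · by_contra hno
    refine cnt_contra (F := F) (X := X) (A := A) (x := x) (y1 := y1) (w1 := w1) (w0 := w0)
      ?_ ?_ ?_ ?_ ?_ ex0 ey1 hd
    · intro c hcx
      by_contra hcw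
      refine hno (G1 [y1, y2, w0, w3, w2, w1] (by simp [hc])
        (fun v hv => (by simp : [x, y1, y2, w0, w1, w2, w3] ⊆ _) (hX v hv)) hcx fun s hs hg => ?_)
      exact GOk2 w0 w1 (ey1.trans (hs _)) y1w0 y1w1 a01.ne (by simp) (by simp)
        (GOk2 w2 w3 (ey2.trans (hs _)) y2w2 y2w3 a23.ne (by simp) (by simp)
        (GOk1 w1 (e0.trans (hs _)) a01 (by simp) (GOk1 w2 (e3.trans (hs _)) a23.symm (by simp)
        (GOk1 w1 (e2.trans (hs _)) a12.symm (by simp)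
        (GOk0 (by have := hg _ xw1 hcw; omega) GOk_nil)))))
    · intro c hcx
      by_contra hcw
      refine hno (G1 [x, y2, w0, w3, w2, w1] (by simp [hc])
        (fun v hv => (by simp : [x, y1, y2, w0, w1, w2, w3] ⊆ _) (hX v hv)) hcx fun s hs hg => ?_)
      exact GOk2 w1 w2 (ex0.trans (hs _)) xw1 xw2 a12.ne (by simp) (by simp)
        (GOk2 w2 w3 (ey2.trans (hs _)) y2w2 y2w3 a23.ne (by simp) (by simp)
        (GOk1 w1 (e0.trans (hs _)) a01 (by simp) (GOk1 w2 (e3.trans (hs _)) a23.symm (by simp)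
        (GOk1 w1 (e2.trans (hs _)) a12.symm (by simp)
        (GOk0 (by have := hg _ y1w1 hcw; omega) GOk_nil)))))
    · intro c hcx
      by_contra hcw
      refine hno (G1 [x, y2, w3, w2, w1, w0] (by simp [hc])
        (fun v hv => (by simp : [x, y1, y2, w0, w1, w2, w3] ⊆ _) (hX v hv)) hcx fun s hs hg => ?_)
      exact GOk2 w1 w2 (ex0.trans (hs _)) xw1 xw2 a12.ne (by simp) (by simp)
        (GOk2 w2 w3 (ey2.trans (hs _)) y2w2 y2w3 a23.ne (by simp) (by simp)
        (GOk1 w2 (e3.trans (hs _)) a23.symm (by simp)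
        (GOk1 w1 (e2.trans (hs _)) a12.symm (by simp) (GOk1 w0 (e1.trans (hs _)) a01.symm (by simp)
        (GOk0 (by have := hg _ y1w0 hcw; omega) GOk_nil)))))
    · intro c hcx hcw
      refine hno (G2 [y2, y1, w3, w2, w1] (by simp [hc])
        (fun v hv => (by simp : [x, y1, y2, w0, w1, w2, w3] ⊆ _) (hX v hv)) hcx hcw h fun s hs hg => ?_)
      exact (GOk2 w2 w3 (ey2.trans (hs _)) y2w2 y2w3 a23.ne (by simp) (by simp)
        (GOk1 w1 (by have := hg _ xy1 y1w0.symm; omega) y1w1 (by simp)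
        (GOk1 w2 (e3.trans (hs _)) a23.symm (by simp)
        (GOk1 w1 (e2.trans (hs _)) a12.symm (by simp)
        (GOk0 (by have := hg _ xw1 a01; omega) GOk_nil)))))
    · by_contra hge
      refine hno (G0 (l := [x, y1, y2, w0, w3, w2, w1]) (by simp [hc])
        (fun v hv => (by simp : [x, y1, y2, w0, w1, w2, w3] ⊆ _) (hX v hv)) ?_)
      exact GOk2 w1 w2 ex0 xw1 xw2 a12.ne (by simp) (by simp)
        (GOk2 w0 w1 ey1 y1w0 y1w1 a01.ne (by simp) (by simp)
        (GOk2 w2 w3 ey2 y2w2 y2w3 a23.ne (by simp) (by simp)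
        (GOk1 w1 e0 a01 (by simp) (GOk1 w2 e3 a23.symm (by simp) (GOk1 w1 e2 a12.symm (by simp)
        (GOk0 (by omega) GOk_nil))))))
  · by_contra hno
    have s1 : A x ⊆ A w0 := by
      intro c hcx
      by_contra hcw
      refine hno (G1 [y1, y2, w3, w2, w1, w0] (by simp [hc])
        (fun v hv => (by simp : [x, y1, y2, w0, w1, w2, w3] ⊆ _) (hX v hv)) hcx fun s hs hg => ?_)
      exact GOk2 w0 w1 (ey1.trans (hs _)) y1w0 y1w1 a01.ne (by simp) (by simp)
        (GOk2 w2 w3 (ey2.trans (hs _)) y2w2 y2w3 a23.ne (by simp) (by simp)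
        (GOk1 w2 (e3.trans (hs _)) a23.symm (by simp)
        (GOk1 w1 (e2.trans (hs _)) a12.symm (by simp) (GOk1 w0 (e1.trans (hs _)) a01.symm (by simp)
        (GOk0 (by have := hg _ xw0 hcw; omega) GOk_nil)))))
    have s2 : A x ⊆ A w2 := by
      intro c hcx
      by_contra hcw
      refine hno (G1 [y1, y2, w0, w1, w3, w2] (by simp [hc])
        (fun v hv => (by simp : [x, y1, y2, w0, w1, w2, w3] ⊆ _) (hX v hv)) hcx fun s hs hg => ?_)
      exact GOk2 w0 w1 (ey1.trans (hs _)) y1w0 y1w1 a01.ne (by simp) (by simp)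
        (GOk2 w2 w3 (ey2.trans (hs _)) y2w2 y2w3 a23.ne (by simp) (by simp)
        (GOk1 w1 (e0.trans (hs _)) a01 (by simp)
        (GOk1 w2 (e1.trans (hs _)) a12 (by simp) (GOk1 w2 (e3.trans (hs _)) a23.symm (by simp)
        (GOk0 (by have := hg _ xw2 hcw; omega) GOk_nil)))))
    have hm := (list_ok (X := X) (l := [x, y1, y2, w0, w1, w2, w3]) (by simp [hc])
        (fun v hv => (by simp : [x, y1, y2, w0, w1, w2, w3] ⊆ _) (hX v hv))).2
    obtain ⟨c, hcx⟩ := exists_color ex0 (a := w1) (b := w2) (by simp [hm]) (by simp [hm])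
      a12.ne xw1 xw2
    refine hno (G2 [y1, y2, w3, x, w1] (by simp [hc])
        (fun v hv => (by simp : [x, y1, y2, w0, w1, w2, w3] ⊆ _) (hX v hv)) (s1 hcx) (s2 hcx) h02 fun s hs hg => ?_)
    exact GOk2 x w1 (ey1.trans (hs _)) xy1.symm y1w1 xw1.ne (by simp) (by simp)
        (GOk2 x w3 (ey2.trans (hs _)) xy2.symm y2w3 xw3.ne (by simp) (by simp)
        (GOk1 x (e3.trans (hs _)) xw3.symm (by simp)
        (GOk1 w1 (by have := hg _ xw0.symm xw2.symm; omega) xw1 (by simp)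
        (GOk0 (by have := hg _ a01 a12.symm; omega) GOk_nil))))

end greedy2

structure EC (G : SimpleGraph V) (x y1 y2 w0 w1 w2 w3 z z1 z2 : V) : Prop where
  hx : nb G x = {w1, w2, z}
  h1 : nb G w1 = {x, y1}
  h2 : nb G w2 = {x, y2}
  hy1 : nb G y1 = {w1, w0, z1}
  hy2 : nb G y2 = {w2, w3, z2}
  cx : (nb G x).card = 3
  cy1 : (nb G y1).card = 3
  cy2 : (nb G y2).card = 3
  c0 : (nb G w0).card = 2
  c1 : (nb G w1).card = 2
  c2 : (nb G w2).card = 2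
  c3 : (nb G w3).card = 2
  cz : (nb G z).card ≠ 2
  cz1 : (nb G z1).card ≠ 2
  cz2 : (nb G z2).card ≠ 2
  y12 : y1 ≠ y2
  xy1 : x ≠ y1
  xy2 : x ≠ y2
  w12 : w1 ≠ w2
  w01 : w0 ≠ w1
  w23 : w2 ≠ w3

namespace EC
variable {x y1 y2 w0 w1 w2 w3 z z1 z2 : V}

theorem swap (E : EC G x y1 y2 w0 w1 w2 w3 z z1 z2) : EC G x y2 y1 w3 w2 w1 w0 z z2 z1 where
  hx := by rw [E.hx, insert_comm]
  h1 := E.h2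
  h2 := E.h1
  hy1 := E.hy2
  hy2 := E.hy1
  cx := E.cx
  cy1 := E.cy2
  cy2 := E.cy1
  c0 := E.c3
  c1 := E.c2
  c2 := E.c1
  c3 := E.c0
  cz := E.cz
  cz1 := E.cz2
  cz2 := E.cz1
  y12 := E.y12.symm
  xy1 := E.xy2
  xy2 := E.xy1
  w12 := E.w12.symm
  w01 := E.w23.symm
  w23 := E.w01.symm

theorem ne_of {a b : V} (ha : (nb G a).card = 3) (hb : (nb G b).card = 2) : a ≠ b := by
  rintro rfl; omega

theorem w02 (E : EC G x y1 y2 w0 w1 w2 w3 z z1 z2) : w0 ≠ w2 := by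
  rintro rfl
  have : y1 ∈ nb G w0 := mem_nb.2 (mem_nb.1 (by simp [E.hy1] : w0 ∈ nb G y1)).symm
  rw [E.h2] at this
  simp [E.xy1.symm, E.y12] at this

theorem z_eq (E : EC G x y1 y2 w0 w1 w2 w3 z z1 z2) (h : G.Adj x y1) : z = y1 := by
  have := mem_nb.2 h
  rw [E.hx] at this
  simp [ne_of E.cy1 E.c1, ne_of E.cy1 E.c2] at this
  exact this.symm

theorem z1_eq (E : EC G x y1 y2 w0 w1 w2 w3 z z1 z2) (h : G.Adj x y1) : z1 = x := by
  have := mem_nb.2 h.symm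
  rw [E.hy1] at this
  simp [ne_of E.cx E.c1, ne_of E.cx E.c0] at this
  exact this.symm

variable {X : Finset V} {T : V → Finset V} {F : SimpleGraph V} {A : V → Finset ℕ}

theorem ex_tri (E : EC G x y1 y2 w0 w1 w2 w3 z z1 z2) (S : Setup G X T F A) (hxX : x ∈ X)
    (h : G.Adj x y1) : 1 ≤ ex F X A x := by
  have h3 := S.exc x hxX
  have hsub : nb F x ⊆ {w1, w2, y1, y2, w0} := by
    intro v hv
    have := S.nbF_sub x hv
    rw [E.hx, E.z_eq h] at this
    have t1 : T w1 = {x, y1} := by rw [S.T_eq (by rw [E.c1]; omega), E.h1]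
    have t2 : T w2 = {x, y2} := by rw [S.T_eq (by rw [E.c2]; omega), E.h2]
    have t3 : T y1 = {w1, w0, x} := by rw [S.T_eq E.cy1.le, E.hy1, E.z1_eq h]
    simp only [mem_biUnion, mem_insert, mem_singleton, exists_eq_or_imp,
      exists_eq_left, t1, t2, t3] at this
    simp at this
    simp only [mem_insert, mem_singleton]
    tauto
  have u1 := card_le_card hsub
  have u2 : ({w1, w2, y1, y2, w0} : Finset V).card ≤ 5 := card_le_five
  omega

theorem ex_tri2 (E : EC G x y1 y2 w0 w1 w2 w3 z z1 z2) (S : Setup G X T F A) (hxX : x ∈ X)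
    (h : ¬ 1 ≤ ex F X A x) : ¬ G.Adj x y1 ∧ ¬ G.Adj x y2 :=
  ⟨fun h' => h (E.ex_tri S hxX h'), fun h' => h (E.swap.ex_tri S hxX h')⟩

theorem exs (E : EC G x y1 y2 w0 w1 w2 w3 z z1 z2) (S : Setup G X T F A)
    (hX : ∀ v ∈ [x, y1, y2, w0, w1, w2, w3], v ∈ X) :
    -1 ≤ ex F X A x ∧ -1 ≤ ex F X A y1 ∧ -1 ≤ ex F X A y2 ∧ 0 ≤ ex F X A w0 ∧
    0 ≤ ex F X A w1 ∧ 0 ≤ ex F X A w2 ∧ 0 ≤ ex F X A w3 := by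
  have n : ∀ a b, (nb G a).card = 2 → (nb G b).card ≠ 2 → a ≠ b := by
    rintro a b h1 h2 rfl; exact h2 h1
  refine ⟨S.ex3 (hX _ (by simp)) E.hx E.w12 (n _ _ E.c1 E.cz) (n _ _ E.c2 E.cz) E.c1 E.c2,
    S.ex3 (hX _ (by simp)) E.hy1 E.w01.symm (n _ _ E.c1 E.cz1) (n _ _ E.c0 E.cz1) E.c1 E.c0,
    S.ex3 (hX _ (by simp)) E.hy2 E.w23 (n _ _ E.c2 E.cz2) (n _ _ E.c3 E.cz2) E.c2 E.c3,
    S.ex2 (hX _ (by simp)) E.c0.le, S.ex2 (hX _ (by simp)) E.c1.le,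
    S.ex2 (hX _ (by simp)) E.c2.le, S.ex2 (hX _ (by simp)) E.c3.le⟩

theorem adjs (E : EC G x y1 y2 w0 w1 w2 w3 z z1 z2) (S : Setup G X T F A) :
    F.Adj w0 w1 ∧ F.Adj w1 w2 ∧ F.Adj x y1 ∧ F.Adj x w1 ∧ F.Adj y1 w1 ∧ F.Adj y1 w0 := by
  refine ⟨S.adj2 y1 E.cy1.le (by simp [E.hy1]) (by simp [E.hy1]) E.w01,
    S.adj2 x E.cx.le (by simp [E.hx]) (by simp [E.hx]) E.w12,
    S.adj2 w1 (by rw [E.c1]; omega) (by simp [E.h1]) (by simp [E.h1]) E.xy1,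
    S.adj1 (mem_nb.1 (by simp [E.hx])), S.adj1 (mem_nb.1 (by simp [E.hy1])),
    S.adj1 (mem_nb.1 (by simp [E.hy1]))⟩

theorem not02 (E : EC G x y1 y2 w0 w1 w2 w3 z z1 z2) (S : Setup G X T F A) (h03 : w0 ≠ w3) :
    ¬ F.Adj w0 w2 := by
  intro h
  have n : ∀ a b, (nb G a).card = 2 → (nb G b).card ≠ 2 → a ≠ b := by
    rintro a b h1 h2 rfl; exact h2 h1
  obtain ⟨-, h | ⟨t, t1, t2⟩⟩ := (S.adj _ _).1 h
  · have := mem_nb.2 h.symm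
    rw [E.h2] at this
    simp [(ne_of E.cx E.c0).symm, (ne_of E.cy2 E.c0).symm] at this
  · have g1 := S.sub t t1
    have g2 := mem_nb.2 (mem_nb.1 (S.sub t t2)).symm
    rw [E.h2] at g2
    simp only [mem_insert, mem_singleton] at g2
    rcases g2 with rfl | rfl
    · rw [E.hx] at g1
      simp [E.w01, E.w02, n _ _ E.c0 E.cz] at g1
    · rw [E.hy2] at g1
      simp [h03, E.w02, n _ _ E.c0 E.cz2] at g1

theorem w1y2 (E : EC G x y1 y2 w0 w1 w2 w3 z z1 z2) (S : Setup G X T F A)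
    (hn : ¬ G.Adj x y2) (h : F.Adj w1 y2) : G.Adj y1 y2 := by
  obtain ⟨-, h | ⟨t, t1, t2⟩⟩ := (S.adj _ _).1 h
  · have := mem_nb.2 h
    rw [E.h1] at this
    simp [E.xy2.symm, E.y12.symm] at this
  · have g1 := mem_nb.2 (mem_nb.1 (S.sub t t1)).symm
    have g2 := mem_nb.1 (S.sub t t2)
    rw [E.h1] at g1
    simp only [mem_insert, mem_singleton] at g1
    rcases g1 with rfl | rfl
    · exact absurd g2 hn
    · exact g2

theorem count7 (E : EC G x y1 y2 w0 w1 w2 w3 z z1 z2) (S : Setup G X T F A) (h03 : w0 ≠ w3)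
    (hX : ∀ v ∈ [x, y1, y2, w0, w1, w2, w3], v ∈ X)
    (hX' : ∀ v ∈ X, v ∈ [x, y1, y2, w0, w1, w2, w3]) (hn : ¬ G.Adj x y2) :
    dg F X w1 + 2 < dg F X x + dg F X y1 := by
  obtain ⟨f1, f2, f3, f4, f5, f6⟩ := E.adjs S
  obtain ⟨g1, g2, g3, g4, g5, g6⟩ := E.swap.adjs S
  have kx : 4 ≤ dg F X x := by
    have : ({w1, w2, y1, y2} : Finset V) ⊆ X.filter (fun u => F.Adj x u) := by
      intro v hv
      simp only [mem_insert, mem_singleton] at hv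
      rw [mem_filter]
      rcases hv with rfl | rfl | rfl | rfl
      · exact ⟨hX _ (by simp), f4⟩
      · exact ⟨hX _ (by simp), g4⟩
      · exact ⟨hX _ (by simp), f3⟩
      · exact ⟨hX _ (by simp), g3⟩
    have h := card_le_card this
    rwa [card_insert_of_notMem, card_insert_of_notMem, card_pair E.y12] at h
    · simp [g5.ne.symm, (ne_of E.cy1 E.c2).symm]
    · simp [E.w12, f5.ne.symm, (ne_of E.cy2 E.c1).symm]
  have k3 : ({w0, w1, x} : Finset V) ⊆ X.filter (fun u => F.Adj y1 u) := by
    intro v hv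
    simp only [mem_insert, mem_singleton] at hv
    rw [mem_filter]
    rcases hv with rfl | rfl | rfl
    · exact ⟨hX _ (by simp), f6⟩
    · exact ⟨hX _ (by simp), f5⟩
    · exact ⟨hX _ (by simp), f3.symm⟩
  have c3 : ({w0, w1, x} : Finset V).card = 3 :=
    card_eq_three.2 ⟨_, _, _, E.w01, (ne_of E.cx E.c0).symm, f4.ne.symm, rfl⟩
  have hw : X.filter (fun u => F.Adj w1 u) ⊆ {y2, x, y1, w0, w2} := by
    intro v hv
    rw [mem_filter] at hv
    have h1 := hX' v hv.1
    simp only [List.mem_cons, List.not_mem_nil, or_false] at h1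
    simp only [mem_insert, mem_singleton]
    have h2 : v ≠ w1 := fun h => hv.2.ne h.symm
    have h3 : v ≠ w3 := by
      intro h; have := hv.2; rw [h] at this; exact E.swap.not02 S h03.symm this.symm
    tauto
  by_cases ha : G.Adj y1 y2
  · have u1 := card_le_card hw
    have u2 : ({y2, x, y1, w0, w2} : Finset V).card ≤ 5 := card_le_five
    have k4 : insert y2 ({w0, w1, x} : Finset V) ⊆ X.filter (fun u => F.Adj y1 u) := by
      apply insert_subset _ k3
      rw [mem_filter]
      exact ⟨hX _ (by simp), S.adj1 ha⟩
    have u3 := card_le_card k4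
    rw [card_insert_of_notMem (by simp [ne_of E.cy2 E.c0, ne_of E.cy2 E.c1, E.xy2.symm]), c3]
      at u3
    unfold dg at *
    omega
  · have hw' : X.filter (fun u => F.Adj w1 u) ⊆ {x, y1, w0, w2} := by
      intro v hv
      rcases mem_insert.1 (hw hv) with rfl | h
      · exact absurd (E.w1y2 S hn (mem_filter.1 hv).2) ha
      · exact h
    have u1 := card_le_card hw'
    have u2 : ({x, y1, w0, w2} : Finset V).card ≤ 4 := card_le_four
    have u3 := card_le_card k3
    unfold dg at *
    omega

theorem nodup6 (E : EC G x y1 y2 w0 w1 w2 w3 z z1 z2) : [x, y1, y2, w0, w1, w2].Nodup := by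
  simp [E.xy1, E.xy2, E.y12, E.w01, E.w12, E.w02, ne_of E.cx E.c0, ne_of E.cx E.c1,
    ne_of E.cx E.c2, ne_of E.cy1 E.c0, ne_of E.cy1 E.c1, ne_of E.cy1 E.c2,
    ne_of E.cy2 E.c0, ne_of E.cy2 E.c1, ne_of E.cy2 E.c2]

theorem LC7 (E : EC G x y1 y2 w0 w1 w2 w3 z z1 z2) (h03 : w0 ≠ w3) (S : Setup G X T F A)
    (hX : X = {x, y1, y2, w0, w1, w2, w3}) : LC F X A := by
  have h1 : ∀ v ∈ [x, y1, y2, w0, w1, w2, w3], v ∈ X := by simp [hX]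
  have h2 : ∀ v ∈ X, v ∈ [x, y1, y2, w0, w1, w2, w3] := by simp [hX]
  have hl : [x, y1, y2, w0, w1, w2, w3].toFinset = X := by simp [hX]
  have hc : X.card = 7 := by
    rw [← hl, List.toFinset_card_of_nodup]
    · rfl
    have := E.nodup6
    rw [show [x, y1, y2, w0, w1, w2, w3] = [x, y1, y2, w0, w1, w2] ++ [w3] from rfl,
      List.nodup_append]
    refine ⟨this, by simp, ?_⟩
    have := E.swap.w02
    simp [ne_of E.cx E.c3, ne_of E.cy1 E.c3, ne_of E.cy2 E.c3, h03, E.w23, this.symm]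
  obtain ⟨f1, f2, f3, f4, f5, f6⟩ := E.adjs S
  obtain ⟨g1, g2, g3, g4, g5, g6⟩ := E.swap.adjs S
  obtain ⟨e1, e2, e3, e4, e5, e6, e7⟩ := E.exs S h1
  by_cases ht : 1 ≤ ex F X A x
  · exact P7 hc h2 f1 f2 g1.symm f3 g3 f4 g4 f5 f6 g5 g6 e1 e2 e3 e4 e5 e6 e7 (Or.inl ht)
  obtain ⟨n1, n2⟩ := E.ex_tri2 S (h1 _ (by simp)) ht
  by_cases k1 : F.Adj x w0
  · by_cases k2 : F.Adj x w3
    · exact P7 hc h2 f1 f2 g1.symm f3 g3 f4 g4 f5 f6 g5 g6 e1 e2 e3 e4 e5 e6 e7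
        (Or.inr (Or.inr ⟨k1, k2, E.not02 S h03⟩))
    · have s1 : [x, y2, y1, w3, w2, w1, w0] ⊆ [x, y1, y2, w0, w1, w2, w3] := by simp
      have s2 : [x, y1, y2, w0, w1, w2, w3] ⊆ [x, y2, y1, w3, w2, w1, w0] := by simp
      have h1' : ∀ v ∈ [x, y2, y1, w3, w2, w1, w0], v ∈ X := fun v hv => h1 v (s1 hv)
      have h2' : ∀ v ∈ X, v ∈ [x, y2, y1, w3, w2, w1, w0] := fun v hv => s2 (h2 v hv)
      exact P7 hc h2' g1 g2 f1.symm g3 f3 g4 f4 g5 g6 f5 f6 e1 e3 e2 e7 e6 e5 e4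
        (Or.inr (Or.inl ⟨k2, E.swap.count7 S h03.symm h1' h2' n1⟩))
  · exact P7 hc h2 f1 f2 g1.symm f3 g3 f4 g4 f5 f6 g5 g6 e1 e2 e3 e4 e5 e6 e7
        (Or.inr (Or.inl ⟨k1, E.count7 S h03 h1 h2 n2⟩))

theorem nbw0 (E : EC G x y1 y2 w0 w1 w2 w0 z z1 z2) : nb G w0 = {y1, y2} := by
  have b1 : y1 ∈ nb G w0 := mem_nb.2 (mem_nb.1 (by simp [E.hy1] : w0 ∈ nb G y1)).symm
  have b2 : y2 ∈ nb G w0 := mem_nb.2 (mem_nb.1 (by simp [E.hy2] : w0 ∈ nb G y2)).symm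
  refine (eq_of_subset_of_card_le ?_ (by rw [E.c0, card_pair E.y12])).symm
  intro v hv
  simp only [mem_insert, mem_singleton] at hv
  rcases hv with rfl | rfl <;> assumption

theorem LC6 (E : EC G x y1 y2 w0 w1 w2 w0 z z1 z2) (S : Setup G X T F A)
    (hX : X = {x, y1, y2, w0, w1, w2}) : LC F X A := by
  have h1 : ∀ v ∈ [x, y1, y2, w0, w1, w2, w0], v ∈ X := by simp [hX]
  have h2 : ∀ v ∈ X, v ∈ [x, y1, y2, w0, w1, w2] := by simp [hX]
  have hl : [x, y1, y2, w0, w1, w2].toFinset = X := by simp [hX]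
  have hc : X.card = 6 := by
    rw [← hl, List.toFinset_card_of_nodup E.nodup6]
    rfl
  obtain ⟨f1, f2, f3, f4, f5, f6⟩ := E.adjs S
  obtain ⟨g1, g2, g3, g4, g5, g6⟩ := E.swap.adjs S
  obtain ⟨e1, e2, e3, e4, e5, e6, e7⟩ := E.exs S h1
  refine P6 hc h2 f1 f2 g1.symm f3 g3 f4 g4 f5 f6 g5 g6 e1 e2 e3 e4 e5 e6 ?_
  by_cases ht : 1 ≤ ex F X A x
  · exact Or.inl ht
  obtain ⟨n1, n2⟩ := E.ex_tri2 S (h1 _ (by simp)) ht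
  have y12 : F.Adj y1 y2 := S.adj2 w0 (by rw [E.c0]; omega) (by simp [E.nbw0])
    (by simp [E.nbw0]) E.y12
  refine Or.inr ⟨?_, ?_⟩
  · intro h
    obtain ⟨-, h | ⟨t, t1, t2⟩⟩ := (S.adj _ _).1 h
    · have := mem_nb.2 h.symm
      rw [E.nbw0] at this
      simp [E.xy1, E.xy2] at this
    · have k1 := mem_nb.2 (mem_nb.1 (S.sub t t2)).symm
      have k2 := mem_nb.1 (S.sub t t1)
      rw [E.nbw0] at k1
      simp only [mem_insert, mem_singleton] at k1
      rcases k1 with rfl | rfl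
      · exact n1 k2.symm
      · exact n2 k2.symm
  · have kx : ({w1, w2, y1, y2} : Finset V) ⊆ X.filter (fun u => F.Adj x u) := by
      intro v hv
      simp only [mem_insert, mem_singleton] at hv
      rw [mem_filter]
      rcases hv with rfl | rfl | rfl | rfl
      · exact ⟨h1 _ (by simp), f4⟩
      · exact ⟨h1 _ (by simp), g4⟩
      · exact ⟨h1 _ (by simp), f3⟩
      · exact ⟨h1 _ (by simp), g3⟩
    have ky : ({w1, w0, x, y2} : Finset V) ⊆ X.filter (fun u => F.Adj y1 u) := by
      intro v hv
      simp only [mem_insert, mem_singleton] at hv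
      rw [mem_filter]
      rcases hv with rfl | rfl | rfl | rfl
      · exact ⟨h1 _ (by simp), f5⟩
      · exact ⟨h1 _ (by simp), f6⟩
      · exact ⟨h1 _ (by simp), f3.symm⟩
      · exact ⟨h1 _ (by simp), y12⟩
    have hx := card_le_card kx
    rw [card_insert_of_notMem, card_insert_of_notMem, card_pair E.y12] at hx
    rotate_left
    · simp [g5.ne.symm, (ne_of E.cy1 E.c2).symm]
    · simp [E.w12, f5.ne.symm, (ne_of E.cy2 E.c1).symm]
    have hy := card_le_card ky
    rw [card_insert_of_notMem, card_insert_of_notMem, card_pair E.xy2] at hy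
    rotate_left
    · simp [(ne_of E.cx E.c0).symm, (ne_of E.cy2 E.c0).symm]
    · simp [E.w01.symm, f4.ne.symm, (ne_of E.cy2 E.c1).symm]
    have hw : X.filter (fun u => F.Adj w1 u) ⊆ X.erase w1 := by
      intro v hv
      rw [mem_filter] at hv
      exact mem_erase.2 ⟨hv.2.ne.symm, hv.1⟩
    have hw := card_le_card hw
    rw [card_erase_of_mem (h1 _ (by simp)), hc] at hw
    unfold dg
    omega

theorem conf (hM : Mn G L) (E : EC G x y1 y2 w0 w1 w2 w3 z z1 z2) : False := by
  have b0 : y1 ∈ nb G w0 := mem_nb.2 (mem_nb.1 (by simp [E.hy1] : w0 ∈ nb G y1)).symm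
  have b3 : y2 ∈ nb G w3 := mem_nb.2 (mem_nb.1 (by simp [E.hy2] : w3 ∈ nb G y2)).symm
  obtain ⟨p, -, hp⟩ := get2 E.c0 b0
  obtain ⟨q, -, hq⟩ := get2 E.c3 b3
  by_cases h03 : w0 = w3
  · subst h03
    refine hM.red {x, y1, y2, w0, w1, w2} ⟨x, by simp, by simp [E.hx]⟩ ?_
      fun T F A S => E.LC6 S rfl
    intro a ha
    simp only [mem_insert, mem_singleton] at ha
    have := E.cx; have := E.cy1; have := E.cy2; have := E.c0; have := E.c1; have := E.c2
    rcases ha with rfl | rfl | rfl | rfl | rfl | rfl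
    · exact ⟨by omega, sd1 z (by rw [E.hx]; simp [insert_subset_iff])⟩
    · exact ⟨by omega, sd1 z1 (by rw [E.hy1]; simp [insert_subset_iff])⟩
    · exact ⟨by omega, sd1 z2 (by rw [E.hy2]; simp [insert_subset_iff])⟩
    · exact ⟨by omega, sd1 p (by rw [hp]; simp [insert_subset_iff])⟩
    · exact ⟨by omega, sd1 x (by rw [E.h1]; simp [insert_subset_iff])⟩
    · exact ⟨by omega, sd1 x (by rw [E.h2]; simp [insert_subset_iff])⟩
  · refine hM.red {x, y1, y2, w0, w1, w2, w3} ⟨x, by simp, by simp [E.hx]⟩ ?_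
      fun T F A S => E.LC7 h03 S rfl
    intro a ha
    simp only [mem_insert, mem_singleton] at ha
    have := E.cx; have := E.cy1; have := E.cy2; have := E.c0; have := E.c1; have := E.c2
    have := E.c3
    rcases ha with rfl | rfl | rfl | rfl | rfl | rfl | rfl
    · exact ⟨by omega, sd1 z (by rw [E.hx]; simp [insert_subset_iff])⟩
    · exact ⟨by omega, sd1 z1 (by rw [E.hy1]; simp [insert_subset_iff])⟩
    · exact ⟨by omega, sd1 z2 (by rw [E.hy2]; simp [insert_subset_iff])⟩
    · exact ⟨by omega, sd1 p (by rw [hp]; simp [insert_subset_iff])⟩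
    · exact ⟨by omega, sd1 x (by rw [E.h1]; simp [insert_subset_iff])⟩
    · exact ⟨by omega, sd1 x (by rw [E.h2]; simp [insert_subset_iff])⟩
    · exact ⟨by omega, sd1 q (by rw [hq]; simp [insert_subset_iff])⟩

end EC

noncomputable def tw (G : SimpleGraph V) (v : V) : Finset V :=
  (nb G v).filter (fun u => (nb G u).card = 2)

def W1 (G : SimpleGraph V) (v : V) : Prop := (nb G v).card = 3 ∧ (tw G v).card = 1

theorem weakNbr (hM : Mn G L) {v w w' z y : V} (hv : nb G v = {w, w', z}) (n1 : w ≠ w')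
    (n2 : w ≠ z) (n3 : w' ≠ z) (c' : (nb G w').card = 2)
    (hw : nb G w = {v, y}) (hvy : v ≠ y) (hW : ¬ W1 G y) :
    (nb G y).card = 3 ∧ ∃ w0 z1, nb G y = {w, w0, z1} ∧ w ≠ w0 ∧ w ≠ z1 ∧ w0 ≠ z1 ∧
      (nb G w0).card = 2 := by
  have c : (nb G w).card = 2 := by rw [hw, card_pair hvy]
  have hav : v ∈ nb G w' := mem_nb.2 (mem_nb.1 (by simp [hv] : w' ∈ nb G v)).symm
  have hyw : G.Adj w y := mem_nb.1 (by simp [hw])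
  have hwy : w ∈ nb G y := mem_nb.2 hyw.symm
  obtain ⟨y', hy', hw'⟩ := get2 c' hav
  have hle : ¬ 4 ≤ (nb G y).card := fun h => confB hM hvy hy' hw hw' hv n1 n2 n3 h
  have h0 : 0 < (nb G y).card := card_pos.2 ⟨w, hwy⟩
  have h1 := confA1 hM y
  have h2 : (nb G y).card ≠ 2 := fun h => confA2 hM hyw c h
  have h3 : (nb G y).card = 3 := by omega
  refine ⟨h3, ?_⟩
  have ht : w ∈ tw G y := mem_filter.2 ⟨hwy, c⟩
  have ht1 : (tw G y).card ≠ 1 := fun h => hW ⟨h3, h⟩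
  have ht0 : 0 < (tw G y).card := card_pos.2 ⟨w, ht⟩
  obtain ⟨w0, hw0, hne⟩ := exists_mem_ne (by omega : 1 < (tw G y).card) w
  obtain ⟨k1, k2⟩ := mem_filter.1 hw0
  obtain ⟨z1, m1, m2, m3⟩ := get3 h3 hwy k1 hne.symm
  exact ⟨w0, z1, m3, hne.symm, m1, m2, k2⟩

theorem weak3 (hM : Mn G L) {v w1 w2 w3 y : V} (hv : nb G v = {w1, w2, w3}) (n1 : w1 ≠ w2)
    (n2 : w1 ≠ w3) (n3 : w2 ≠ w3) (c2 : (nb G w2).card = 2) (c3 : (nb G w3).card = 2)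
    (hw : nb G w1 = {v, y}) (hvy : v ≠ y) : W1 G y := by
  by_contra hW
  obtain ⟨-, w0, z1, k1, k2, k3, k4, k5⟩ := weakNbr hM hv n1 n2 n3 c2 hw hvy hW
  have b2 : v ∈ nb G w2 := mem_nb.2 (mem_nb.1 (by simp [hv] : w2 ∈ nb G v)).symm
  have b3 : v ∈ nb G w3 := mem_nb.2 (mem_nb.1 (by simp [hv] : w3 ∈ nb G v)).symm
  obtain ⟨y2, m2, hy2⟩ := get2 c2 b2
  obtain ⟨y3, m3, hy3⟩ := get2 c3 b3
  exact confC hM hv n1 n2 n3 hw hvy hy2 m2 hy3 m3 k1 k2 k3 k4 k5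

/-- third neighbor of a bad weak neighbor of a `W_2` vertex -/
theorem weak2 (hM : Mn G L) {v w1 w2 z y w0 z1 : V} (hv : nb G v = {w1, w2, z}) (n1 : w1 ≠ w2)
    (n2 : w1 ≠ z) (n3 : w2 ≠ z) (c2 : (nb G w2).card = 2) (hw : nb G w1 = {v, y}) (hvy : v ≠ y)
    (k1 : nb G y = {w1, w0, z1}) (k2 : w1 ≠ w0) (k3 : w1 ≠ z1) (k4 : w0 ≠ z1)
    (k5 : (nb G w0).card = 2) : (nb G z1).card ≠ 2 := by
  intro k6
  have b2 : y ∈ nb G w0 := mem_nb.2 (mem_nb.1 (by simp [k1] : w0 ∈ nb G y)).symm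
  have b3 : y ∈ nb G z1 := mem_nb.2 (mem_nb.1 (by simp [k1] : z1 ∈ nb G y)).symm
  obtain ⟨y2, m2, hy2⟩ := get2 k5 b2
  obtain ⟨y3, m3, hy3⟩ := get2 k6 b3
  exact confC hM k1 k2 k3 k4 (hw.trans (pair_comm _ _)) hvy.symm hy2 m2 hy3 m3 hv n1 n2 n3 c2

theorem weak22 (hM : Mn G L) {v w1 w2 z y1 y2 : V} (hv : nb G v = {w1, w2, z}) (n1 : w1 ≠ w2)
    (n2 : w1 ≠ z) (n3 : w2 ≠ z) (cz : (nb G z).card ≠ 2)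
    (h1 : nb G w1 = {v, y1}) (vy1 : v ≠ y1) (h2 : nb G w2 = {v, y2}) (vy2 : v ≠ y2) :
    W1 G y1 ∨ W1 G y2 := by
  by_contra hW
  rw [not_or] at hW
  have cv : (nb G v).card = 3 := by rw [hv]; exact card_eq_three.2 ⟨_, _, _, n1, n2, n3, rfl⟩
  have c1 : (nb G w1).card = 2 := by rw [h1, card_pair vy1]
  have c2 : (nb G w2).card = 2 := by rw [h2, card_pair vy2]
  have hv' : nb G v = {w2, w1, z} := by rw [hv, insert_comm]
  obtain ⟨d1, w0, z1, k1, k2, k3, k4, k5⟩ := weakNbr hM hv n1 n2 n3 c2 h1 vy1 hW.1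
  obtain ⟨d2, w3, z2, l1, l2, l3, l4, l5⟩ := weakNbr hM hv' n1.symm n3 n2 c1 h2 vy2 hW.2
  have cz1 := weak2 hM hv n1 n2 n3 c2 h1 vy1 k1 k2 k3 k4 k5
  have cz2 := weak2 hM hv' n1.symm n3 n2 c1 h2 vy2 l1 l2 l3 l4 l5
  have y12 : y1 ≠ y2 := by rintro rfl; exact confD hM vy1 n1 h1 h2 cv d1
  exact EC.conf hM (G := G) ⟨hv, h1, h2, k1, l1, cv, d1, d2, k5, c1, c2, l5, cz, cz1, cz2, y12,
    vy1, vy2, n1, k2.symm, l2⟩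

noncomputable def fl (G : SimpleGraph V) (u v : V) : ℤ :=
  if (nb G v).card = 2 then 2 + (if W1 G u then 1 else 0)
  else if (nb G u).card = 2 then (if ∃ a ∈ nb G u, a ≠ v ∧ W1 G a then 1 else 0) else 0

theorem fl_pair {u v y : V} (hv : (nb G v).card ≠ 2) (hu : nb G u = {v, y}) (hvy : v ≠ y) :
    fl G u v = if W1 G y then 1 else 0 := by
  have hc : (nb G u).card = 2 := by rw [hu, card_pair hvy]
  unfold fl
  rw [if_neg hv, if_pos hc]
  congr 1
  rw [hu]
  simp [hvy.symm]

theorem W1_not {v : V} (hv : (nb G v).card = 2) : ¬ W1 G v := fun h => by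
  have := h.1; omega

theorem charge (hM : Mn G L) (v : V) (hv : (nb G v).Nonempty) :
    0 ≤ 7 * ((nb G v).card : ℤ) - 18 + ∑ u ∈ nb G v, (fl G u v - fl G v u) := by
  have h0 := card_pos.2 hv
  have h1 := confA1 hM v
  by_cases h2 : (nb G v).card = 2
  · obtain ⟨a, b, hab, hn⟩ := card_eq_two.1 h2
    have ha : (nb G a).card ≠ 2 := fun h =>
      confA2 hM (mem_nb.1 (by simp [hn] : a ∈ nb G v)) h2 h
    have hb : (nb G b).card ≠ 2 := fun h =>
      confA2 hM (mem_nb.1 (by simp [hn] : b ∈ nb G v)) h2 h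
    have e1 : fl G v a = _ := fl_pair ha hn hab
    have e2 : fl G v b = _ := fl_pair hb (hn.trans (pair_comm _ _)) hab.symm
    rw [h2, hn, sum_pair hab, e1, e2]
    simp only [fl, h2, if_true]
    push_cast
    omega
  -- degree at least three
  have hg : ∀ u ∈ nb G v, u ∉ tw G v → fl G u v - fl G v u = 0 := by
    intro u hu hut
    have : (nb G u).card ≠ 2 := fun h => hut (mem_filter.2 ⟨hu, h⟩)
    simp [fl, h2, this]
  have hs : ∑ u ∈ nb G v, (fl G u v - fl G v u) = ∑ u ∈ tw G v, (fl G u v - fl G v u) :=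
    (sum_subset (filter_subset _ _) hg).symm
  have hlow : ∀ u ∈ tw G v, -(2 + if W1 G v then 1 else 0 : ℤ) ≤ fl G u v - fl G v u := by
    intro u hu
    have hc := (mem_filter.1 hu).2
    have : 0 ≤ fl G u v := by unfold fl; split_ifs <;> omega
    have h3 : fl G v u = 2 + if W1 G v then 1 else 0 := by unfold fl; rw [if_pos hc]
    omega
  have hsum := card_nsmul_le_sum _ _ _ hlow
  rw [hs]
  have htle : (tw G v).card ≤ (nb G v).card := card_le_card (filter_subset _ _)
  by_cases h4 : 4 ≤ (nb G v).card
  · have hW : ¬ W1 G v := fun h => by have := h.1; omega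
    simp only [hW, if_false, nsmul_eq_mul] at hsum
    omega
  have h3 : (nb G v).card = 3 := by omega
  by_cases hW : W1 G v
  · have := hW.2
    rw [h3]
    simp only [hW, if_true, nsmul_eq_mul, this] at hsum
    push_cast at *
    omega
  have hout : ∀ u ∈ tw G v, fl G v u = 2 := by
    intro u hu
    unfold fl
    rw [if_pos (mem_filter.1 hu).2, if_neg hW]
    rfl
  have hother : ∀ u ∈ tw G v, ∃ y, v ≠ y ∧ nb G u = {v, y} := by
    intro u hu
    obtain ⟨k1, k2⟩ := mem_filter.1 hu
    exact get2 k2 (mem_nb.2 (mem_nb.1 k1).symm)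
  have ht1 : (tw G v).card ≠ 1 := fun h => hW ⟨h3, h⟩
  by_cases ht0 : (tw G v).card = 0
  · rw [card_eq_zero.1 ht0, h3]; simp
  by_cases ht2 : (tw G v).card = 2
  · obtain ⟨w1, w2, n1, ht⟩ := card_eq_two.1 ht2
    have m1 : w1 ∈ tw G v := by simp [ht]
    have m2 : w2 ∈ tw G v := by simp [ht]
    obtain ⟨y1, vy1, hw1⟩ := hother _ m1
    obtain ⟨y2, vy2, hw2⟩ := hother _ m2
    obtain ⟨z, n2, n3, hn⟩ := get3 h3 (mem_filter.1 m1).1 (mem_filter.1 m2).1 n1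
    have cz : (nb G z).card ≠ 2 := by
      intro h
      have : z ∈ tw G v := mem_filter.2 ⟨by simp [hn], h⟩
      rw [ht] at this
      simp [n2.symm, n3.symm] at this
    have hor := weak22 hM hn n1 n2 n3 cz hw1 vy1 hw2 vy2
    rw [ht, sum_pair n1, hout _ m1, hout _ m2, fl_pair h2 hw1 vy1, fl_pair h2 hw2 vy2, h3]
    rcases hor with h | h
    · rw [if_pos h]; split_ifs <;> norm_num
    · rw [if_pos h]; split_ifs <;> norm_num
  · have ht3 : (tw G v).card = 3 := by omega
    obtain ⟨w1, w2, w3, n1, n2, n3, ht⟩ := card_eq_three.1 ht3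
    have hn : nb G v = {w1, w2, w3} := by
      rw [← ht]; exact (eq_of_subset_of_card_le (filter_subset _ _) (by rw [h3]; exact ht3.ge)).symm
    have m1 : w1 ∈ tw G v := by simp [ht]
    have m2 : w2 ∈ tw G v := by simp [ht]
    have m3 : w3 ∈ tw G v := by simp [ht]
    obtain ⟨y1, vy1, hw1⟩ := hother _ m1
    obtain ⟨y2, vy2, hw2⟩ := hother _ m2
    obtain ⟨y3, vy3, hw3⟩ := hother _ m3
    have c1 := (mem_filter.1 m1).2
    have c2 := (mem_filter.1 m2).2
    have c3 := (mem_filter.1 m3).2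
    have p1 := weak3 hM hn n1 n2 n3 c2 c3 hw1 vy1
    have p2 := weak3 hM (hn.trans (insert_comm _ _ _)) n1.symm n3 n2 c1 c3 hw2 vy2
    have p3 := weak3 hM (hn.trans (by ext; simp; tauto) : nb G v = {w3, w1, w2}) n2.symm n3.symm n1
      c1 c2 hw3 vy3
    rw [ht, sum_insert (by simp [n1, n2]), sum_pair n3, hout _ m1, hout _ m2, hout _ m3,
      fl_pair h2 hw1 vy1, fl_pair h2 hw2 vy2, fl_pair h2 hw3 vy3, h3, if_pos p1, if_pos p2,
      if_pos p3]
    norm_num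

theorem discharge (hM : Mn G L) :
    0 ≤ ∑ v ∈ univ.filter (fun v => (nb G v).Nonempty), (7 * ((nb G v).card : ℤ) - 18) := by
  have hsw : ∑ v, ∑ u ∈ nb G v, fl G u v = ∑ v, ∑ u ∈ nb G v, fl G v u :=
    sum_comm' (by intro a b; simp [mem_nb, G.adj_comm])
  have hz : ∑ v, ∑ u ∈ nb G v, (fl G u v - fl G v u) = 0 := by
    simp only [sum_sub_distrib, hsw, sub_self]
  have hz2 : ∑ v ∈ univ.filter (fun v => (nb G v).Nonempty),
      ∑ u ∈ nb G v, (fl G u v - fl G v u) = 0 := by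
    rw [← hz]
    refine sum_subset (subset_univ _) ?_
    intro v _ hv
    have : nb G v = ∅ := by
      by_contra h
      exact hv (mem_filter.2 ⟨mem_univ _, nonempty_iff_ne_empty.2 h⟩)
    simp [this]
  have hp := sum_nonneg (s := univ.filter (fun v => (nb G v).Nonempty))
    fun v hv => charge hM v (mem_filter.1 hv).2
  rw [sum_add_distrib, hz2, add_zero] at hp
  exact hp
end configs

section top
variable {V : Type*} [Fintype V]

theorem mad_neg {G G' : SimpleGraph V} (hmad : MadLT G (18 / 7)) (hle : G' ≤ G)
    (hne : ∃ v, (nb G' v).Nonempty) :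
    ∑ v ∈ univ.filter (fun v => (nb G' v).Nonempty), (7 * ((nb G' v).card : ℤ) - 18) < 0 := by
  let H : G.Subgraph :=
    { verts := {v | (nb G' v).Nonempty}
      Adj := G'.Adj
      adj_sub := fun h => hle h
      edge_vert := fun {v w} h => ⟨w, mem_nb.2 h⟩
      symm := G'.symm }
  have hE : H.edgeSet = G'.edgeSet := by
    ext e
    induction e with
    | _ a b => simp only [SimpleGraph.Subgraph.mem_edgeSet, SimpleGraph.mem_edgeSet]; rfl
  have h1 := hmad H hne
  have hv : H.verts.ncard = (univ.filter (fun v => (nb G' v).Nonempty)).card := by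
    rw [← Set.ncard_coe_finset]
    congr 1
    ext v; simp [H]
  have he : H.edgeSet.ncard = G'.edgeFinset.card := by
    rw [hE, ← Set.ncard_coe_finset, SimpleGraph.coe_edgeFinset]
  have hd : ∀ v, G'.degree v = (nb G' v).card := by
    intro v
    rw [← SimpleGraph.card_neighborFinset_eq_degree]
    congr 1
    ext u; simp [mem_nb]
  have hs := G'.sum_degrees_eq_twice_card_edges
  simp only [hd] at hs
  have hs2 : ∑ v ∈ univ.filter (fun v => (nb G' v).Nonempty), (nb G' v).card =
      ∑ v, (nb G' v).card := by
    refine sum_subset (subset_univ _) ?_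
    intro v _ hv
    have : nb G' v = ∅ := by
      by_contra h
      exact hv (mem_filter.2 ⟨mem_univ _, nonempty_iff_ne_empty.2 h⟩)
    simp [this]
  have hpos : 0 < (univ.filter (fun v => (nb G' v).Nonempty)).card := by
    obtain ⟨v, hv⟩ := hne
    exact card_pos.2 ⟨v, by simp [hv]⟩
  rw [hv, he, div_lt_iff₀ (by exact_mod_cast hpos)] at h1
  have h2 : 14 * (G'.edgeFinset.card : ℚ) <
      18 * ((univ.filter (fun v => (nb G' v).Nonempty)).card : ℚ) := by linarith
  have h3 : 14 * G'.edgeFinset.card < 18 * (univ.filter (fun v => (nb G' v).Nonempty)).card := by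
    exact_mod_cast h2
  rw [sum_sub_distrib, ← mul_sum, ← Nat.cast_sum, hs2, hs, sum_const, nsmul_eq_mul]
  push_cast
  omega

theorem col_all {G : SimpleGraph V} {L : V → Finset ℕ} (hmad : MadLT G (18 / 7))
    (hL : ∀ v, 6 ≤ (L v).card) (G' : SimpleGraph V) : G' ≤ G → Col G' L := by
  induction G' using WellFoundedLT.induction with
  | _ G' ih =>
  intro hle
  by_contra hno
  by_cases hne : ∃ v, (nb G' v).Nonempty
  · have hM : Mn G' L := by
      refine ⟨hL, hno, fun X ⟨v, hv, u, hu⟩ => ih _ ?_ ?_⟩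
      · refine lt_of_le_of_ne (fun a b h => h.1) ?_
        intro h
        have h1 := mem_nb.1 hu
        rw [← h] at h1
        exact h1.2.1 hv
      · exact fun a b h => hle h.1
    have := discharge hM
    have := mad_neg hmad hle hne
    omega
  · apply hno
    have h0 : ∀ v, nb G' v = ∅ := fun v => by
      by_contra h
      exact hne ⟨v, nonempty_iff_ne_empty.2 h⟩
    have hc : ∀ v, ∃ c, c ∈ L v := fun v => card_pos.1 (by have := hL v; omega)
    choose φ hφ using hc
    refine ⟨φ, fun u v h => ?_, fun v => by simp [h0], hφ⟩
    have := mem_nb.2 h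
    simp [h0] at this

end top
end Dyn3

theorem mad_lt_implies_ch3d_le_six {V : Type*} [Fintype V] (G : SimpleGraph V)
    (h : MadLT G (18 / 7)) : Ch3dLE G 6 := by
  intro L hL
  obtain ⟨φ, h1, h2, h3⟩ := Dyn3.col_all h hL G le_rfl
  refine ⟨φ, ⟨h1, fun v => ?_⟩, h3⟩
  have hs : G.neighborSet v = (Dyn3.nb G v : Set V) := by
    ext u; simp [Dyn3.mem_nb]
  have h4 := h2 v
  classical
  rw [hs, Set.ncard_coe_finset, ← Finset.coe_image, Set.ncard_coe_finset]
  convert h4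
end

section
/- If G is a finite simple graph with maximum average degree mad(G) < 14/5, then the list 3-dynamic chromatic number of G satisfies ch_3^d(G) ≤ 7. -/
open SimpleGraph

open Classical in
/-- greedy order condition -/
def OkList {V : Type*} (N : V → Finset V) : List V → Prop
  | [] => True
  | a :: t => (N a \ t.toFinset).card ≤ 6 ∧ OkList N t

/-- delete all edges at `v` -/
def delV {V : Type*} (G : SimpleGraph V) (v : V) : SimpleGraph V where
  Adj a b := G.Adj a b ∧ a ≠ v ∧ b ≠ v
  symm := ⟨fun _ _ h => ⟨h.1.symm, h.2.2, h.2.1⟩⟩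
  loopless := ⟨fun _ h => h.1.ne rfl⟩

open Classical in
lemma greedy {V : Type*} (L : V → Finset ℕ) (hL : ∀ v, 7 ≤ (L v).card)
    (C : V → V → Prop) (hC : ∀ a b, C a b → C b a) (hne : ∀ a b, C a b → a ≠ b)
    (N : V → Finset V) (hN : ∀ a b, C a b → b ∈ N a) (l : List V) :
    ∀ φ : V → ℕ, (∀ v, φ v ∈ L v) → (∀ a b, a ∉ l → b ∉ l → C a b → φ a ≠ φ b) →
      OkList N l → ∃ ψ : V → ℕ, (∀ v, ψ v ∈ L v) ∧ ∀ a b, C a b → ψ a ≠ ψ b := by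
  induction l with
  | nil => intro φ h1 h2 _; exact ⟨φ, h1, fun a b h => h2 a b (by simp) (by simp) h⟩
  | cons a t ih =>
    intro φ h1 h2 ⟨h3, h4⟩
    have : ∃ c ∈ L a, c ∉ (N a \ t.toFinset).image φ := by
      apply Finset.exists_mem_notMem_of_card_lt_card
      have := Finset.card_image_le (s := N a \ t.toFinset) (f := φ)
      have := hL a
      omega
    obtain ⟨c, hc, hc'⟩ := this
    have key : ∀ b, b ∉ t → C a b → φ b ≠ c := by
      intro b hb hab h
      exact hc' (Finset.mem_image.2 ⟨b, by simp [hb, hN a b hab], h⟩)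
    refine ih (Function.update φ a c) ?_ ?_ h4
    · intro v
      by_cases hv : v = a
      · subst hv; simpa using hc
      · simpa [hv] using h1 v
    · intro x y hx hy hxy
      by_cases hxa : x = a
      · subst hxa
        have : y ≠ x := (hne _ _ hxy).symm
        simp [this]
        exact (key y hy hxy).symm
      · by_cases hya : y = a
        · subst hya
          simp [hxa]
          exact key x hx (hC _ _ hxy)
        · simp [hxa, hya]
          exact h2 x y (by simp [hxa, hx]) (by simp [hya, hy]) hxy

open Classical in
lemma exists_T {V : Type*} [Fintype V] [Nonempty V] (φ : V → ℕ) (N' N : Finset V) (hs : N' ⊆ N)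
    (h : min 3 N'.card ≤ (N'.image φ).card) :
    ∃ T ⊆ N, T.card = min 3 N.card ∧ ∀ a ∈ T, ∀ b ∈ T, a ∈ N' → b ∈ N' → φ a = φ b → a = b := by
  obtain ⟨I, hI, hIc⟩ := Finset.exists_subset_card_eq h
  obtain ⟨T0, hT0, hinj, him⟩ : ∃ T0 : Finset V, T0 ⊆ N' ∧ Set.InjOn φ T0 ∧ T0.image φ = I := by
    have hex : ∀ i : ℕ, i ∈ I → ∃ a ∈ N', φ a = i := fun i hi => Finset.mem_image.1 (hI hi)
    choose! f hf1 hf2 using hex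
    refine ⟨I.image f, ?_, ?_, ?_⟩
    · intro a ha
      obtain ⟨i, hi, rfl⟩ := Finset.mem_image.1 ha
      exact hf1 i hi
    · intro a ha b hb hab
      obtain ⟨i, hi, rfl⟩ := Finset.mem_image.1 (Finset.mem_coe.1 ha)
      obtain ⟨j, hj, rfl⟩ := Finset.mem_image.1 (Finset.mem_coe.1 hb)
      rw [hf2 i hi, hf2 j hj] at hab
      rw [hab]
    · ext i
      simp only [Finset.mem_image]
      constructor
      · rintro ⟨a, ⟨j, hj, rfl⟩, rfl⟩
        rw [hf2 j hj]; exact hj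
      · intro hi
        exact ⟨f i, ⟨i, hi, rfl⟩, hf2 i hi⟩
  have hc0 : T0.card = min 3 N'.card := by
    rw [← hIc, ← him, Finset.card_image_of_injOn hinj]
  have hcc := Finset.card_le_card hs
  obtain ⟨T, h1, h2, h3⟩ := Finset.exists_subsuperset_card_eq (hT0.trans hs) (n := min 3 N.card)
    (by omega) (by omega)
  refine ⟨T, h2, h3, ?_⟩
  intro a ha b hb ha' hb' hab
  by_cases hd : N'.card < 3
  · have : T0 = N' := Finset.eq_of_subset_of_card_le hT0 (by omega)
    subst this
    exact hinj ha' hb' hab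
  · have : T0 = T := Finset.eq_of_subset_of_card_le h1 (by omega)
    subst this
    exact hinj ha hb hab

open Classical in
lemma reduce {V : Type*} [Fintype V] (G : SimpleGraph V) (L : V → Finset ℕ)
    (hL : ∀ v, 7 ≤ (L v).card) (v : V) (hcol : Dyn3ListColorable (delV G v) L)
    (l : List V) (hvl : v ∈ l)
    (hsub : ∀ a b, G.Adj v a → G.Adj v b → a ≠ b → a ∈ l ∨ b ∈ l)
    (hl : ∀ P : V → V → Finset V, (∀ x a, (P x a).card ≤ 3) →
      (∀ x a b, b ∈ P x a → b = x ∨ (G.Adj x b ∧ b ≠ a)) →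
      OkList (fun a => (G.neighborFinset a).biUnion (fun x => P x a)) l) :
    Dyn3ListColorable G L := by
  obtain ⟨φ, ⟨hp, hd⟩, hφL⟩ := hcol
  have : Nonempty V := ⟨v⟩
  have hT : ∀ x, ∃ T ⊆ G.neighborFinset x, T.card = min 3 (G.neighborFinset x).card ∧
      ∀ a ∈ T, ∀ b ∈ T, (delV G v).Adj x a → (delV G v).Adj x b → φ a = φ b → a = b := by
    intro x
    have := exists_T φ ((delV G v).neighborFinset x) (G.neighborFinset x)
      (by intro a; simp; exact fun h => h.1)
      (by
        have := hd x
        rw [Set.ncard_eq_toFinset_card', Set.ncard_eq_toFinset_card', Set.toFinset_image] at this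
        exact this)
    simpa using this
  choose T hTN hTc hTi using hT
  let P : V → V → Finset V := fun x a => if a ∈ T x then insert x ((T x).erase a) else {x}
  let C : V → V → Prop := fun a b => G.Adj a b ∨ (a ≠ b ∧ ∃ x, a ∈ T x ∧ b ∈ T x)
  have hTA : ∀ x a, a ∈ T x → G.Adj x a := fun x a h => by simpa using hTN x h
  obtain ⟨ψ, hψL, hψ⟩ := greedy L hL C
    (by rintro a b (h | ⟨h, x, h1, h2⟩)
        · exact Or.inl h.symm
        · exact Or.inr ⟨h.symm, x, h2, h1⟩)
    (by rintro a b (h | ⟨h, x, h1, h2⟩)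
        · exact h.ne
        · exact h)
    (fun a => (G.neighborFinset a).biUnion (fun x => P x a))
    (by rintro a b (h | ⟨h, x, h1, h2⟩)
        · simp only [Finset.mem_biUnion, mem_neighborFinset]
          refine ⟨b, h, ?_⟩
          simp only [P]; split_ifs <;> simp
        · simp only [Finset.mem_biUnion, mem_neighborFinset]
          refine ⟨x, (hTA x a h1).symm, ?_⟩
          simp [P, h1, h2, h.symm])
    l φ hφL
    (by
      rintro a b ha hb (h | ⟨h, x, h1, h2⟩)
      · exact hp a b ⟨h, fun e => ha (e ▸ hvl), fun e => hb (e ▸ hvl)⟩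
      · by_cases hx : x = v
        · subst hx
          rcases hsub a b (hTA _ _ h1) (hTA _ _ h2) h with h | h
          · exact absurd h ha
          · exact absurd h hb
        · intro e
          exact h (hTi x a h1 b h2 ⟨hTA _ _ h1, hx, fun e => ha (e ▸ hvl)⟩
            ⟨hTA _ _ h2, hx, fun e => hb (e ▸ hvl)⟩ e))
    (hl P
      (by
        intro x a
        have := hTc x
        simp only [P]; split_ifs with h
        · have h1 := Finset.card_insert_le x ((T x).erase a)
          have h2 := Finset.card_erase_add_one h
          omega
        · simp)
      (by
        intro x a b hb
        simp only [P] at hb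
        split_ifs at hb with h
        · simp only [Finset.mem_insert, Finset.mem_erase] at hb
          rcases hb with hb | hb
          · exact Or.inl hb
          · exact Or.inr ⟨hTA _ _ hb.2, hb.1⟩
        · exact Or.inl (by simpa using hb)))
  refine ⟨ψ, ⟨fun a b h => hψ a b (Or.inl h), ?_⟩, hψL⟩
  intro x
  rw [Set.ncard_eq_toFinset_card', Set.ncard_eq_toFinset_card', Set.toFinset_image]
  change min 3 (G.neighborFinset x).card ≤ ((G.neighborFinset x).image ψ).card
  rw [← hTc x, ← Finset.card_image_of_injOn (f := ψ) (s := T x)]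
  · exact Finset.card_le_card (Finset.image_subset_image (hTN x))
  · intro a ha b hb e
    by_contra hab
    exact hψ a b (Or.inr ⟨hab, x, ha, hb⟩) e

section combin
open Classical

lemma nb2 {V : Type*} [Fintype V] {G : SimpleGraph V} {v u : V} (h : G.degree v ≤ 2)
    (hu : G.Adj v u) : ∃ w, ∀ x, G.Adj v x → x = u ∨ x = w := by
  have h1 : ((G.neighborFinset v).erase u).card ≤ 1 := by
    rw [Finset.card_erase_of_mem (by simpa using hu)]; simpa using h
  have : Nonempty V := ⟨v⟩
  obtain ⟨w, hw⟩ := Finset.card_le_one_iff_subset_singleton.1 h1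
  refine ⟨w, fun x hx => ?_⟩
  by_contra! hh
  have := hw (show x ∈ _ by simp [hh.1, hx])
  simp at this
  exact hh.2 this

lemma nb3 {V : Type*} [Fintype V] {G : SimpleGraph V} {v u u' : V} (h : G.degree v = 3)
    (hu : G.Adj v u) (hu' : G.Adj v u') (hne : u ≠ u') :
    ∃ w, ∀ x, G.Adj v x → x = u ∨ x = u' ∨ x = w := by
  have h1 : (((G.neighborFinset v).erase u).erase u').card ≤ 1 := by
    rw [Finset.card_erase_of_mem (by simp [hu', hne.symm]),
      Finset.card_erase_of_mem (by simpa using hu)]; simp [h]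
  have : Nonempty V := ⟨v⟩
  obtain ⟨w, hw⟩ := Finset.card_le_one_iff_subset_singleton.1 h1
  refine ⟨w, fun x hx => ?_⟩
  by_contra! hh
  have := hw (show x ∈ _ by simp [hh.1, hh.2.1, hx])
  simp at this
  exact hh.2.2 this

lemma nb4 {V : Type*} [Fintype V] {G : SimpleGraph V} {v a b c : V} (h : G.degree v = 4)
    (ha : G.Adj v a) (hb : G.Adj v b) (hc : G.Adj v c) (hab : a ≠ b) (hac : a ≠ c)
    (hbc : b ≠ c) :
    ∃ w, ∀ x, G.Adj v x → x = a ∨ x = b ∨ x = c ∨ x = w := by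
  have h1 : ((((G.neighborFinset v).erase a).erase b).erase c).card ≤ 1 := by
    rw [Finset.card_erase_of_mem (by simp [hc, hac.symm, hbc.symm]),
      Finset.card_erase_of_mem (by simp [hb, hab.symm]),
      Finset.card_erase_of_mem (by simpa using ha)]; simp [h]
  have : Nonempty V := ⟨v⟩
  obtain ⟨w, hw⟩ := Finset.card_le_one_iff_subset_singleton.1 h1
  refine ⟨w, fun x hx => ?_⟩
  by_contra! hh
  have := hw (show x ∈ _ by simp [hh.1, hh.2.1, hh.2.2.1, hx])
  simp at this
  exact hh.2.2.2 this

/-- the set of conflicts coming from a vertex with at most two neighbours -/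
lemma bnd2 {V : Type*} [Fintype V] {G : SimpleGraph V} {P : V → V → Finset V}
    (h3 : ∀ x a, (P x a).card ≤ 3) {v : V} (h : G.degree v ≤ 2) (S : Finset V) :
    (((G.neighborFinset v).biUnion (fun x => P x v)) \ S).card ≤ 6 := by
  refine (Finset.card_le_card Finset.sdiff_subset).trans ?_
  refine (Finset.card_biUnion_le_card_mul _ _ 3 (fun x _ => h3 x v)).trans ?_
  have : (G.neighborFinset v).card ≤ 2 := by simpa using h
  omega

/-- explicit bound -/
lemma bnd {V : Type*} [Fintype V] {G : SimpleGraph V} {P : V → V → Finset V}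
    (h3 : ∀ x a, (P x a).card ≤ 3) {v : V} (z p q r : V) (S : Finset V)
    (h : ∀ x b, G.Adj v x → b ∈ P x v → b ∉ S → b = p ∨ b = q ∨ b = r ∨ b ∈ P z v) :
    (((G.neighborFinset v).biUnion (fun x => P x v)) \ S).card ≤ 6 := by
  have : (((G.neighborFinset v).biUnion (fun x => P x v)) \ S) ⊆ {p, q, r} ∪ P z v := by
    intro b hb
    simp only [Finset.mem_sdiff, Finset.mem_biUnion, mem_neighborFinset] at hb
    obtain ⟨⟨x, hx, hb⟩, hS⟩ := hb
    have := h x b hx hb hS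
    simp only [Finset.mem_union, Finset.mem_insert, Finset.mem_singleton]
    tauto
  refine (Finset.card_le_card this).trans ((Finset.card_union_le _ _).trans ?_)
  have := h3 z v
  have := Finset.card_le_three (a := p) (b := q) (c := r)
  omega

/-- number of 2-neighbours -/
noncomputable def n2 {V : Type*} [Fintype V] (G : SimpleGraph V) (v : V) : ℕ :=
  ((G.neighborFinset v).filter (fun x => G.degree x = 2)).card

def W1 {V : Type*} [Fintype V] (G : SimpleGraph V) (v : V) : Prop :=
  G.degree v = 3 ∧ n2 G v = 1

lemma R1 {V : Type*} [Fintype V] {G : SimpleGraph V} {L : V → Finset ℕ}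
    (hL : ∀ v, 7 ≤ (L v).card) (hno : ¬ Dyn3ListColorable G L)
    (IH : ∀ v u, G.Adj v u → Dyn3ListColorable (delV G v) L) (v : V) : G.degree v ≠ 1 := by
  intro h
  obtain ⟨u, hu⟩ := (G.degree_pos_iff_exists_adj v).1 (by omega)
  obtain ⟨w, hw⟩ := Finset.card_eq_one.1 (show (G.neighborFinset v).card = 1 by simpa using h)
  refine hno (reduce G L hL v (IH v u hu) [v] (by simp) ?_ ?_)
  · intro a b ha hb hab
    rw [← mem_neighborFinset, hw, Finset.mem_singleton] at ha hb
    exact absurd (ha.trans hb.symm) hab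
  · intro P h3 hP
    exact ⟨bnd2 h3 (by omega) _, trivial⟩

lemma R2 {V : Type*} [Fintype V] {G : SimpleGraph V} {L : V → Finset ℕ}
    (hL : ∀ v, 7 ≤ (L v).card) (hno : ¬ Dyn3ListColorable G L)
    (IH : ∀ v u, G.Adj v u → Dyn3ListColorable (delV G v) L) (u v : V) (huv : G.Adj v u)
    (hu : G.degree u = 2) (hv : G.degree v = 2) : False := by
  obtain ⟨w, hw⟩ := nb2 hv.le huv
  refine hno (reduce G L hL v (IH v u huv) [u, v] (by simp) ?_ ?_)
  · intro a b ha hb hab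
    have := hw a ha
    have := hw b hb
    simp only [List.mem_cons]
    grind
  · intro P h3 hP
    exact ⟨bnd2 h3 (by omega) _, bnd2 h3 (by omega) _, trivial⟩

lemma R3 {V : Type*} [Fintype V] {G : SimpleGraph V} {L : V → Finset ℕ}
    (hL : ∀ v, 7 ≤ (L v).card) (hno : ¬ Dyn3ListColorable G L)
    (IH : ∀ v u, G.Adj v u → Dyn3ListColorable (delV G v) L) (u : V)
    (hu : G.degree u = 3) : n2 G u ≤ 1 := by
  by_contra! hn
  obtain ⟨v₁, h1, v₂, h2, hne⟩ := Finset.one_lt_card.1 hn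
  simp only [Finset.mem_filter, mem_neighborFinset] at h1 h2
  obtain ⟨h1, d1⟩ := h1
  obtain ⟨h2, d2⟩ := h2
  obtain ⟨z, hz⟩ := nb3 hu h1 h2 hne
  obtain ⟨x₁, hx1⟩ := nb2 d1.le h1.symm
  obtain ⟨x₂, hx2⟩ := nb2 d2.le h2.symm
  refine hno (reduce G L hL v₁ (IH v₁ u h1.symm) [u, v₁, v₂] (by simp) ?_ ?_)
  · intro a b ha hb hab
    have := hx1 a ha
    have := hx1 b hb
    simp only [List.mem_cons]
    grind
  · intro P h3 hP
    refine ⟨bnd h3 z x₁ x₂ x₂ _ ?_, bnd2 h3 (by omega) _, bnd2 h3 (by omega) _, trivial⟩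
    intro x b hx hb hS
    have := hP x u b hb
    simp only [List.toFinset_cons, List.toFinset_nil, Finset.mem_insert, not_or] at hS
    rcases hz x hx with rfl | rfl | rfl <;> grind

lemma R6 {V : Type*} [Fintype V] {G : SimpleGraph V} {L : V → Finset ℕ}
    (hL : ∀ v, 7 ≤ (L v).card) (hno : ¬ Dyn3ListColorable G L)
    (IH : ∀ v u, G.Adj v u → Dyn3ListColorable (delV G v) L) (u : V)
    (hu : G.degree u = 4) : n2 G u ≤ 2 := by
  by_contra! hn
  obtain ⟨v₁, v₂, v₃, h1, h2, h3, h12, h13, h23⟩ := Finset.two_lt_card_iff.1 hn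
  simp only [Finset.mem_filter, mem_neighborFinset] at h1 h2 h3
  obtain ⟨h1, d1⟩ := h1
  obtain ⟨h2, d2⟩ := h2
  obtain ⟨h3, d3⟩ := h3
  obtain ⟨z, hz⟩ := nb4 hu h1 h2 h3 h12 h13 h23
  obtain ⟨x₁, hx1⟩ := nb2 d1.le h1.symm
  obtain ⟨x₂, hx2⟩ := nb2 d2.le h2.symm
  obtain ⟨x₃, hx3⟩ := nb2 d3.le h3.symm
  refine hno (reduce G L hL v₁ (IH v₁ u h1.symm) [u, v₁, v₂, v₃] (by simp) ?_ ?_)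
  · intro a b ha hb hab
    have := hx1 a ha
    have := hx1 b hb
    simp only [List.mem_cons]
    grind
  · intro P h3 hP
    refine ⟨bnd h3 z x₁ x₂ x₃ _ ?_, bnd2 h3 (by omega) _, bnd2 h3 (by omega) _,
      bnd2 h3 (by omega) _, trivial⟩
    intro x b hx hb hS
    have := hP x u b hb
    simp only [List.toFinset_cons, List.toFinset_nil, Finset.mem_insert, not_or] at hS
    rcases hz x hx with rfl | rfl | rfl | rfl <;> grind

lemma W1_data {V : Type*} [Fintype V] {G : SimpleGraph V} {u y : V} (h : W1 G u)
    (hy : G.Adj u y) (hd : G.degree y = 3) :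
    ∃ v w z, G.Adj u v ∧ G.degree v = 2 ∧ (∀ x, G.Adj v x → x = u ∨ x = w) ∧
      (∀ x, G.Adj u x → x = y ∨ x = v ∨ x = z) := by
  obtain ⟨hu, hn⟩ := h
  obtain ⟨v, hv⟩ := Finset.card_pos.1 (show 0 < n2 G u by omega)
  simp only [Finset.mem_filter, mem_neighborFinset] at hv
  obtain ⟨hv, dv⟩ := hv
  obtain ⟨w, hw⟩ := nb2 dv.le hv.symm
  obtain ⟨z, hz⟩ := nb3 hu hy hv (by rintro rfl; omega)
  exact ⟨v, w, z, hv, dv, hw, hz⟩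

lemma R4 {V : Type*} [Fintype V] {G : SimpleGraph V} {L : V → Finset ℕ}
    (hL : ∀ v, 7 ≤ (L v).card) (hno : ¬ Dyn3ListColorable G L)
    (IH : ∀ v u, G.Adj v u → Dyn3ListColorable (delV G v) L) (u y : V)
    (hu : W1 G u) (hy : W1 G y) (huy : G.Adj u y) : False := by
  obtain ⟨v, w, z, huv, dv, hw, hz⟩ := W1_data hu huy hy.1
  obtain ⟨v', w', z', hyv, dv', hw', hz'⟩ := W1_data hy huy.symm hu.1
  refine hno (reduce G L hL v (IH v u huv.symm) [u, y, v, v'] (by simp) ?_ ?_)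
  · intro a b ha hb hab
    have := hw a ha
    have := hw b hb
    simp only [List.mem_cons]
    grind
  · intro P h3 hP
    refine ⟨bnd h3 z w z' z' _ ?_, bnd h3 z' w' u z _ ?_, bnd2 h3 (by omega) _,
      bnd2 h3 (by omega) _, trivial⟩
    · intro x b hx hb hS
      have := hP x u b hb
      simp only [List.toFinset_cons, List.toFinset_nil, Finset.mem_insert, not_or] at hS
      rcases hz x hx with rfl | rfl | rfl <;> grind
    · intro x b hx hb hS
      have := hP x y b hb
      simp only [List.toFinset_cons, List.toFinset_nil, Finset.mem_insert, not_or] at hS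
      rcases hz' x hx with rfl | rfl | rfl <;> grind

/-- explicit bound, six vertices -/
lemma bnd' {V : Type*} [Fintype V] {G : SimpleGraph V} {P : V → V → Finset V}
    {v : V} (a b c d e f : V) (S : Finset V)
    (h : ∀ x t, G.Adj v x → t ∈ P x v → t ∉ S →
      t = a ∨ t = b ∨ t = c ∨ t = d ∨ t = e ∨ t = f) :
    (((G.neighborFinset v).biUnion (fun x => P x v)) \ S).card ≤ 6 := by
  have : (((G.neighborFinset v).biUnion (fun x => P x v)) \ S) ⊆ {a, b, c, d, e, f} := by
    intro b hb
    simp only [Finset.mem_sdiff, Finset.mem_biUnion, mem_neighborFinset] at hb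
    obtain ⟨⟨x, hx, hb⟩, hS⟩ := hb
    have := h x b hx hb hS
    simp only [Finset.mem_insert, Finset.mem_singleton]
    tauto
  exact (Finset.card_le_card this).trans Finset.card_le_six

lemma R5 {V : Type*} [Fintype V] {G : SimpleGraph V} {L : V → Finset ℕ}
    (hL : ∀ v, 7 ≤ (L v).card) (hno : ¬ Dyn3ListColorable G L)
    (IH : ∀ v u, G.Adj v u → Dyn3ListColorable (delV G v) L) (y : V)
    (hy : G.degree y = 3) (h : ∀ x, G.Adj y x → W1 G x) : False := by
  obtain ⟨u₁, u₂, u₃, h12, h13, h23, hN⟩ :=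
    Finset.card_eq_three.1 (show (G.neighborFinset y).card = 3 by simpa using hy)
  have hN' : ∀ x, G.Adj y x ↔ x = u₁ ∨ x = u₂ ∨ x = u₃ := by
    intro x; rw [← mem_neighborFinset, hN]; simp
  have a1 := (hN' u₁).2 (by simp)
  have a2 := (hN' u₂).2 (by simp)
  have a3 := (hN' u₃).2 (by simp)
  obtain ⟨v₁, w₁, z₁, huv1, dv1, hw1, hz1⟩ := W1_data (h _ a1) a1.symm hy
  obtain ⟨v₂, w₂, z₂, huv2, dv2, hw2, hz2⟩ := W1_data (h _ a2) a2.symm hy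
  obtain ⟨v₃, w₃, z₃, huv3, dv3, hw3, hz3⟩ := W1_data (h _ a3) a3.symm hy
  refine hno (reduce G L hL v₁ (IH v₁ u₁ huv1.symm) [u₁, y, v₁, v₂, v₃] (by simp) ?_ ?_)
  · intro a b ha hb hab
    have := hw1 a ha
    have := hw1 b hb
    simp only [List.mem_cons]
    grind
  · intro P h3 hP
    refine ⟨bnd h3 z₁ w₁ u₂ u₃ _ ?_, bnd' u₁ z₁ u₂ z₂ u₃ z₃ _ ?_, bnd2 h3 (by omega) _,
      bnd2 h3 (by omega) _, bnd2 h3 (by omega) _, trivial⟩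
    · intro x b hx hb hS
      have := hP x _ b hb
      simp only [List.toFinset_cons, List.toFinset_nil, Finset.mem_insert, not_or] at hS
      rcases hz1 x hx with rfl | rfl | rfl <;> grind
    · intro x b hx hb hS
      have := hP x y b hb
      simp only [List.toFinset_cons, List.toFinset_nil, Finset.mem_insert, not_or] at hS
      rcases (hN' x).1 hx with rfl | rfl | rfl <;> grind

/-- discharging rule -/
noncomputable def gv {V : Type*} [Fintype V] (G : SimpleGraph V) (x y : V) : ℤ :=
  if G.degree x = 2 then 0 else if G.degree y = 2 then 4 else
    if W1 G x then 0 else if W1 G y then 1 else 0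

lemma gv_nonneg {V : Type*} [Fintype V] (G : SimpleGraph V) (x y : V) : 0 ≤ gv G x y := by
  unfold gv; split_ifs <;> norm_num

lemma n2_sum {V : Type*} [Fintype V] (G : SimpleGraph V) (v : V) (a b : ℤ) :
    ∑ x ∈ G.neighborFinset v, (if G.degree x = 2 then a else b) =
      a * n2 G v + b * (G.degree v - n2 G v) := by
  rw [Finset.sum_ite]
  have := Finset.card_filter_add_card_filter_not (s := G.neighborFinset v)
    (fun x => G.degree x = 2)
  rw [card_neighborFinset_eq_degree] at this
  simp only [Finset.sum_const, nsmul_eq_mul, n2]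
  rw [← this]; push_cast; ring

lemma discharge {V : Type*} [Fintype V] {G : SimpleGraph V} {L : V → Finset ℕ}
    (hL : ∀ v, 7 ≤ (L v).card) (hno : ¬ Dyn3ListColorable G L)
    (IH : ∀ v u, G.Adj v u → Dyn3ListColorable (delV G v) L) (v : V)
    (hv : 0 < G.degree v) :
    28 ≤ 10 * (G.degree v : ℤ) + ∑ x ∈ G.neighborFinset v, gv G x v
      - ∑ x ∈ G.neighborFinset v, gv G v x := by
  have r1 := R1 hL hno IH
  have r2 := R2 hL hno IH
  have r3 := R3 hL hno IH
  have r4 := R4 hL hno IH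
  have r5 := R5 hL hno IH
  have r6 := R6 hL hno IH
  have hin : 0 ≤ ∑ x ∈ G.neighborFinset v, gv G x v :=
    Finset.sum_nonneg fun x _ => gv_nonneg G x v
  have hout : ∑ x ∈ G.neighborFinset v, gv G v x ≤ 4 * n2 G v + 1 * (G.degree v - n2 G v) := by
    rw [← n2_sum]
    refine Finset.sum_le_sum fun x _ => ?_
    unfold gv; split_ifs <;> norm_num
  have hn : n2 G v ≤ G.degree v := by
    unfold n2; rw [← card_neighborFinset_eq_degree]; exact Finset.card_filter_le _ _
  have hv1 := r1 v
  by_cases h2 : G.degree v = 2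
  · have e1 : ∑ x ∈ G.neighborFinset v, gv G x v = 8 := by
      rw [Finset.sum_congr rfl (g := fun _ => (4 : ℤ))]
      · simp [h2]
      · intro x hx
        have : G.degree x ≠ 2 := fun h => r2 x v (by simpa using hx) h h2
        simp [gv, this, h2]
    have e2 : ∑ x ∈ G.neighborFinset v, gv G v x = 0 :=
      Finset.sum_eq_zero fun x _ => by simp [gv, h2]
    omega
  by_cases h3 : G.degree v = 3
  · have := r3 v h3
    by_cases hw : W1 G v
    · have e1 : ∑ x ∈ G.neighborFinset v, gv G x v = 2 := by
        rw [Finset.sum_congr rfl (g := fun x => if G.degree x = 2 then (0 : ℤ) else 1), n2_sum,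
          hw.2, h3]
        · norm_num
        · intro x hx
          have : ¬ W1 G x := fun h => r4 v x hw h (by simpa using hx)
          simp [gv, this, h2, hw]
      have e2 : ∑ x ∈ G.neighborFinset v, gv G v x = 4 := by
        rw [Finset.sum_congr rfl (g := fun x => if G.degree x = 2 then (4 : ℤ) else 0), n2_sum,
          hw.2, h3]
        · norm_num
        · intro x hx
          simp [gv, h2, hw]
      omega
    · have hn0 : n2 G v = 0 := by
        by_contra hne
        exact hw ⟨h3, by omega⟩
      have : ∃ x, G.Adj v x ∧ ¬ W1 G x := by
        by_contra! hh
        exact r5 v h3 hh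
      obtain ⟨x₀, hx0, hx0'⟩ := this
      have hd0 : G.degree x₀ ≠ 2 := by
        intro h
        rw [n2, Finset.card_eq_zero] at hn0
        have : x₀ ∈ (G.neighborFinset v).filter (fun x => G.degree x = 2) := by simp [hx0, h]
        simp [hn0] at this
      have hnd : ∀ x ∈ G.neighborFinset v, G.degree x ≠ 2 := by
        intro x hx h
        rw [n2, Finset.card_eq_zero] at hn0
        have : x ∈ (G.neighborFinset v).filter (fun x => G.degree x = 2) := by
          simpa [h] using hx
        simp [hn0] at this
      have e2 : ∑ x ∈ G.neighborFinset v, gv G v x ≤ 2 := by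
        have hm : x₀ ∈ G.neighborFinset v := by simpa using hx0
        rw [← Finset.add_sum_erase _ _ hm]
        have : gv G v x₀ = 0 := by simp [gv, hd0, hx0']
        rw [this]
        have : ∑ x ∈ (G.neighborFinset v).erase x₀, gv G v x ≤
            ∑ x ∈ (G.neighborFinset v).erase x₀, (1 : ℤ) := by
          refine Finset.sum_le_sum fun x hx => ?_
          have := hnd x (Finset.mem_of_mem_erase hx)
          unfold gv; rw [if_neg h2, if_neg this]; split_ifs <;> norm_num
        rw [Finset.sum_const, Finset.card_erase_of_mem hm] at this
        simpa [h3] using this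
      omega
  by_cases h4 : G.degree v = 4
  · have := r6 v h4
    omega
  omega

lemma sum_swap {V : Type*} [Fintype V] (G : SimpleGraph V) :
    ∑ v, ∑ x ∈ G.neighborFinset v, gv G x v = ∑ v, ∑ x ∈ G.neighborFinset v, gv G v x := by
  rw [Finset.sum_comm']
  intro x y
  simp [G.adj_comm]

lemma main_ind {V : Type*} [Fintype V] (L : V → Finset ℕ) (hL : ∀ v, 7 ≤ (L v).card)
    (G : SimpleGraph V) : 
    (∀ G' ≤ G, G' ≠ ⊥ → 5 * ∑ v, G'.degree v <
      14 * (Finset.univ.filter (fun v => 0 < G'.degree v)).card) →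
    Dyn3ListColorable G L := by
  induction G using WellFoundedLT.induction with
  | ind G ih =>
    intro hm
    by_contra hno
    have IH : ∀ v u, G.Adj v u → Dyn3ListColorable (delV G v) L := by
      intro v u huv
      have hle : delV G v ≤ G := fun a b h => h.1
      refine ih _ (lt_of_le_of_ne hle ?_) (fun G' h' => hm G' (h'.trans hle))
      intro e
      rw [← e] at huv
      exact huv.2.1 rfl
    by_cases hbot : G = ⊥
    · subst hbot
      apply hno
      have : ∀ v, ∃ c, c ∈ L v := fun v => Finset.card_pos.1 (by have := hL v; omega)
      choose φ hφ using this
      refine ⟨φ, ⟨fun u v h => absurd h (by simp), fun v => ?_⟩, hφ⟩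
      have : (⊥ : SimpleGraph V).neighborSet v = ∅ := by ext; simp
      simp [this]
    have h1 := hm G le_rfl hbot
    have h2 : ∑ v ∈ Finset.univ.filter (fun v => 0 < G.degree v), (28 : ℤ) ≤
        ∑ v ∈ Finset.univ.filter (fun v => 0 < G.degree v),
        (10 * (G.degree v : ℤ) + ∑ x ∈ G.neighborFinset v, gv G x v
      - ∑ x ∈ G.neighborFinset v, gv G v x) :=
      Finset.sum_le_sum fun v hv => discharge hL hno IH v (by simpa using hv)
    rw [Finset.sum_filter_of_ne (p := fun v => 0 < G.degree v)
      (f := fun v => 10 * (G.degree v : ℤ) + ∑ x ∈ G.neighborFinset v, gv G x v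
        - ∑ x ∈ G.neighborFinset v, gv G v x)] at h2
    · rw [Finset.sum_sub_distrib, Finset.sum_add_distrib, sum_swap, ← Finset.mul_sum] at h2
      simp only [Finset.sum_const, nsmul_eq_mul] at h2
      have h1' : (5 * ∑ v, (G.degree v : ℤ)) <
          14 * ((Finset.univ.filter (fun v => 0 < G.degree v)).card : ℤ) := by exact_mod_cast h1
      linarith
    · intro v _ hne
      by_contra h0
      apply hne
      have : G.degree v = 0 := by omega
      have h' : G.neighborFinset v = ∅ := by
        rw [← Finset.card_eq_zero]; simpa using this
      simp [this, h']

end combin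

theorem mad_lt_implies_ch3d_le_seven {V : Type*} [Fintype V] (G : SimpleGraph V)
    (h : MadLT G (14 / 5)) : Ch3dLE G 7 := by
  classical
  intro L hL
  refine main_ind L hL G ?_
  intro G' hle hne
  let H : G.Subgraph :=
    { verts := {v | 0 < G'.degree v}
      Adj := G'.Adj
      adj_sub := fun h => hle h
      edge_vert := fun {a b} h => (G'.degree_pos_iff_exists_adj a).2 ⟨b, h⟩
      symm := G'.symm }
  have hH : H.verts.Nonempty := by
    obtain ⟨a, b, hab⟩ := SimpleGraph.ne_bot_iff_exists_adj.1 hne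
    exact ⟨a, (G'.degree_pos_iff_exists_adj a).2 ⟨b, hab⟩⟩
  have h1 := h H hH
  have hE : H.edgeSet = G'.edgeSet := by
    ext e; induction e using Sym2.ind with | _ a b => rfl
  have hv : H.verts.ncard = (Finset.univ.filter (fun v => 0 < G'.degree v)).card := by
    rw [← Set.ncard_coe_finset]; congr 1; ext; simp [H]
  have hpos : 0 < H.verts.ncard := (Set.ncard_pos (Set.toFinite _)).2 hH
  rw [div_lt_iff₀ (by exact_mod_cast hpos), hE, hv] at h1
  have h2 := G'.sum_degrees_eq_twice_card_edges
  have h3 : G'.edgeSet.ncard = G'.edgeFinset.card := by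
    rw [← Set.ncard_coe_finset]; simp
  rw [h3] at h1
  have h4 : (5 * (2 * G'.edgeFinset.card) : ℚ) <
    14 * (Finset.univ.filter (fun v => 0 < G'.degree v)).card := by linarith
  rw [h2]
  exact_mod_cast h4
end

section
/- If G is a finite simple graph with maximum average degree mad(G) < 3, then the list 3-dynamic chromatic number of G satisfies ch_3^d(G) ≤ 8. -/
open SimpleGraph

section Aux
open Classical

noncomputable def nbA {V : Type*} [Fintype V] (G : SimpleGraph V) (x : V) : Finset V :=
  Finset.univ.filter (fun y => G.Adj x y)

lemma mem_nbA {V : Type*} [Fintype V] (G : SimpleGraph V) (x y : V) :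
    y ∈ nbA G x ↔ G.Adj x y := by simp [nbA]

def QA {V : Type*} [Fintype V] (G : SimpleGraph V) (φ : V → ℕ) (U : Finset V) : Prop :=
  (∀ x y, G.Adj x y → x ∉ U → y ∉ U → φ x ≠ φ y) ∧
  ∀ v, min 3 (nbA G v).card ≤ ((nbA G v \ U).image φ).card + (nbA G v ∩ U).card

lemma QA_empty {V : Type*} [Fintype V] (G : SimpleGraph V) (φ : V → ℕ) :
    QA G φ ∅ ↔ IsDyn3Coloring G φ := by
  have h1 : ∀ v, (G.neighborSet v) = (nbA G v : Set V) := by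
    intro v; ext y; simp [mem_nbA]
  unfold QA IsDyn3Coloring
  simp only [h1, Set.ncard_coe_finset, ← Finset.coe_image]
  simp

noncomputable def badA {V : Type*} [Fintype V] (G : SimpleGraph V) (φ : V → ℕ) (U : Finset V)
    (y : V) : Finset ℕ :=
  (if y ∈ U then ∅ else {φ y}) ∪
    (if ((nbA G y \ U).image φ).card ≤ 2 then (nbA G y \ U).image φ else ∅)

lemma badA_le3 {V : Type*} [Fintype V] (G : SimpleGraph V) (φ : V → ℕ) (U : Finset V)
    (y : V) : (badA G φ U y).card ≤ 3 := by
  unfold badA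
  refine (Finset.card_union_le _ _).trans ?_
  split_ifs <;> simp <;> omega

lemma badA_le1 {V : Type*} [Fintype V] (G : SimpleGraph V) (φ : V → ℕ) (U : Finset V)
    (x y : V) (hx : x ∈ U) (hy : y ∈ U) (hxy : G.Adj x y) (hd : (nbA G y).card ≤ 2) :
    (badA G φ U y).card ≤ 1 := by
  have h1 : (nbA G y \ U).card < (nbA G y).card := by
    apply Finset.card_lt_card
    refine ⟨Finset.sdiff_subset, fun h => ?_⟩
    have := h ((mem_nbA G y x).2 hxy.symm)
    simp [hx] at this
  have h2 : ((nbA G y \ U).image φ).card ≤ (nbA G y \ U).card := Finset.card_image_le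
  unfold badA
  rw [if_pos hy, Finset.empty_union]
  split_ifs
  · omega
  · simp

lemma stepA {V : Type*} [Fintype V] (G : SimpleGraph V) (φ : V → ℕ) (U : Finset V)
    (hQ : QA G φ U) (x : V) (hx : x ∈ U) (l : Finset ℕ) (hl : 8 ≤ l.card)
    (hb : ∑ y ∈ nbA G x, (badA G φ U y).card ≤ 7) :
    ∃ c ∈ l, QA G (Function.update φ x c) (U.erase x) := by
  have h1 : ((nbA G x).biUnion (badA G φ U)).card < l.card :=
    lt_of_le_of_lt Finset.card_biUnion_le (by omega)
  obtain ⟨c, hc, hcb⟩ := Finset.exists_mem_notMem_of_card_lt_card h1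
  refine ⟨c, hc, ?_, ?_⟩
  · have key : ∀ y, G.Adj x y → y ∉ U → c ≠ φ y := by
      intro y hy hyU he
      apply hcb
      rw [Finset.mem_biUnion]
      exact ⟨y, (mem_nbA G x y).2 hy, by simp [badA, hyU, he]⟩
    intro a b hab ha hb'
    by_cases hax : a = x
    · subst hax
      have hba : b ≠ a := hab.ne'
      rw [Function.update_self, Function.update_of_ne hba]
      exact key b hab (by simpa [hba] using hb')
    · by_cases hbx : b = x
      · subst hbx
        rw [Function.update_self, Function.update_of_ne hax]
        exact (key a hab.symm (by simpa [hax] using ha)).symm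
      · rw [Function.update_of_ne hax, Function.update_of_ne hbx]
        exact hQ.1 a b hab (by simpa [hax] using ha) (by simpa [hbx] using hb')
  · intro v
    have hv := hQ.2 v
    have himg : (nbA G v \ U).image (Function.update φ x c) = (nbA G v \ U).image φ := by
      apply Finset.image_congr
      intro z hz
      have : z ≠ x := by rintro rfl; simp [hx] at hz
      simp [Function.update_of_ne this]
    by_cases hxv : x ∈ nbA G v
    · have e1 : nbA G v \ U.erase x = insert x (nbA G v \ U) := by
        ext z; by_cases hz : z = x <;> simp [hz, hxv]
      have e2 : nbA G v ∩ U = insert x (nbA G v ∩ U.erase x) := by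
        ext z; by_cases hz : z = x <;> simp [hz, hxv, hx]
      rw [e2, Finset.card_insert_of_notMem (by simp)] at hv
      rw [e1, Finset.image_insert, Function.update_self, himg]
      by_cases h2 : ((nbA G v \ U).image φ).card ≤ 2
      · rw [Finset.card_insert_of_notMem]
        · omega
        · intro hcm
          apply hcb
          rw [Finset.mem_biUnion]
          refine ⟨v, (mem_nbA G x v).2 ((mem_nbA G v x).1 hxv).symm, ?_⟩
          unfold badA
          rw [if_pos h2]
          exact Finset.mem_union_right _ hcm
      · have := Finset.card_le_card (Finset.subset_insert c ((nbA G v \ U).image φ))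
        omega
    · have e1 : nbA G v \ U.erase x = nbA G v \ U := by
        ext z; by_cases hz : z = x <;> simp [hz, hxv]
      have e2 : nbA G v ∩ U.erase x = nbA G v ∩ U := by
        ext z; by_cases hz : z = x <;> simp [hz, hxv]
      rw [e1, e2, himg]; exact hv

lemma finishA {V : Type*} [Fintype V] (G : SimpleGraph V) (L : V → Finset ℕ)
    (hL : ∀ v, 8 ≤ (L v).card) (n : ℕ) : ∀ (U : Finset V) (φ : V → ℕ), U.card = n →
    QA G φ U → (∀ v, φ v ∈ L v) → (∀ v ∈ U, (nbA G v).card ≤ 2) → Dyn3ListColorable G L := by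
  induction n with
  | zero =>
    intro U φ hU hQ hφ _
    rw [Finset.card_eq_zero] at hU
    subst hU
    exact ⟨φ, (QA_empty G φ).1 hQ, hφ⟩
  | succ n ih =>
    intro U φ hU hQ hφ hd
    obtain ⟨x, hx⟩ : U.Nonempty := by rw [← Finset.card_pos]; omega
    obtain ⟨c, hc, hQ'⟩ := stepA G φ U hQ x hx (L x) (hL x) (by
      have := Finset.sum_le_card_nsmul (nbA G x) (fun y => (badA G φ U y).card) 3
        (fun y _ => badA_le3 G φ U y)
      have := hd x hx
      simp only [smul_eq_mul] at *
      omega)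
    refine ih (U.erase x) _ (by rw [Finset.card_erase_of_mem hx]; omega) hQ' ?_ ?_
    · intro v
      by_cases h : v = x
      · subst h; simpa using hc
      · rw [Function.update_of_ne h]; exact hφ v
    · intro v hv; exact hd v (Finset.mem_of_mem_erase hv)

def delA {V : Type*} (G : SimpleGraph V) (S : Finset V) : SimpleGraph V where
  Adj x y := G.Adj x y ∧ x ∉ S ∧ y ∉ S
  symm := ⟨fun _ _ h => ⟨h.1.symm, h.2.2, h.2.1⟩⟩
  loopless := ⟨fun _ h => h.1.ne rfl⟩

lemma initA {V : Type*} [Fintype V] (G : SimpleGraph V) (S U : Finset V) (hSU : S ⊆ U)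
    (φ : V → ℕ) (hφ : IsDyn3Coloring (delA G S) φ)
    (hS : ∀ v ∈ S, (nbA G v \ U).card ≤ 1) : QA G φ U := by
  rw [← QA_empty] at hφ
  refine ⟨fun x y h hx hy => hφ.1 x y ⟨h, fun h' => hx (hSU h'), fun h' => hy (hSU h')⟩
    (by simp) (by simp), fun v => ?_⟩
  have hcard := Finset.card_sdiff_add_card_inter (nbA G v) U
  by_cases hv : v ∈ S
  · have h1 := hS v hv
    have : ((nbA G v \ U).image φ).card = (nbA G v \ U).card := by
      apply Finset.card_image_of_injOn
      intro a ha b hb _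
      exact Finset.card_le_one.1 h1 a ha b hb
    omega
  · have h2 := hφ.2 v
    have e : nbA (delA G S) v = nbA G v \ S := by
      ext z; simp [mem_nbA, delA, hv]
    rw [e] at h2
    simp only [Finset.sdiff_empty, Finset.inter_empty, Finset.card_empty, add_zero] at h2
    have e2 : nbA G v \ S = (nbA G v \ U) ∪ (nbA G v ∩ (U \ S)) := by
      ext z
      have := @hSU z
      simp only [Finset.mem_sdiff, Finset.mem_union, Finset.mem_inter]; tauto
    have e3 : nbA G v ∩ U = (nbA G v ∩ (U \ S)) ∪ (nbA G v ∩ S) := by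
      ext z
      have := @hSU z
      simp only [Finset.mem_sdiff, Finset.mem_union, Finset.mem_inter]; tauto
    have c3 : (nbA G v ∩ U).card = (nbA G v ∩ (U \ S)).card + (nbA G v ∩ S).card := by
      rw [e3, Finset.card_union_of_disjoint]
      rw [Finset.disjoint_left]; intro z; simp; tauto
    have c4 := Finset.card_sdiff_add_card_inter (nbA G v) S
    have c5 : ((nbA G v \ S).image φ).card ≤
        ((nbA G v \ U).image φ).card + (nbA G v ∩ (U \ S)).card := by
      rw [e2, Finset.image_union]
      refine (Finset.card_union_le _ _).trans ?_
      have := Finset.card_image_le (s := nbA G v ∩ (U \ S)) (f := φ)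
      omega
    omega

lemma delA_lt {V : Type*} (G : SimpleGraph V) (S : Finset V) (x y : V) (hx : x ∈ S)
    (h : G.Adj x y) : delA G S < G := by
  refine lt_of_le_of_ne (fun a b h => h.1) ?_
  intro he
  rw [← he] at h
  exact h.2.1 hx

lemma dischA {V : Type*} [Fintype V] (G : SimpleGraph V)
    (h1 : ∀ v, (nbA G v).card ≠ 1)
    (h2 : ∀ v, ((nbA G v).filter (fun y => (nbA G y).card ≤ 2)).card ≠ 0 →
      8 + 2 * ((nbA G v).filter (fun y => (nbA G y).card ≤ 2)).card ≤ 3 * (nbA G v).card) :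
    3 * (Finset.univ.filter (fun v => (nbA G v).card ≠ 0)).card ≤ ∑ v, (nbA G v).card := by
  have hk : ∑ v, ((nbA G v).filter (fun y => (nbA G y).card ≤ 2)).card
      = ∑ v, if (nbA G v).card = 2 then 2 else 0 := by
    have a : ∀ v, ((nbA G v).filter (fun y => (nbA G y).card ≤ 2)).card
        = ∑ y, if G.Adj v y ∧ (nbA G y).card ≤ 2 then 1 else 0 := by
      intro v
      rw [Finset.card_eq_sum_ones, nbA, Finset.filter_filter, Finset.sum_filter]
    simp only [a]
    rw [Finset.sum_comm]
    refine Finset.sum_congr rfl fun y _ => ?_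
    have b : (∑ x, if G.Adj x y ∧ (nbA G y).card ≤ 2 then 1 else 0)
        = if (nbA G y).card ≤ 2 then (nbA G y).card else 0 := by
      split_ifs with h
      · simp only [h, and_true]
        rw [← Finset.sum_filter, ← Finset.card_eq_sum_ones]
        congr 1; ext z; simp [mem_nbA, G.adj_comm]
      · simp [h]
    rw [b]
    have := h1 y
    split_ifs <;> omega
  have hs : ∑ v, ((if (nbA G v).card ≠ 0 then 6 else 0)
      + ((nbA G v).filter (fun y => (nbA G y).card ≤ 2)).card)
      ≤ ∑ v, (2 * (nbA G v).card + if (nbA G v).card = 2 then 2 else 0) := by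
    refine Finset.sum_le_sum fun v _ => ?_
    have := h1 v
    have := h2 v
    have := Finset.card_filter_le (nbA G v) (fun y => (nbA G y).card ≤ 2)
    split_ifs <;> omega
  rw [Finset.sum_add_distrib, Finset.sum_add_distrib, hk, ← Finset.mul_sum,
    ← Finset.sum_filter, Finset.sum_const, smul_eq_mul] at hs
  omega

lemma madA {V : Type*} [Fintype V] (G G' : SimpleGraph V) (hle : G' ≤ G) (h : MadLT G 3)
    (x y : V) (hxy : G'.Adj x y) :
    ∑ v, (nbA G' v).card < 3 * (Finset.univ.filter (fun v => (nbA G' v).card ≠ 0)).card := by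
  have key := h
    { verts := {v | (nbA G' v).card ≠ 0}
      Adj := G'.Adj
      adj_sub := fun h => hle h
      edge_vert := fun {a b} h => by
        simp only [Set.mem_setOf_eq, ne_eq, Finset.card_eq_zero]
        intro he
        have := (mem_nbA G' a b).2 h
        simp [he] at this
      symm := ⟨fun _ _ h => h.symm⟩ } ⟨x, by
        simp only [Set.mem_setOf_eq, ne_eq, Finset.card_eq_zero]
        intro he
        have := (mem_nbA G' x y).2 hxy
        simp [he] at this⟩
  have hs : ∑ v, (nbA G' v).card = 2 * G'.edgeSet.ncard := by
    rw [← SimpleGraph.coe_edgeFinset, Set.ncard_coe_finset,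
      ← SimpleGraph.sum_degrees_eq_twice_card_edges]
    refine Finset.sum_congr rfl fun v _ => ?_
    rw [← SimpleGraph.card_neighborFinset_eq_degree]
    congr 1; ext z; simp [mem_nbA]
  have hv : ({v | (nbA G' v).card ≠ 0} : Set V).ncard
      = (Finset.univ.filter (fun v => (nbA G' v).card ≠ 0)).card := by
    rw [← Set.ncard_coe_finset]; simp
  have hpos : 0 < (Finset.univ.filter (fun v => (nbA G' v).card ≠ 0)).card := by
    rw [Finset.card_pos]
    refine ⟨x, ?_⟩
    simp only [Finset.mem_filter, Finset.mem_univ, true_and, ne_eq, Finset.card_eq_zero]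
    intro he
    have := (mem_nbA G' x y).2 hxy
    simp [he] at this
  change (2 * (G'.edgeSet.ncard : ℚ)) / (({v | (nbA G' v).card ≠ 0} : Set V).ncard : ℚ) < 3 at key
  rw [hv, div_lt_iff₀ (by exact_mod_cast hpos)] at key
  rw [hs]
  exact_mod_cast key

lemma mainA {V : Type*} [Fintype V] (G : SimpleGraph V) (h : MadLT G 3)
    (L : V → Finset ℕ) (hL : ∀ v, 8 ≤ (L v).card) (G' : SimpleGraph V) :
    G' ≤ G → Dyn3ListColorable G' L := by
  induction G' using WellFoundedLT.induction with
  | ind G' ih =>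
  intro hle
  by_cases h1 : ∃ v, (nbA G' v).card = 1
  · obtain ⟨v, hv⟩ := h1
    obtain ⟨w, hw⟩ := Finset.card_pos.1 (by omega : 0 < (nbA G' v).card)
    rw [mem_nbA] at hw
    have hlt := delA_lt G' {v} v w (by simp) hw
    obtain ⟨φ, hφ, hφL⟩ := ih _ hlt (hlt.le.trans hle)
    refine finishA G' L hL _ {v} φ rfl (initA G' {v} {v} subset_rfl φ hφ ?_) hφL ?_
    · intro z hz
      rw [Finset.mem_singleton] at hz; subst hz
      exact (Finset.card_le_card Finset.sdiff_subset).trans hv.le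
    · intro z hz
      rw [Finset.mem_singleton] at hz; subst hz
      omega
  by_cases h2 : ∃ v, ((nbA G' v).filter (fun y => (nbA G' y).card ≤ 2)).card ≠ 0 ∧
      3 * (nbA G' v).card < 8 + 2 * ((nbA G' v).filter (fun y => (nbA G' y).card ≤ 2)).card
  · obtain ⟨u, hk, hu⟩ := h2
    set S := (nbA G' u).filter (fun y => (nbA G' y).card ≤ 2) with hS
    obtain ⟨w, hw⟩ := Finset.card_pos.1 (Nat.pos_of_ne_zero hk)
    have hmS : ∀ y, y ∈ S ↔ G'.Adj u y ∧ (nbA G' y).card ≤ 2 := by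
      intro y; rw [hS, Finset.mem_filter, mem_nbA]
    have huS : u ∉ S := by
      intro h; exact ((hmS u).1 h).1.ne rfl
    have hlt := delA_lt G' S w u hw ((hmS w).1 hw).1.symm
    obtain ⟨φ, hφ, hφL⟩ := ih _ hlt (hlt.le.trans hle)
    have hQ : QA G' φ (insert u S) := by
      refine initA G' S _ (Finset.subset_insert _ _) φ hφ ?_
      intro v hv
      have : (nbA G' v \ insert u S).card < (nbA G' v).card := by
        apply Finset.card_lt_card
        refine ⟨Finset.sdiff_subset, fun h => ?_⟩
        have := h ((mem_nbA G' v u).2 ((hmS v).1 hv).1.symm)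
        simp at this
      have := ((hmS v).1 hv).2
      omega
    obtain ⟨c, hc, hQ'⟩ := stepA G' φ _ hQ u (Finset.mem_insert_self _ _) (L u) (hL u) (by
      rw [← Finset.sum_filter_add_sum_filter_not (nbA G' u) (fun y => (nbA G' y).card ≤ 2), ← hS]
      have a1 := Finset.sum_le_card_nsmul S (fun y => (badA G' φ (insert u S) y).card) 1
        (fun y hy => badA_le1 G' φ _ u y (Finset.mem_insert_self _ _)
          (Finset.mem_insert_of_mem hy) ((hmS y).1 hy).1 ((hmS y).1 hy).2)
      have a2 := Finset.sum_le_card_nsmul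
        ((nbA G' u).filter (fun y => ¬ (nbA G' y).card ≤ 2))
        (fun y => (badA G' φ (insert u S) y).card) 3 (fun y _ => badA_le3 G' φ _ y)
      have a3 := Finset.card_filter_add_card_filter_not (s := nbA G' u)
        (fun y => (nbA G' y).card ≤ 2)
      rw [← hS] at a3
      simp only [smul_eq_mul] at a1 a2
      omega)
    rw [Finset.erase_insert huS] at hQ'
    refine finishA G' L hL _ S _ rfl hQ' ?_ (fun v hv => ((hmS v).1 hv).2)
    intro v
    by_cases h : v = u
    · subst h; simpa using hc
    · rw [Function.update_of_ne h]; exact hφL v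
  by_cases h3 : ∃ x y, G'.Adj x y
  · exfalso
    obtain ⟨x, y, hxy⟩ := h3
    push Not at h1 h2
    have := madA G G' hle h x y hxy
    have := dischA G' h1 h2
    omega
  · push Not at h3
    have hne : ∀ v, ∃ c, c ∈ L v := fun v =>
      Finset.card_pos.1 (by have := hL v; omega)
    choose φ hφ using hne
    refine ⟨φ, (QA_empty G' φ).1 ⟨fun x y h => absurd h (h3 x y), fun v => ?_⟩, hφ⟩
    have : nbA G' v = ∅ := by
      ext z; simp [mem_nbA, h3]
    simp [this]

end Aux

theorem mad_lt_implies_ch3d_le_eight {V : Type*} [Fintype V] (G : SimpleGraph V)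
    (h : MadLT G 3) : Ch3dLE G 8 := by
  exact fun L hL => mainA G h L hL G le_rfl
end

section
/- Let k ≥ 6 and let G be a finite simple graph with ch_3^d(G) > k such that every proper subgraph H of G (obtained from G by deleting at least one vertex or at least one edge) satisfies ch_3^d(H) ≤ k. Then no two vertices of G of degree at most 2 are adjacent. -/
open SimpleGraph

lemma aux_other {V : Type*} [Fintype V] (N : Set V) (u v : V) (huv : u ≠ v) (h : N.ncard ≤ 2)
    (hv : v ∈ N) (hu : u ∉ N) : ∃ a, a ≠ u ∧ N ⊆ {v, a} := by
  have h1 : (N \ {v}).ncard ≤ 1 := by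
    have := Set.ncard_sdiff_singleton_add_one hv (Set.toFinite N)
    omega
  rcases Set.eq_empty_or_nonempty (N \ {v}) with h0 | ⟨a, ha⟩
  · refine ⟨v, huv.symm, fun x hx => ?_⟩
    by_contra hx'
    have : x ∈ N \ {v} := ⟨hx, by simpa using hx'⟩
    rw [h0] at this
    exact this
  · refine ⟨a, fun e => hu (e ▸ ha.1), fun x hx => ?_⟩
    by_cases hxv : x = v
    · simp [hxv]
    · have := (Set.ncard_le_one (Set.toFinite _)).1 h1 x ⟨hx, hxv⟩ a ha
      simp [this]

lemma aux_pick {V : Type*} [Fintype V] (φ : V → ℕ) (M : Set V) (L T : Finset ℕ) (hL : 6 ≤ L.card)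
    (hT : T.card ≤ 3) : ∃ c ∈ L, c ∉ T ∧ (M.ncard ≤ 2 → ∀ y ∈ M, c ≠ φ y) := by
  classical
  by_cases hM : M.ncard ≤ 2
  · have hc : (T ∪ M.toFinset.image φ).card < L.card := by
      have h1 := Finset.card_union_le T (M.toFinset.image φ)
      have h2 : (M.toFinset.image φ).card ≤ M.toFinset.card := Finset.card_image_le
      rw [← Set.ncard_eq_toFinset_card'] at h2
      omega
    obtain ⟨c, hc1, hc2⟩ := Finset.exists_mem_notMem_of_card_lt_card hc
    refine ⟨c, hc1, fun h => hc2 (Finset.mem_union_left _ h), fun _ y hy e => hc2 ?_⟩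
    exact Finset.mem_union_right _ (Finset.mem_image.2 ⟨y, by simpa using hy, e.symm⟩)
  · obtain ⟨c, hc1, hc2⟩ := Finset.exists_mem_notMem_of_card_lt_card (s := T) (t := L) (by omega)
    exact ⟨c, hc1, hc2, fun h => absurd h hM⟩

theorem min_counterexample_no_adjacent_low_vertices {V : Type*} [Fintype V]
    (G : SimpleGraph V) (k : ℕ) (hk : 6 ≤ k) (hG : ¬ Ch3dLE G k)
    (hmin : ProperSubgraphsCh3dLE G k) :
    ∀ u v : V, (G.neighborSet u).ncard ≤ 2 → (G.neighborSet v).ncard ≤ 2 →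
      ¬ G.Adj u v := by
  classical
  intro u v hu hv huv
  apply hG
  intro L hL
  have hne : u ≠ v := huv.ne
  obtain ⟨a, hau, ha⟩ := aux_other (G.neighborSet u) u v hne hu huv (by simp)
  obtain ⟨b, hbv, hb⟩ := aux_other (G.neighborSet v) v u hne.symm hv huv.symm (by simp)
  let H : G.Subgraph := (⊤ : G.Subgraph).induce {u, v}ᶜ
  have hH : H ≠ ⊤ := by
    intro e
    have : u ∈ H.verts := by rw [e]; trivial
    simp [H] at this
  obtain ⟨ψ, ⟨hψ1, hψ2⟩, hψL⟩ := hmin H hH (fun x => L x.1) (fun x => hL x.1)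
  have hmem : ∀ x, x ≠ u → x ≠ v → x ∈ H.verts := by
    intro x h1 h2; simp [H, h1, h2]
  have hmem' : ∀ x, x ∈ H.verts → x ≠ u ∧ x ≠ v := by
    intro x h; simpa [H] using h
  let φ0 : V → ℕ := fun x => if h : x ∈ H.verts then ψ ⟨x, h⟩ else 0
  have hφ0 : ∀ x : H.verts, φ0 x.1 = ψ x := by intro x; simp [φ0]
  have hproper : ∀ x y, x ≠ u → x ≠ v → y ≠ u → y ≠ v → G.Adj x y → φ0 x ≠ φ0 y := by
    intro x y h1 h2 h3 h4 h
    have := hψ1 ⟨x, hmem x h1 h2⟩ ⟨y, hmem y h3 h4⟩ (by simp [H, h1, h2, h3, h4, h])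
    rwa [← hφ0, ← hφ0] at this
  have hdyn : ∀ x, x ≠ u → x ≠ v → min 3 (G.neighborSet x \ {u, v}).ncard ≤
      (φ0 '' (G.neighborSet x \ {u, v})).ncard := by
    intro x h1 h2
    have h := hψ2 ⟨x, hmem x h1 h2⟩
    have e : G.neighborSet x \ {u, v} =
        Subtype.val '' (H.coe.neighborSet ⟨x, hmem x h1 h2⟩) := by
      ext y
      constructor
      · rintro ⟨hy1, hy2⟩
        simp only [Set.mem_insert_iff, Set.mem_singleton_iff, not_or] at hy2
        have hy3 : G.Adj x y := hy1
        exact ⟨⟨y, hmem y hy2.1 hy2.2⟩, by simp [H, h1, h2, hy2, hy3], rfl⟩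
      · rintro ⟨z, hz, rfl⟩
        have h4 := hmem' z.1 z.2
        have h5 : H.Adj x z.1 := hz
        exact ⟨h5.adj_sub, by simp [h4]⟩
    rw [e, Set.ncard_image_of_injective _ Subtype.val_injective, Set.image_image]
    simpa only [hφ0] using h
  obtain ⟨cu, hcuL, hcuT, hcuS⟩ := aux_pick φ0 (G.neighborSet a \ {u, v}) (L u) {φ0 a, φ0 b}
    (hk.trans (hL u)) (by have := Finset.card_le_two (a := φ0 a) (b := φ0 b); omega)
  obtain ⟨cv, hcvL, hcvT, hcvS⟩ := aux_pick φ0 (G.neighborSet b \ {u, v}) (L v) {φ0 a, φ0 b, cu}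
    (hk.trans (hL v)) Finset.card_le_three
  simp only [Finset.mem_insert, Finset.mem_singleton, not_or] at hcuT hcvT
  let φ : V → ℕ := fun x => if x = u then cu else if x = v then cv else φ0 x
  have φu : φ u = cu := by simp [φ]
  have φv : φ v = cv := by simp [φ, hne.symm]
  have φo : ∀ x, x ≠ u → x ≠ v → φ x = φ0 x := by intro x h1 h2; simp [φ, h1, h2]
  have nu : ∀ y, G.Adj u y → y = v ∨ y = a := fun y hy => by simpa using ha hy
  have nv : ∀ y, G.Adj v y → y = u ∨ y = b := fun y hy => by simpa using hb hy
  have pu : ∀ y, G.Adj u y → φ u ≠ φ y := by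
    intro y hy
    have hyu : y ≠ u := hy.ne.symm
    by_cases hyv : y = v
    · subst hyv; rw [φu, φv]; exact fun e => hcvT.2.2 e.symm
    · rcases nu y hy with h | h
      · exact absurd h hyv
      · rw [φu, φo y hyu hyv, h]; exact hcuT.1
  have pv : ∀ y, G.Adj v y → φ v ≠ φ y := by
    intro y hy
    have hyv : y ≠ v := hy.ne.symm
    by_cases hyu : y = u
    · subst hyu; rw [φu, φv]; exact hcvT.2.2
    · rcases nv y hy with h | h
      · exact absurd h hyu
      · rw [φv, φo y hyu hyv, h]; exact hcvT.2.1
  have inj : ∀ x, Set.InjOn φ (G.neighborSet x) →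
      min 3 (G.neighborSet x).ncard ≤ (φ '' G.neighborSet x).ncard := by
    intro x hx
    rw [hx.ncard_image]; exact min_le_right _ _
  refine ⟨φ, ⟨?_, ?_⟩, ?_⟩
  · intro x y hxy
    by_cases hxu : x = u
    · subst hxu; exact pu y hxy
    by_cases hxv : x = v
    · subst hxv; exact pv y hxy
    by_cases hyu : y = u
    · subst hyu; exact (pu x hxy.symm).symm
    by_cases hyv : y = v
    · subst hyv; exact (pv x hxy.symm).symm
    rw [φo x hxu hxv, φo y hyu hyv]
    exact hproper x y hxu hxv hyu hyv hxy
  · intro x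
    by_cases hxu : x = u
    · subst hxu
      have key : G.Adj x a → a ≠ v → φ v ≠ φ a := by
        intro h1 h2
        rw [φv, φo a hau h2]; exact hcvT.1
      apply inj
      intro y hy z hz e
      have hy' : G.Adj x y := hy
      have hz' : G.Adj x z := hz
      rcases nu y hy' with h | h <;> rcases nu z hz' with h' | h' <;> subst h <;>
        first | exact h'.symm | skip
      · subst h'
        by_contra hc
        exact key hz' (fun h => hc h.symm) e
      · subst h'
        by_contra hc
        exact key hy' hc e.symm
    by_cases hxv : x = v
    · subst hxv
      have key : G.Adj x b → b ≠ u → φ u ≠ φ b := by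
        intro h1 h2
        rw [φu, φo b h2 hbv]; exact hcuT.2
      apply inj
      intro y hy z hz e
      have hy' : G.Adj x y := hy
      have hz' : G.Adj x z := hz
      rcases nv y hy' with h | h <;> rcases nv z hz' with h' | h' <;> subst h <;>
        first | exact h'.symm | skip
      · subst h'
        by_contra hc
        exact key hz' (fun h => hc h.symm) e
      · subst h'
        by_contra hc
        exact key hy' hc e.symm
    have hd := hdyn x hxu hxv
    have him : φ '' (G.neighborSet x \ {u, v}) = φ0 '' (G.neighborSet x \ {u, v}) := by
      apply Set.image_congr
      intro y hy
      have h2 := hy.2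
      simp only [Set.mem_insert_iff, Set.mem_singleton_iff, not_or] at h2
      exact φo y h2.1 h2.2
    by_cases h3 : (G.neighborSet x \ {u, v}).ncard ≤ 2
    · have hi0 : Set.InjOn φ0 (G.neighborSet x \ {u, v}) := by
        apply Set.injOn_of_ncard_image_eq _ (Set.toFinite _)
        have := Set.ncard_image_le (f := φ0) (Set.toFinite (G.neighborSet x \ {u, v}))
        omega
      have ku : G.Adj x u → ∀ y, G.Adj x y → y ≠ u → y ≠ v → φ u ≠ φ y := by
        intro h y hy h1 h2
        rcases nu x h.symm with h' | h'
        · exact absurd h' hxv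
        · subst h'
          rw [φu, φo y h1 h2]
          exact hcuS h3 y ⟨hy, by simp [h1, h2]⟩
      have kv : G.Adj x v → ∀ y, G.Adj x y → y ≠ u → y ≠ v → φ v ≠ φ y := by
        intro h y hy h1 h2
        rcases nv x h.symm with h' | h'
        · exact absurd h' hxu
        · subst h'
          rw [φv, φo y h1 h2]
          exact hcvS h3 y ⟨hy, by simp [h1, h2]⟩
      have kuv := pu v huv
      apply inj
      intro y hy z hz e
      have hy' : G.Adj x y := hy
      have hz' : G.Adj x z := hz
      by_cases hyu : y = u <;> by_cases hyv : y = v <;> by_cases hzu : z = u <;>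
        by_cases hzv : z = v <;> try grind
      exact hi0 ⟨hy, by simp [hyu, hyv]⟩ ⟨hz, by simp [hzu, hzv]⟩
        (by rwa [φo y hyu hyv, φo z hzu hzv] at e)
    · have hm : (φ '' (G.neighborSet x \ {u, v})).ncard ≤ (φ '' G.neighborSet x).ncard :=
        Set.ncard_le_ncard (Set.image_mono Set.diff_subset) (Set.toFinite _)
      rw [him] at hm
      omega
  · intro x
    by_cases hxu : x = u
    · subst hxu; rw [φu]; exact hcuL
    by_cases hxv : x = v
    · subst hxv; rw [φv]; exact hcvL
    rw [φo x hxu hxv]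
    have := hψL ⟨x, hmem x hxu hxv⟩
    rwa [← hφ0] at this
end

section
/- Let k ≥ 6 and let G be a finite simple graph with ch_3^d(G) > k such that every proper subgraph H of G (obtained from G by deleting at least one vertex or at least one edge) satisfies ch_3^d(H) ≤ k. Then no two adjacent vertices of G have a common neighbor of degree 2. -/
open SimpleGraph

lemma restrict_del {V : Type*} [Fintype V] (G : SimpleGraph V) (k : ℕ)
    (hmin : ProperSubgraphsCh3dLE G k) (w : V) (L : V → Finset ℕ)
    (hL : ∀ v, k ≤ (L v).card) :
    ∃ f : V → ℕ, (∀ v, v ≠ w → f v ∈ L v) ∧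
      (∀ u v, u ≠ w → v ≠ w → G.Adj u v → f u ≠ f v) ∧
      ∀ v, v ≠ w → min 3 (G.neighborSet v \ {w}).ncard ≤
        (f '' (G.neighborSet v \ {w})).ncard := by
  classical
  let H : G.Subgraph := (⊤ : G.Subgraph).deleteVerts {w}
  have hv : ∀ v, v ∈ H.verts ↔ v ≠ w := by intro v; simp [H]
  have ha : ∀ u v, H.Adj u v ↔ u ≠ w ∧ v ≠ w ∧ G.Adj u v := by
    intro u v; simp [H, SimpleGraph.Subgraph.deleteVerts_adj]
  have hH : H ≠ ⊤ := by
    intro h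
    have : w ∈ H.verts := by rw [h]; trivial
    exact (hv w).1 this rfl
  obtain ⟨φ, ⟨h1, h2⟩, h3⟩ := hmin H hH (fun v => L v.1) (fun v => hL v.1)
  let f : V → ℕ := fun v => if h : v ∈ H.verts then φ ⟨v, h⟩ else 0
  have hf : ∀ v : H.verts, f v.1 = φ v := by
    intro v; simp only [f]; rw [dif_pos v.2]
  refine ⟨f, ?_, ?_, ?_⟩
  · intro v hvw
    have := h3 ⟨v, (hv v).2 hvw⟩
    rw [← hf] at this; exact this
  · intro u v hu hvw huv
    have := h1 ⟨u, (hv u).2 hu⟩ ⟨v, (hv v).2 hvw⟩ ((ha u v).2 ⟨hu, hvw, huv⟩)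
    rw [← hf, ← hf] at this; exact this
  · intro v hvw
    have := h2 ⟨v, (hv v).2 hvw⟩
    have e1 : Subtype.val '' (H.coe.neighborSet ⟨v, (hv v).2 hvw⟩) = G.neighborSet v \ {w} := by
      ext u
      constructor
      · rintro ⟨⟨u, hu⟩, hu', rfl⟩
        have := (ha v u).1 hu'
        exact ⟨this.2.2, this.2.1⟩
      · rintro ⟨hu, hu'⟩
        exact ⟨⟨u, (hv u).2 hu'⟩, (ha v u).2 ⟨hvw, hu', hu⟩, rfl⟩
    have e2 : φ '' (H.coe.neighborSet ⟨v, (hv v).2 hvw⟩) = f '' (G.neighborSet v \ {w}) := by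
      rw [← e1, Set.image_image]
      exact Set.image_congr (fun a _ => (hf a).symm)
    rw [e2] at this
    rw [← e1, Set.ncard_image_of_injective _ Subtype.val_injective, e1]
    exact this

/-- The colors to avoid because of one endpoint. -/
lemma avoid_set {V : Type*} [Fintype V] [DecidableEq V] (f : V → ℕ) (N : Set V) (y w : V) (hw : w ∈ N)
    (hy : y ∈ N) (hyw : y ≠ w)
    (hN : min 3 (N \ {w}).ncard ≤ (f '' (N \ {w})).ncard) :
    ∃ A : Finset ℕ, A.card ≤ 2 ∧ f y ∈ A ∧ ∀ c, c ∉ A →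
      min 3 N.ncard ≤ (Function.update f w c '' N).ncard := by
  classical
  have hc : ∀ c, Function.update f w c '' N = insert c (f '' (N \ {w})) := by
    intro c
    have e : N = insert w (N \ {w}) := by simp [Set.insert_eq_of_mem hw]
    conv_lhs => rw [e]
    rw [Set.image_insert_eq, Function.update_self]
    congr 1
    apply Set.image_congr
    intro a ha
    exact Function.update_of_ne ha.2 _ _
  have hfin : (f '' (N \ {w})).Finite := Set.toFinite _
  have hcard : (N \ {w}).ncard + 1 = N.ncard := Set.ncard_diff_singleton_add_one hw
  by_cases h : (f '' (N \ {w})).ncard ≤ 2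
  · refine ⟨hfin.toFinset, ?_, ?_, ?_⟩
    · rwa [← Set.ncard_eq_toFinset_card _ hfin]
    · rw [Set.Finite.mem_toFinset]; exact ⟨y, ⟨hy, hyw⟩, rfl⟩
    · intro c hcA
      rw [Set.Finite.mem_toFinset] at hcA
      rw [hc, Set.ncard_insert_of_notMem hcA hfin]
      omega
  · refine ⟨{f y}, by simp, by simp, ?_⟩
    intro c _
    have : (f '' (N \ {w})).ncard ≤ (Function.update f w c '' N).ncard := by
      rw [hc]; exact Set.ncard_le_ncard (Set.subset_insert _ _) (hfin.insert _)
    omega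

theorem min_counterexample_no_common_two_neighbor {V : Type*} [Fintype V]
    (G : SimpleGraph V) (k : ℕ) (hk : 6 ≤ k) (hG : ¬ Ch3dLE G k)
    (hmin : ProperSubgraphsCh3dLE G k) :
    ∀ x y w : V, G.Adj x y → G.Adj x w → G.Adj y w →
      (G.neighborSet w).ncard ≠ 2 := by
  classical
  intro x y w hxy hxw hyw h2
  apply hG
  intro L hL
  obtain ⟨f, hf1, hf2, hf3⟩ := restrict_del G k hmin w L hL
  have hNw : G.neighborSet w = {x, y} := by
    symm
    apply Set.eq_of_subset_of_ncard_le
    · rintro a (rfl | rfl)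
      · exact hxw.symm
      · exact hyw.symm
    · rw [h2, Set.ncard_pair hxy.ne]
    · exact Set.toFinite _
  obtain ⟨A, hA, hyA, hA'⟩ := avoid_set f (G.neighborSet x) y w hxw hxy hyw.ne (hf3 x hxw.ne)
  obtain ⟨B, hB, hxB, hB'⟩ := avoid_set f (G.neighborSet y) x w hyw hxy.symm hxw.ne (hf3 y hyw.ne)
  have hlt : (A ∪ B).card < (L w).card := by
    have := Finset.card_union_le A B
    have := hL w
    omega
  obtain ⟨c, hcL, hc⟩ := Finset.exists_mem_notMem_of_card_lt_card hlt
  rw [Finset.mem_union, not_or] at hc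
  have hcx : c ≠ f x := fun h => hc.2 (h ▸ hxB)
  have hcy : c ≠ f y := fun h => hc.1 (h ▸ hyA)
  have hnb : ∀ v, G.Adj w v → c ≠ f v := by
    intro v hv
    have : v ∈ G.neighborSet w := hv
    rw [hNw] at this
    rcases this with rfl | rfl
    · exact hcx
    · exact hcy
  refine ⟨Function.update f w c, ⟨?_, ?_⟩, ?_⟩
  · intro u v huv
    by_cases hu : u = w
    · subst hu
      rw [Function.update_self, Function.update_of_ne huv.ne']
      exact hnb v huv
    · by_cases hv : v = w
      · subst hv
        rw [Function.update_self, Function.update_of_ne hu]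
        exact (hnb u huv.symm).symm
      · rw [Function.update_of_ne hu, Function.update_of_ne hv]
        exact hf2 u v hu hv huv
  · intro v
    by_cases hvx : v = x
    · subst hvx; exact hA' c hc.1
    by_cases hvy : v = y
    · subst hvy; exact hB' c hc.2
    by_cases hvw : v = w
    · subst hvw
      rw [h2, hNw, Set.image_pair, Function.update_of_ne hxw.ne, Function.update_of_ne hyw.ne,
        Set.ncard_pair (hf2 x y hxw.ne hyw.ne hxy)]
      simp
    · have hwv : w ∉ G.neighborSet v := by
        intro h
        have : v ∈ G.neighborSet w := G.adj_symm h
        rw [hNw] at this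
        rcases this with h | h
        · exact hvx h
        · exact hvy h
      have := hf3 v hvw
      rw [Set.diff_singleton_eq_self hwv] at this
      have e : Function.update f w c '' G.neighborSet v = f '' G.neighborSet v := by
        apply Set.image_congr
        intro a ha
        have hne : a ≠ w := by rintro rfl; exact hwv ha
        exact Function.update_of_ne hne _ _
      rw [e]; exact this
  · intro v
    by_cases hv : v = w
    · subst hv; rw [Function.update_self]; exact hcL
    · rw [Function.update_of_ne hv]; exact hf1 v hv
end

section
/- Let k ≥ 6 and let G be a finite simple graph with ch_3^d(G) > k such that every proper subgraph H of G (obtained from G by deleting at least one vertex or at least one edge) satisfies ch_3^d(H) ≤ k. Let i ∈ {1,2,3} and let x be a vertex of degree 3 having exactly i neighbors of degree 2, say w_1, …, w_i, and for each j let u_j be the neighbor of w_j other than x. Then u_1, …, u_i are pairwise distinct (that is, x has i distinct weak neighbors). -/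
open SimpleGraph

theorem aux_restrict {V : Type*} [Fintype V] (G : SimpleGraph V) (k : ℕ)
    (hmin : ProperSubgraphsCh3dLE G k) (S : Set V) (hS : S.Nonempty)
    (L : V → Finset ℕ) (hL : ∀ v, k ≤ (L v).card) :
    ∃ φ : V → ℕ, (∀ u v, u ∉ S → v ∉ S → G.Adj u v → φ u ≠ φ v) ∧
      (∀ v, v ∉ S → min 3 (G.neighborSet v \ S).ncard ≤ (φ '' (G.neighborSet v \ S)).ncard) ∧
      ∀ v, v ∉ S → φ v ∈ L v := by
  classical
  let H : G.Subgraph := (⊤ : G.Subgraph).induce Sᶜ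
  have hverts : H.verts = Sᶜ := rfl
  have hne : H ≠ ⊤ := by
    intro h
    obtain ⟨s, hs⟩ := hS
    have h1 : s ∈ H.verts := by rw [h]; trivial
    rw [hverts] at h1
    exact h1 hs
  obtain ⟨ψ, ⟨hp, hd⟩, hl⟩ := hmin H hne (fun v => L v.1) (fun v => hL v.1)
  have hadj : ∀ a b : H.verts, H.coe.Adj a b ↔ G.Adj a.1 b.1 := by
    rintro ⟨a, ha⟩ ⟨b, hb⟩
    rw [hverts] at ha hb
    simp only [Set.mem_compl_iff] at ha hb
    simp [H, ha, hb]
  let φ : V → ℕ := fun v => if h : v ∈ H.verts then ψ ⟨v, h⟩ else 0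
  have hφ : ∀ v : H.verts, φ v.1 = ψ v := by
    intro v
    simp [φ, v.2]
  refine ⟨φ, ?_, ?_, ?_⟩
  · intro u v hu hv h
    have := hp ⟨u, hu⟩ ⟨v, hv⟩ ((hadj _ _).2 h)
    rw [← hφ, ← hφ] at this
    exact this
  · intro v hv
    have h1 := hd ⟨v, hv⟩
    have h2 : G.neighborSet v \ S = Subtype.val '' (H.coe.neighborSet ⟨v, hv⟩) := by
      ext y
      constructor
      · rintro ⟨h, hy⟩
        exact ⟨⟨y, hy⟩, (hadj _ _).2 h, rfl⟩
      · rintro ⟨y, h, rfl⟩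
        exact ⟨(hadj _ _).1 h, y.2⟩
    have h3 : φ '' (G.neighborSet v \ S) = ψ '' (H.coe.neighborSet ⟨v, hv⟩) := by
      rw [h2, Set.image_image]
      exact Set.image_congr (fun y _ => hφ y)
    rw [h3, h2, Set.ncard_image_of_injective _ Subtype.val_injective]
    exact h1
  · intro v hv
    have := hl ⟨v, hv⟩
    rw [← hφ] at this
    exact this

theorem aux_one (n : ℕ) (C : Set ℕ) (hC : C.Finite) (h : min 3 n ≤ C.ncard) :
    ∃ A : Finset ℕ, A.card ≤ 2 ∧ ∀ c, c ∉ A → min 3 (n + 1) ≤ (insert c C).ncard := by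
  by_cases h3 : 3 ≤ C.ncard
  · refine ⟨∅, by simp, fun c _ => ?_⟩
    have := Set.ncard_le_ncard (Set.subset_insert c C) (hC.insert c)
    omega
  · refine ⟨hC.toFinset, ?_, fun c hc => ?_⟩
    · rw [← Set.ncard_eq_toFinset_card C hC]; omega
    · have hc' : c ∉ C := by simpa using hc
      rw [Set.ncard_insert_of_notMem hc' hC]; omega

theorem aux_two (n : ℕ) (C : Set ℕ) (hC : C.Finite) (h : min 3 n ≤ C.ncard) :
    ∃ A B : Finset ℕ, A.card ≤ 2 ∧ B.card ≤ 1 ∧ ∀ b c, b ∉ A → c ∉ B → b ≠ c →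
      min 3 (n + 2) ≤ (insert b (insert c C)).ncard := by
  have hle : ∀ b c, C.ncard ≤ (insert c C).ncard ∧ 
      (insert b C).ncard ≤ (insert b (insert c C)).ncard ∧ 
      (insert c C).ncard ≤ (insert b (insert c C)).ncard := fun b c =>
    ⟨Set.ncard_le_ncard (Set.subset_insert c C) (hC.insert c),
     Set.ncard_le_ncard (Set.insert_subset_insert (Set.subset_insert c C)) ((hC.insert c).insert b),
     Set.ncard_le_ncard (Set.subset_insert b _) ((hC.insert c).insert b)⟩
  have hcard := Set.ncard_eq_toFinset_card C hC
  by_cases h3 : 3 ≤ C.ncard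
  · refine ⟨∅, ∅, by simp, by simp, fun b c _ _ _ => ?_⟩
    have := hle b c
    omega
  · by_cases h2 : 2 ≤ C.ncard
    · refine ⟨hC.toFinset, ∅, by omega, by simp, fun b c hb _ _ => ?_⟩
      have hb' : b ∉ C := by simpa using hb
      have := hle b c
      have := Set.ncard_insert_of_notMem hb' hC
      omega
    · refine ⟨hC.toFinset, hC.toFinset, by omega, by omega, fun b c hb hc hbc => ?_⟩
      have hb' : b ∉ C := by simpa using hb
      have hc' : c ∉ C := by simpa using hc
      have hb2 : b ∉ insert c C := by simp [hbc, hb']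
      rw [Set.ncard_insert_of_notMem hb2 (hC.insert c), Set.ncard_insert_of_notMem hc' hC]
      omega

theorem aux_pick_s6 (A F : Finset ℕ) (k m : ℕ) (hA : k ≤ A.card) (hF : F.card ≤ m) (hm : m < k) :
    ∃ a ∈ A, a ∉ F := by
  by_contra! h
  have := Finset.card_le_card (show A ⊆ F from h)
  omega

theorem min_counterexample_distinct_weak_neighbors {V : Type*} [Fintype V]
    (G : SimpleGraph V) (k : ℕ) (hk : 6 ≤ k) (hG : ¬ Ch3dLE G k)
    (hmin : ProperSubgraphsCh3dLE G k) :
    ∀ i ∈ ({1, 2, 3} : Set ℕ), ∀ x : V, Wmem G i x →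
      ∀ w₁ w₂ u₁ u₂ : V, w₁ ≠ w₂ →
        G.Adj x w₁ → G.Adj x w₂ →
        (G.neighborSet w₁).ncard = 2 → (G.neighborSet w₂).ncard = 2 →
        G.Adj w₁ u₁ → u₁ ≠ x → G.Adj w₂ u₂ → u₂ ≠ x →
        u₁ ≠ u₂ := by
  classical
  rintro - - x ⟨hx3, -⟩ w₁ w₂ u u' hw hxw1 hxw2 hd1 hd2 hu1 hux hu2 - rfl
  apply hG
  intro L hL
  have hN1 : G.neighborSet w₁ = {x, u} := by
    symm
    apply Set.eq_of_subset_of_ncard_le _ _ (Set.toFinite _)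
    · rintro y (rfl | rfl)
      exacts [hxw1.symm, hu1]
    · rw [hd1, Set.ncard_pair hux.symm]
  have hN2 : G.neighborSet w₂ = {x, u} := by
    symm
    apply Set.eq_of_subset_of_ncard_le _ _ (Set.toFinite _)
    · rintro y (rfl | rfl)
      exacts [hxw2.symm, hu2]
    · rw [hd2, Set.ncard_pair hux.symm]
  obtain ⟨z, hxz, hz⟩ : ∃ z, G.Adj x z ∧ z ∉ ({w₁, w₂} : Set V) := by
    by_contra! h
    have := Set.ncard_le_ncard (show G.neighborSet x ⊆ {w₁, w₂} from h) (Set.toFinite _)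
    rw [hx3, Set.ncard_pair hw] at this
    omega
  have hz1 : z ≠ w₁ := fun h => hz (by simp [h])
  have hz2 : z ≠ w₂ := fun h => hz (by simp [h])
  have h3 : ∀ {α : Type _} (a b c : α), a ≠ b → a ≠ c → b ≠ c → ({a, b, c} : Set α).ncard = 3 := by
    intro α a b c hab hac hbc
    exact Set.ncard_eq_three.2 ⟨a, b, c, hab, hac, hbc, rfl⟩
  have h3' : ∀ (a b c : ℕ), a ≠ b → a ≠ c → b ≠ c → ({a, b, c} : Set ℕ).ncard = 3 := by
    intro a b c hab hac hbc
    exact Set.ncard_eq_three.2 ⟨a, b, c, hab, hac, hbc, rfl⟩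
  have hNx : G.neighborSet x = {w₁, w₂, z} := by
    symm
    apply Set.eq_of_subset_of_ncard_le _ _ (Set.toFinite _)
    · rintro y (rfl | rfl | rfl)
      exacts [hxw1, hxw2, hxz]
    · rw [hx3, h3 _ _ _ hw hz1.symm hz2.symm]
  have hx1 := hxw1.ne
  have hx2 := hxw2.ne
  have hzx := hxz.ne'
  have huw1 := hu1.ne'
  have huw2 := hu2.ne'
  have a1 : ∀ y, G.Adj w₁ y ↔ y = x ∨ y = u := fun y => by
    rw [← SimpleGraph.mem_neighborSet, hN1]; simp
  have a2 : ∀ y, G.Adj w₂ y ↔ y = x ∨ y = u := fun y => by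
    rw [← SimpleGraph.mem_neighborSet, hN2]; simp
  have ax : ∀ y, G.Adj x y ↔ y = w₁ ∨ y = w₂ ∨ y = z := fun y => by
    rw [← SimpleGraph.mem_neighborSet, hNx]; simp
  obtain ⟨φ, hp, hd, hl⟩ := aux_restrict G k hmin {x, w₁, w₂} ⟨x, by simp⟩ L hL
  set S : Set V := {x, w₁, w₂} with hSdef
  have hmS : ∀ v, v ∉ S ↔ v ≠ x ∧ v ≠ w₁ ∧ v ≠ w₂ := by intro v; simp [hSdef]
  have hzS : z ∉ S := (hmS z).2 ⟨hzx, hz1, hz2⟩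
  have huS : u ∉ S := (hmS u).2 ⟨hux, huw1, huw2⟩
  obtain ⟨A, hA, hA'⟩ := aux_one _ _ (Set.toFinite _) (hd z hzS)
  obtain ⟨B, C, hB, hC, hBC⟩ := aux_two _ _ (Set.toFinite _) (hd u huS)
  obtain ⟨a, haL, haF⟩ := aux_pick_s6 (L x) (insert (φ z) (insert (φ u) A)) k 4 (hL x)
    (by have := Finset.card_insert_le (φ z) (insert (φ u) A)
        have := Finset.card_insert_le (φ u) A
        omega) (by omega)
  obtain ⟨b, hbL, hbF⟩ := aux_pick_s6 (L w₁) (insert a (insert (φ z) (insert (φ u) B))) k 5 (hL _)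
    (by have := Finset.card_insert_le a (insert (φ z) (insert (φ u) B))
        have := Finset.card_insert_le (φ z) (insert (φ u) B)
        have := Finset.card_insert_le (φ u) B
        omega) (by omega)
  obtain ⟨c, hcL, hcF⟩ := aux_pick_s6 (L w₂)
    (insert b (insert a (insert (φ z) (insert (φ u) C)))) k 5 (hL _)
    (by have := Finset.card_insert_le b (insert a (insert (φ z) (insert (φ u) C)))
        have := Finset.card_insert_le a (insert (φ z) (insert (φ u) C))
        have := Finset.card_insert_le (φ z) (insert (φ u) C)
        have := Finset.card_insert_le (φ u) C
        omega) (by omega)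
  simp only [Finset.mem_insert, not_or] at haF hbF hcF
  obtain ⟨haz, hau, haA⟩ := haF
  obtain ⟨hba, hbz, hbu, hbB⟩ := hbF
  obtain ⟨hcb, hca, hcz, hcu, hcC⟩ := hcF
  obtain ⟨f, fx, f1, f2, fo⟩ : ∃ f : V → ℕ, f x = a ∧ f w₁ = b ∧ f w₂ = c ∧
      ∀ v, v ∉ S → f v = φ v := by
    refine ⟨fun v => if v = x then a else if v = w₁ then b else if v = w₂ then c else φ v,
      by simp, by simp [hx1.symm], by simp [hx2.symm, hw.symm], ?_⟩
    intro v hv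
    obtain ⟨h1, h2, h3⟩ := (hmS v).1 hv
    simp [h1, h2, h3]
  have fz := fo z hzS
  have fu := fo u huS
  have himg : ∀ v, f '' (G.neighborSet v \ S) = φ '' (G.neighborSet v \ S) := fun v =>
    Set.image_congr (fun y hy => fo y hy.2)
  have hcases : ∀ v, v = x ∨ v = w₁ ∨ v = w₂ ∨ v ∉ S := by
    intro v; rw [hmS]; tauto
  have px : ∀ y, G.Adj x y → f x ≠ f y := by
    intro y hy
    rcases (ax y).1 hy with rfl | rfl | rfl
    · rw [fx, f1]; exact fun h => hba h.symm
    · rw [fx, f2]; exact fun h => hca h.symm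
    · rw [fx, fz]; exact haz
  have p1 : ∀ y, G.Adj w₁ y → f w₁ ≠ f y := by
    intro y hy
    rcases (a1 y).1 hy with rfl | rfl
    · rw [fx, f1]; exact hba
    · rw [f1, fu]; exact hbu
  have p2 : ∀ y, G.Adj w₂ y → f w₂ ≠ f y := by
    intro y hy
    rcases (a2 y).1 hy with rfl | rfl
    · rw [fx, f2]; exact hca
    · rw [f2, fu]; exact hcu
  refine ⟨f, ⟨?_, ?_⟩, ?_⟩
  · intro v y h
    rcases hcases v with rfl | rfl | rfl | hv
    · exact px y h
    · exact p1 y h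
    · exact p2 y h
    rcases hcases y with rfl | rfl | rfl | hy
    · exact (px v h.symm).symm
    · exact (p1 v h.symm).symm
    · exact (p2 v h.symm).symm
    rw [fo v hv, fo y hy]
    exact hp v y hv hy h
  · intro v
    rcases hcases v with rfl | rfl | rfl | hv
    · rw [hNx]
      simp only [Set.image_insert_eq, Set.image_singleton, f1, f2, fz]
      rw [h3' _ _ _ (Ne.symm hcb) hbz hcz]
      exact min_le_left _ _
    · rw [hd1, hN1]
      simp only [Set.image_insert_eq, Set.image_singleton, fx, fu]
      rw [Set.ncard_pair hau]; simp
    · rw [hd2, hN2]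
      simp only [Set.image_insert_eq, Set.image_singleton, fx, fu]
      rw [Set.ncard_pair hau]; simp
    have hvm := (hmS v).1 hv
    have mx : G.Adj v x ↔ v = z := by
      rw [G.adj_comm, ax]; simp [hvm.2.1, hvm.2.2]
    have m1 : G.Adj v w₁ ↔ v = u := by
      rw [G.adj_comm, a1]; simp [hvm.1]
    have m2 : G.Adj v w₂ ↔ v = u := by
      rw [G.adj_comm, a2]; simp [hvm.1]
    by_cases hvz : v = z
    · by_cases hvu : v = u
      · have hsub : ({a, b, c} : Set ℕ) ⊆ f '' G.neighborSet v := by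
          rintro y (rfl | rfl | rfl)
          · exact ⟨x, mx.2 hvz, fx⟩
          · exact ⟨w₁, m1.2 hvu, f1⟩
          · exact ⟨w₂, m2.2 hvu, f2⟩
        have := Set.ncard_le_ncard hsub (Set.toFinite _)
        rw [h3' _ _ _ (Ne.symm hba) (Ne.symm hca) (Ne.symm hcb)] at this
        exact (min_le_left _ _).trans this
      · have hN : G.neighborSet v = insert x (G.neighborSet v \ S) := by
          ext y
          simp only [Set.mem_insert_iff, Set.mem_sdiff, SimpleGraph.mem_neighborSet, hmS]
          constructor
          · intro h
            by_cases hyx : y = x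
            · exact Or.inl hyx
            · refine Or.inr ⟨h, hyx, ?_, ?_⟩
              · rintro rfl; exact hvu (m1.1 h)
              · rintro rfl; exact hvu (m2.1 h)
          · rintro (rfl | h)
            exacts [mx.2 hvz, h.1]
        rw [hN, Set.image_insert_eq, himg, fx,
          Set.ncard_insert_of_notMem (by simp [hSdef]) (Set.toFinite _)]
        subst hvz
        exact hA' a haA
    · by_cases hvu : v = u
      · have hN : G.neighborSet v = insert w₁ (insert w₂ (G.neighborSet v \ S)) := by
          ext y
          simp only [Set.mem_insert_iff, Set.mem_sdiff, SimpleGraph.mem_neighborSet, hmS]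
          constructor
          · intro h
            by_cases h1 : y = w₁
            · exact Or.inl h1
            by_cases h2 : y = w₂
            · exact Or.inr (Or.inl h2)
            refine Or.inr (Or.inr ⟨h, ?_, h1, h2⟩)
            rintro rfl; exact hvz (mx.1 h)
          · rintro (rfl | rfl | h)
            exacts [m1.2 hvu, m2.2 hvu, h.1]
        rw [hN, Set.image_insert_eq, Set.image_insert_eq, himg, f1, f2,
          Set.ncard_insert_of_notMem (by simp [hSdef, hw]) (Set.toFinite _),
          Set.ncard_insert_of_notMem (by simp [hSdef]) (Set.toFinite _)]
        subst hvu
        exact hBC b c hbB hcC (Ne.symm hcb)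
      · have hN : G.neighborSet v \ S = G.neighborSet v := by
          ext y
          simp only [Set.mem_sdiff, SimpleGraph.mem_neighborSet, hmS]
          constructor
          · exact fun h => h.1
          · intro h
            refine ⟨h, ?_, ?_, ?_⟩
            · rintro rfl; exact hvz (mx.1 h)
            · rintro rfl; exact hvu (m1.1 h)
            · rintro rfl; exact hvu (m2.1 h)
        have h1 := hd v hv
        rw [← himg, hN] at h1
        exact h1
  · intro v
    rcases hcases v with rfl | rfl | rfl | hv
    · rw [fx]; exact haL
    · rw [f1]; exact hbL
    · rw [f2]; exact hcL
    · rw [fo v hv]; exact hl v hv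
end

section
/- Let H be the graph K_4 minus one edge, with vertices v_1, v_2, v_3, v_4 where the missing edge is v_1v_4 (so v_2 and v_3 are adjacent to everything else and to each other). For every list assignment L with |L(v_1)| ≥ 2, |L(v_2)| ≥ 3, |L(v_3)| ≥ 2, and |L(v_4)| ≥ 2, the graph H admits a proper coloring φ with φ(v) ∈ L(v) for every vertex v. -/
open SimpleGraph

/-- `K₄` minus the edge `v₁v₄` (vertices `0,1,2,3` standing for `v₁,v₂,v₃,v₄`). -/
def K4minusEdge : SimpleGraph (Fin 4) :=
  (⊤ : SimpleGraph (Fin 4)).deleteEdges {s(0, 3)}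

theorem K4aux_pick (A : Finset ℕ) (h : 2 ≤ A.card) (a : ℕ) : ∃ x ∈ A, x ≠ a :=
  Finset.exists_mem_ne (by omega) a

theorem K4aux_pick2 (A : Finset ℕ) (h : 3 ≤ A.card) (a b : ℕ) :
    ∃ x ∈ A, x ≠ a ∧ x ≠ b := by
  have h1 := Finset.pred_card_le_card_erase (s := A) (a := a)
  obtain ⟨x, hx, hb⟩ := K4aux_pick (A.erase a) (by omega) b
  rw [Finset.mem_erase] at hx
  exact ⟨x, hx.2, hx.1, hb⟩

theorem K4aux (A B C D : Finset ℕ) (hA : 2 ≤ A.card) (hB : 3 ≤ B.card)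
    (hC : 2 ≤ C.card) (hD : 2 ≤ D.card) :
    ∃ a ∈ A, ∃ b ∈ B, ∃ c ∈ C, ∃ d ∈ D, a ≠ b ∧ a ≠ c ∧ b ≠ c ∧ b ≠ d ∧ c ≠ d := by
  by_cases h : ∃ x, x ∈ A ∧ x ∈ D
  · obtain ⟨x, hxA, hxD⟩ := h
    obtain ⟨c, hc, hcx⟩ := K4aux_pick C hC x
    obtain ⟨b, hb, hbx, hbc⟩ := K4aux_pick2 B hB x c
    exact ⟨x, hxA, b, hb, c, hc, x, hxD, hbx.symm, hcx.symm, hbc, hbx, hcx⟩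
  · obtain ⟨c, hc, -⟩ := K4aux_pick C hC 0
    by_cases hcD : c ∈ D
    · have hcA : c ∉ A := fun hh => h ⟨c, hh, hcD⟩
      obtain ⟨d, hd, hdc⟩ := K4aux_pick D hD c
      obtain ⟨b, hb, hbc, hbd⟩ := K4aux_pick2 B hB c d
      obtain ⟨a, ha, hab⟩ := K4aux_pick A hA b
      exact ⟨a, ha, b, hb, c, hc, d, hd, hab, fun e => hcA (e ▸ ha), hbc, hbd, hdc.symm⟩
    · obtain ⟨a, ha, hac⟩ := K4aux_pick A hA c
      obtain ⟨b, hb, hbc, hba⟩ := K4aux_pick2 B hB c a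
      obtain ⟨d, hd, hdb⟩ := K4aux_pick D hD b
      exact ⟨a, ha, b, hb, c, hc, d, hd, hba.symm, hac, hbc, hdb.symm, fun e => hcD (e ▸ hd)⟩

theorem K4_minus_edge_choosable (L : Fin 4 → Finset ℕ)
    (h0 : 2 ≤ (L 0).card) (h1 : 3 ≤ (L 1).card)
    (h2 : 2 ≤ (L 2).card) (h3 : 2 ≤ (L 3).card) :
    ∃ φ : Fin 4 → ℕ, (∀ u v, K4minusEdge.Adj u v → φ u ≠ φ v) ∧
      ∀ v, φ v ∈ L v := by
  obtain ⟨a, ha, b, hb, c, hc, d, hd, hab, hac, hbc, hbd, hcd⟩ :=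
    K4aux (L 0) (L 1) (L 2) (L 3) h0 h1 h2 h3
  refine ⟨![a, b, c, d], ?_, ?_⟩
  · intro u v huv
    fin_cases u <;> fin_cases v <;>
      simp_all [K4minusEdge, SimpleGraph.deleteEdges_adj, eq_comm]
  · intro v
    fin_cases v <;> simpa
end
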